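/- Let 1 < c < 16/15. Then every sufficiently large positive integer n can be represented in the form ⌊m^c⌋ + ⌊p^c⌋ = n, where m is a positive integer, p is a prime number, and ⌊θ⌋ denotes the integer part of θ. -/

import Mathlib

open Finset

/-- The additive character `e(x) = exp (2πix)`. -/
noncomputable def unitExp (x : ℝ) : ℂ := Complex.exp ((2 * Real.pi * x : ℝ) * Complex.I)

theorem norm_unitExp (x : ℝ) : ‖unitExp x‖ = 1 := Complex.norm_exp_ofReal_mul_I _

theorem unitExp_add (x y : ℝ) : unitExp (x + y) = unitExp x * unitExp y := by
  rw [unitExp, unitExp, unitExp, ← Complex.exp_add]; congr 1; push_cast; ring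

theorem unitExp_zero : unitExp 0 = 1 := by simp [unitExp]

theorem conj_unitExp (x : ℝ) : (starRingEnd ℂ) (unitExp x) = unitExp (-x) := by
  rw [unitExp, unitExp, ← Complex.exp_conj, map_mul, Complex.conj_ofReal, Complex.conj_I]
  congr 1; push_cast; ring

theorem unitExp_intCast (k : ℤ) : unitExp k = 1 := by
  rw [unitExp, Complex.exp_eq_one_iff]
  exact ⟨k, by push_cast; ring⟩

theorem unitExp_eq (x : ℝ) :
    unitExp x = (1 - 2 * (Real.sin (Real.pi * x)) ^ 2 : ℝ) +
      (2 * Real.sin (Real.pi * x) * Real.cos (Real.pi * x) : ℝ) * Complex.I := by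
  have h : 2 * Real.pi * x = 2 * (Real.pi * x) := by ring
  rw [unitExp, Complex.exp_mul_I, ← Complex.ofReal_cos, ← Complex.ofReal_sin, h,
    Real.cos_two_mul, Real.sin_two_mul]
  have := Real.sin_sq_add_cos_sq (Real.pi * x)
  have h2 : 2 * Real.cos (Real.pi * x) ^ 2 - 1 = 1 - 2 * Real.sin (Real.pi * x) ^ 2 := by linarith
  rw [h2]

theorem norm_one_sub_unitExp (x : ℝ) : ‖1 - unitExp x‖ = 2 * |Real.sin (Real.pi * x)| := by
  have h1 : 1 - unitExp x = ((2 * Real.sin (Real.pi * x) : ℝ) : ℂ) *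
      (-Complex.I * Complex.exp ((Real.pi * x : ℝ) * Complex.I)) := by
    rw [unitExp_eq, Complex.exp_mul_I, ← Complex.ofReal_cos, ← Complex.ofReal_sin]
    push_cast
    linear_combination (2 * (Complex.sin (Real.pi * x)) ^ 2) * Complex.I_sq
  rw [h1, norm_mul, norm_mul, Complex.norm_exp_ofReal_mul_I, Complex.norm_real]
  simp

theorem two_mul_le_sin_pi_mul {x δ : ℝ} (hδ : 0 ≤ δ) (h1 : δ ≤ x) (h2 : x ≤ 1 - δ) :
    2 * δ ≤ Real.sin (Real.pi * x) := by
  have hπ := Real.pi_pos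
  rcases le_total x (1 / 2) with h | h
  · have := Real.mul_le_sin (x := Real.pi * x) (by nlinarith) (by nlinarith)
    rw [show 2 / Real.pi * (Real.pi * x) = 2 * x by field_simp] at this
    linarith
  · have := Real.mul_le_sin (x := Real.pi * (1 - x)) (by nlinarith) (by nlinarith)
    rw [show 2 / Real.pi * (Real.pi * (1 - x)) = 2 * (1 - x) by field_simp,
      show Real.pi * (1 - x) = Real.pi - Real.pi * x by ring, Real.sin_pi_sub] at this
    linarith

theorem four_mul_abs_sub_round_le (x : ℝ) : 4 * |x - round x| ≤ ‖1 - unitExp x‖ := by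
  have h1 : unitExp x = unitExp (x - round x) := by
    conv_lhs => rw [show x = (x - round x) + ((round x : ℤ) : ℝ) by ring, unitExp_add,
      unitExp_intCast, mul_one]
  rw [h1, norm_one_sub_unitExp]
  have h2 := abs_sub_round x
  set z := x - round x
  have h3 : |Real.sin (Real.pi * z)| = |Real.sin (Real.pi * |z|)| := by
    rcases abs_choice z with h | h <;> rw [h]
    rw [mul_neg, Real.sin_neg, abs_neg]
  rw [h3]
  have := two_mul_le_sin_pi_mul (abs_nonneg z) le_rfl (by linarith)
  have := le_abs_self (Real.sin (Real.pi * |z|))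
  linarith

/-- The function `1 / (1 - e(x))`, written through the cotangent. -/
noncomputable def resolventExp (x : ℝ) : ℂ :=
  1 / 2 + (Real.cos (Real.pi * x) / Real.sin (Real.pi * x) / 2 : ℝ) * Complex.I

theorem resolventExp_mul {x : ℝ} (h : Real.sin (Real.pi * x) ≠ 0) :
    resolventExp x * (1 - unitExp x) = 1 := by
  rw [unitExp_eq, resolventExp]
  have h' : (Real.sin (Real.pi * x) : ℂ) ≠ 0 := by exact_mod_cast h
  have := Real.sin_sq_add_cos_sq (Real.pi * x)
  have h2 : (Real.sin (Real.pi * x) : ℂ) ^ 2 + (Real.cos (Real.pi * x) : ℂ) ^ 2 = 1 := by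
    exact_mod_cast this
  push_cast at h' h2 ⊢
  field_simp
  linear_combination (2 * (Complex.sin (Real.pi * x))) * h2 -
    2 * Complex.cos (Real.pi * x) ^ 2 * Complex.sin (Real.pi * x) * (Complex.I_sq)

theorem norm_resolventExp_le {x δ : ℝ} (hδ : 0 < δ) (h1 : δ ≤ x) (h2 : x ≤ 1 - δ) :
    ‖resolventExp x‖ ≤ 1 / (4 * δ) := by
  have hs := two_mul_le_sin_pi_mul hδ.le h1 h2
  have hm := resolventExp_mul (x := x) (by linarith)
  have hn : ‖resolventExp x‖ * (2 * |Real.sin (Real.pi * x)|) = 1 := by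
    rw [← norm_one_sub_unitExp, ← norm_mul, hm, norm_one]
  rw [abs_of_pos (by linarith)] at hn
  rw [le_div_iff₀ (by linarith)]
  nlinarith [norm_nonneg (resolventExp x)]

theorem norm_resolventExp_sub_le {x y δ : ℝ} (hδ : 0 < δ) (h1 : δ ≤ x) (hxy : x ≤ y)
    (h2 : y ≤ 1 - δ) :
    ‖resolventExp y - resolventExp x‖ ≤ (resolventExp x).im - (resolventExp y).im := by
  have hx := two_mul_le_sin_pi_mul hδ.le h1 (hxy.trans h2)
  have hy := two_mul_le_sin_pi_mul hδ.le (h1.trans hxy) h2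
  have him : ∀ t, (resolventExp t).im = Real.cos (Real.pi * t) / Real.sin (Real.pi * t) / 2 := by
    intro t; simp [resolventExp, -Complex.ofReal_div]
  have hd : resolventExp y - resolventExp x =
      (((resolventExp y).im - (resolventExp x).im : ℝ) : ℂ) * Complex.I := by
    rw [him, him, resolventExp, resolventExp]; push_cast; ring
  have hmono : (resolventExp y).im ≤ (resolventExp x).im := by
    rw [him, him]
    have hs : 0 ≤ Real.sin (Real.pi * y - Real.pi * x) := by
      apply Real.sin_nonneg_of_nonneg_of_le_pi <;> nlinarith [Real.pi_pos]
    rw [Real.sin_sub] at hs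
    rw [div_div, div_div, div_le_div_iff₀ (by linarith) (by linarith)]
    nlinarith
  rw [hd, norm_mul, Complex.norm_I, mul_one, Complex.norm_real, Real.norm_eq_abs, abs_sub_comm,
    abs_of_nonneg (by linarith)]

/-- The Kusmin–Landau inequality. -/
theorem norm_sum_unitExp_le_of_monotone {f : ℕ → ℝ} {a b : ℕ} {k : ℤ} {δ : ℝ} (hδ : 0 < δ)
    (hmono : ∀ n, a ≤ n → n + 1 < b → f (n + 1) - f n ≤ f (n + 2) - f (n + 1))
    (hl : ∀ n, a ≤ n → n < b → k + δ ≤ f (n + 1) - f n)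
    (hu : ∀ n, a ≤ n → n < b → f (n + 1) - f n ≤ k + 1 - δ) :
    ‖∑ n ∈ Ico a b, unitExp (f n)‖ ≤ 1 / δ := by
  rcases le_or_gt b a with hab | hab
  · rw [Ico_eq_empty (by omega)]; simp [hδ.le]
  set g : ℕ → ℝ := fun n => f (n + 1) - f n - k with hg
  have hstep : ∀ n, unitExp (f (n + 1)) = unitExp (f n) * unitExp (g n) := by
    intro n
    rw [← unitExp_add, show f n + g n = f (n + 1) + ((-k : ℤ) : ℝ) by
      simp only [hg]; push_cast; ring, unitExp_add, unitExp_intCast, mul_one]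
  have key : ∀ n, a ≤ n → n < b →
      ‖∑ i ∈ Ico a (n + 1), unitExp (f i) + unitExp (f (n + 1)) * resolventExp (g n)‖ ≤
        ‖resolventExp (g a)‖ + ((resolventExp (g a)).im - (resolventExp (g n)).im) := by
    have hres : ∀ n, a ≤ n → n < b →
        resolventExp (g n) * (1 - unitExp (g n)) = 1 := by
      intro n h1 h2
      refine resolventExp_mul (ne_of_gt ?_)
      have := two_mul_le_sin_pi_mul (x := g n) hδ.le (by simp only [hg]; linarith [hl n h1 h2])
        (by simp only [hg]; linarith [hu n h1 h2])
      linarith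
    intro n han
    induction n, han using Nat.le_induction with
    | base =>
      intro hb
      rw [show Ico a (a + 1) = {a} by simp, sum_singleton, hstep a]
      have : unitExp (f a) + unitExp (f a) * unitExp (g a) * resolventExp (g a) =
          unitExp (f a) * resolventExp (g a) := by
        linear_combination (-unitExp (f a)) * hres a le_rfl hab
      rw [this, norm_mul, norm_unitExp]
      simp
    | succ n han ih =>
      intro hb
      have ih' := ih (by omega)
      rw [sum_Ico_succ_top (by omega)]
      have h1 : ∑ i ∈ Ico a (n + 1), unitExp (f i) + unitExp (f (n + 1)) +
          unitExp (f (n + 1 + 1)) * resolventExp (g (n + 1)) =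
          (∑ i ∈ Ico a (n + 1), unitExp (f i) + unitExp (f (n + 1)) * resolventExp (g n)) +
            unitExp (f (n + 1)) * (resolventExp (g (n + 1)) - resolventExp (g n)) := by
        rw [hstep (n + 1)]
        linear_combination (-unitExp (f (n + 1))) * hres (n + 1) (by omega) hb
      rw [h1]
      refine (norm_add_le _ _).trans ?_
      rw [norm_mul, norm_unitExp, one_mul]
      have := norm_resolventExp_sub_le (x := g n) (y := g (n + 1)) hδ
        (by simp only [hg]; linarith [hl n han (by omega)])
        (by simp only [hg]; linarith [hmono n han hb])
        (by simp only [hg]; linarith [hu (n + 1) (by omega) hb])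
      linarith
  obtain ⟨m, rfl⟩ : ∃ m, b = m + 1 := ⟨b - 1, by omega⟩
  have hm := key m (by omega) (by omega)
  have bnd : ∀ n, a ≤ n → n < m + 1 → ‖resolventExp (g n)‖ ≤ 1 / (4 * δ) := fun n h1 h2 =>
    norm_resolventExp_le hδ (by simp only [hg]; linarith [hl n h1 h2])
      (by simp only [hg]; linarith [hu n h1 h2])
  have ha := bnd a le_rfl hab
  have hmm := bnd m (by omega) (by omega)
  have i1 := (abs_le.1 (Complex.abs_im_le_norm (resolventExp (g a)))).2
  have i2 := (abs_le.1 (Complex.abs_im_le_norm (resolventExp (g m)))).1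
  have h3 : ‖∑ i ∈ Ico a (m + 1), unitExp (f i)‖ ≤
      ‖∑ i ∈ Ico a (m + 1), unitExp (f i) + unitExp (f (m + 1)) * resolventExp (g m)‖ +
        ‖resolventExp (g m)‖ := by
    have := norm_sub_le (∑ i ∈ Ico a (m + 1), unitExp (f i) +
      unitExp (f (m + 1)) * resolventExp (g m)) (unitExp (f (m + 1)) * resolventExp (g m))
    rw [norm_mul (unitExp _), norm_unitExp, one_mul, add_sub_cancel_right] at this
    exact this
  have : 1 / δ = 4 * (1 / (4 * δ)) := by field_simp
  linarith

theorem card_le_of_forall_sub_le {S : Finset ℕ} {B : ℝ} (hB : 0 ≤ B)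
    (h : ∀ m ∈ S, ∀ n ∈ S, m ≤ n → ((n : ℝ) - m) ≤ B) : (#S : ℝ) ≤ B + 1 := by
  rcases S.eq_empty_or_nonempty with rfl | hS
  · simp; linarith
  have h1 := h _ (S.min'_mem hS) _ (S.max'_mem hS) (S.min'_le_max' hS)
  have h2 : S ⊆ Icc (S.min' hS) (S.max' hS) := fun x hx =>
    mem_Icc.2 ⟨S.min'_le x hx, S.le_max' x hx⟩
  have h3 := card_le_card h2
  rw [Nat.card_Icc] at h3
  have h4 : (#S : ℝ) ≤ (S.max' hS : ℝ) + 1 - S.min' hS := by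
    rw [le_sub_iff_add_le]
    have := S.min'_le_max' hS
    exact_mod_cast (by omega : #S + S.min' hS ≤ S.max' hS + 1)
  linarith

theorem exists_eq_Ico_of_convex {S : Finset ℕ}
    (h : ∀ m ∈ S, ∀ n ∈ S, ∀ k, m ≤ k → k ≤ n → k ∈ S) : ∃ a b, S = Ico a b := by
  rcases S.eq_empty_or_nonempty with rfl | hS
  · exact ⟨0, 0, by simp⟩
  refine ⟨S.min' hS, S.max' hS + 1, ?_⟩
  ext x
  rw [mem_Ico]
  exact ⟨fun hx => ⟨S.min'_le x hx, Nat.lt_succ_of_le (S.le_max' x hx)⟩,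
    fun hx => h _ (S.min'_mem hS) _ (S.max'_mem hS) x hx.1 (Nat.le_of_lt_succ hx.2)⟩

/-- Van der Corput's second derivative test, for second differences. -/
theorem norm_sum_unitExp_le_of_second_difference {f : ℕ → ℝ} {N : ℕ} {lam A : ℝ}
    (hlam : 0 < lam) (hlam1 : lam ≤ 1) (hA : 1 ≤ A)
    (hl : ∀ n, n + 1 < N → lam ≤ (f (n + 2) - f (n + 1)) - (f (n + 1) - f n))
    (hu : ∀ n, n + 1 < N → (f (n + 2) - f (n + 1)) - (f (n + 1) - f n) ≤ A * lam) :
    ‖∑ n ∈ range N, unitExp (f n)‖ ≤ 4 * A * √lam * N + 8 / √lam := by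
  rcases Nat.eq_zero_or_pos N with rfl | hN
  · simp; positivity
  set g : ℕ → ℝ := fun n => f (n + 1) - f n with hg
  have hgap : ∀ m n, m ≤ n → n < N →
      lam * ((n : ℝ) - m) ≤ g n - g m ∧ g n - g m ≤ A * lam * ((n : ℝ) - m) := by
    intro m n hmn
    induction n, hmn using Nat.le_induction with
    | base => intro _; simp
    | succ n hmn ih =>
      intro hn
      have h0 := ih (by omega)
      have h1 := hl n hn
      have h2 := hu n hn
      simp only [hg] at h0 ⊢
      push_cast
      constructor <;> nlinarith
  have hsq : 0 < √lam := Real.sqrt_pos.2 hlam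
  have hsq1 : √lam ≤ 1 := Real.sqrt_le_one.2 hlam1
  have hss : √lam * √lam = lam := Real.mul_self_sqrt hlam.le
  set δ : ℝ := √lam / 2 with hδdef
  have hδ : 0 < δ := by positivity
  set κ : ℕ → ℤ := fun n => ⌊g n + δ⌋ with hκ
  have hκmem : ∀ n ∈ range N, κ n ∈ Icc (κ 0) (κ (N - 1)) := by
    intro n hn
    rw [mem_range] at hn
    have h1 := (hgap 0 n (by omega) hn).1
    have h2 := (hgap n (N - 1) (by omega) (by omega)).1
    have h3 : (n : ℝ) ≤ ((N - 1 : ℕ) : ℝ) := by exact_mod_cast (by omega : n ≤ N - 1)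
    rw [mem_Icc]
    constructor
    · apply Int.floor_le_floor
      have : 0 ≤ lam * ((n : ℝ) - (0 : ℕ)) := by simp; positivity
      linarith
    · apply Int.floor_le_floor
      have : 0 ≤ lam * (((N - 1 : ℕ) : ℝ) - n) := mul_nonneg hlam.le (by linarith)
      linarith
  rw [← sum_fiberwise_of_maps_to hκmem]
  have hcard : ((#(Icc (κ 0) (κ (N - 1))) : ℕ) : ℝ) ≤ A * lam * N + 2 := by
    rw [Int.card_Icc]
    have h0 : κ 0 ≤ κ (N - 1) := (mem_Icc.1 (hκmem 0 (mem_range.2 hN))).2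
    have h1 : (((κ (N - 1) + 1 - κ 0).toNat : ℤ) : ℝ) = κ (N - 1) + 1 - κ 0 := by
      rw [Int.toNat_of_nonneg (by omega)]; push_cast; ring
    have h1' : (((κ (N - 1) + 1 - κ 0).toNat : ℕ) : ℝ) = κ (N - 1) + 1 - κ 0 := by
      exact_mod_cast h1
    rw [h1']
    have h2 := Int.floor_le (g (N - 1) + δ)
    have h3 := Int.lt_floor_add_one (g 0 + δ)
    have h4 := (hgap 0 (N - 1) (by omega) (by omega)).2
    have h5 : ((N - 1 : ℕ) : ℝ) ≤ N := by exact_mod_cast (by omega : N - 1 ≤ N)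
    have h6 : A * lam * (((N - 1 : ℕ) : ℝ) - (0 : ℕ)) ≤ A * lam * N := by
      apply mul_le_mul_of_nonneg_left _ (by positivity)
      simp
    simp only [hκ]
    linarith
  have hfib : ∀ k : ℤ, ‖∑ n ∈ range N with κ n = k, unitExp (f n)‖ ≤ 4 / √lam := by
    intro k
    rw [← sum_filter_add_sum_filter_not _ (fun n => g n < k + δ)]
    have hP1 : ‖∑ n ∈ (range N).filter (fun n => κ n = k) with g n < k + δ, unitExp (f n)‖ ≤
        2 * δ / lam + 1 := by
      refine (norm_sum_le _ _).trans ?_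
      simp only [norm_unitExp, sum_const, nsmul_eq_mul, mul_one]
      apply card_le_of_forall_sub_le (by positivity)
      intro m hm n hn hmn
      simp only [mem_filter, mem_range] at hm hn
      have h1 := (hgap m n hmn hn.1.1).1
      have h2 := Int.floor_le (g m + δ)
      have h3 : (⌊g m + δ⌋ : ℝ) = k := by exact_mod_cast hm.1.2
      rw [le_div_iff₀ hlam]
      linarith [hn.2]
    have hP2 : ‖∑ n ∈ (range N).filter (fun n => κ n = k) with ¬ g n < k + δ, unitExp (f n)‖ ≤
        1 / δ := by
      obtain ⟨a, b, hab⟩ := exists_eq_Ico_of_convex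
        (S := ((range N).filter (fun n => κ n = k)).filter (fun n => ¬ g n < k + δ)) (by
          intro m hm n hn i hmi hin
          simp only [mem_filter, mem_range, not_lt] at hm hn ⊢
          have h1 := (hgap m i hmi (by omega)).1
          have h2 := (hgap i n hin (by omega)).1
          have h1' : (m : ℝ) ≤ i := by exact_mod_cast hmi
          have h2' : (i : ℝ) ≤ n := by exact_mod_cast hin
          have h3 : g m ≤ g i := by nlinarith
          have h4 : g i ≤ g n := by nlinarith
          refine ⟨⟨by omega, ?_⟩, by linarith [hm.2]⟩
          apply le_antisymm
          · rw [← hn.1.2]; apply Int.floor_le_floor; linarith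
          · rw [← hm.1.2]; apply Int.floor_le_floor; linarith)
      rw [hab]
      have hmem : ∀ n, a ≤ n → n < b → (n < N ∧ κ n = k) ∧ ¬ g n < k + δ := by
        intro n h1 h2
        have : n ∈ Ico a b := mem_Ico.2 ⟨h1, h2⟩
        rw [← hab] at this
        simpa only [mem_filter, mem_range] using this
      apply norm_sum_unitExp_le_of_monotone (k := k) hδ
      · intro n h1 h2
        have := hl n (hmem (n + 1) (by omega) h2).1.1
        linarith
      · intro n h1 h2
        have := (hmem n h1 h2).2
        simp only [hg] at this
        linarith
      · intro n h1 h2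
        have h3 := (hmem n h1 h2).1.2
        have h4 := Int.lt_floor_add_one (g n + δ)
        have h5 : (⌊g n + δ⌋ : ℝ) = k := by exact_mod_cast h3
        simp only [hg] at h4 h5
        linarith
    refine (norm_add_le _ _).trans ((add_le_add hP1 hP2).trans ?_)
    have e1 : 2 * δ / lam = 1 / √lam := by
      rw [div_eq_div_iff hlam.ne' hsq.ne', hδdef]; linarith
    have e2 : 1 / δ = 2 / √lam := by rw [hδdef]; field_simp
    have e3 : 1 ≤ 1 / √lam := by rw [le_div_iff₀ hsq]; linarith
    rw [e1, e2]
    have : 4 / √lam = 1 / √lam + 1 / √lam + 2 / √lam := by ring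
    linarith
  refine (norm_sum_le _ _).trans ((sum_le_sum fun k _ => hfib k).trans ?_)
  rw [sum_const, nsmul_eq_mul]
  refine (mul_le_mul_of_nonneg_right hcard (by positivity)).trans (le_of_eq ?_)
  have : A * lam * N * (4 / √lam) = 4 * A * √lam * N := by
    rw [div_eq_mul_inv]
    nth_rewrite 1 [← hss]
    field_simp
  rw [add_mul, this]; ring

theorem norm_sum_unitExp_neg (f : ℕ → ℝ) (S : Finset ℕ) :
    ‖∑ n ∈ S, unitExp (-f n)‖ = ‖∑ n ∈ S, unitExp (f n)‖ := by
  rw [← Complex.norm_conj (∑ n ∈ S, unitExp (f n)), map_sum]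
  simp only [conj_unitExp]

theorem exists_second_difference_eq {f f₁ f₂ : ℝ → ℝ} {x : ℝ}
    (h1 : ∀ t ∈ Set.Icc x (x + 2), HasDerivAt f (f₁ t) t)
    (h2 : ∀ t ∈ Set.Icc x (x + 2), HasDerivAt f₁ (f₂ t) t) :
    ∃ t ∈ Set.Icc x (x + 2), (f (x + 2) - f (x + 1)) - (f (x + 1) - f x) = f₂ t := by
  have hd : ∀ t ∈ Set.Icc x (x + 1),
      HasDerivAt (fun t => f (t + 1) - f t) (f₁ (t + 1) - f₁ t) t := by
    intro t ht
    exact ((h1 (t + 1) ⟨by linarith [ht.1], by linarith [ht.2]⟩).comp_add_const t 1).sub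
      (h1 t ⟨ht.1, by linarith [ht.2]⟩)
  obtain ⟨s, hs, hs'⟩ := exists_hasDerivAt_eq_slope (fun t => f (t + 1) - f t)
    (fun t => f₁ (t + 1) - f₁ t) (show x < x + 1 by linarith)
    (fun t ht => (hd t ht).continuousAt.continuousWithinAt)
    (fun t ht => hd t ⟨ht.1.le, ht.2.le⟩)
  have hmem : ∀ t ∈ Set.Icc s (s + 1), t ∈ Set.Icc x (x + 2) := fun t ht =>
    ⟨by linarith [ht.1, hs.1], by linarith [ht.2, hs.2]⟩
  obtain ⟨t, ht, ht'⟩ := exists_hasDerivAt_eq_slope f₁ f₂ (show s < s + 1 by linarith)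
    (fun t ht => (h2 t (hmem t ht)).continuousAt.continuousWithinAt)
    (fun t ht => h2 t (hmem t ⟨ht.1.le, ht.2.le⟩))
  refine ⟨t, hmem t ⟨ht.1.le, ht.2.le⟩, ?_⟩
  rw [ht', show s + 1 - s = 1 by ring, div_one, hs', show x + 1 - x = 1 by ring, div_one,
    show x + 1 + 1 = x + 2 by ring]

/-- Van der Corput's second derivative test. -/
theorem norm_sum_unitExp_le_of_second_deriv {f f₁ f₂ : ℝ → ℝ} {a b : ℕ} {lam A s : ℝ}
    (hlam : 0 < lam) (hA : 1 ≤ A) (hs : s = 1 ∨ s = -1)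
    (h1 : ∀ t ∈ Set.Icc ((a : ℝ) + 1) b, HasDerivAt f (f₁ t) t)
    (h2 : ∀ t ∈ Set.Icc ((a : ℝ) + 1) b, HasDerivAt f₁ (f₂ t) t)
    (hl : ∀ t ∈ Set.Icc ((a : ℝ) + 1) b, lam ≤ s * f₂ t)
    (hu : ∀ t ∈ Set.Icc ((a : ℝ) + 1) b, s * f₂ t ≤ A * lam) :
    ‖∑ m ∈ Ioc a b, unitExp (f m)‖ ≤ 4 * A * √lam * ((b - a : ℕ) : ℝ) + 9 / √lam := by
  have hsq : 0 < √lam := Real.sqrt_pos.2 hlam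
  rcases le_or_gt b a with hab | hab
  · rw [Ioc_eq_empty (by omega), sum_empty, norm_zero]; positivity
  rcases le_or_gt lam 1 with hlam1 | hlam1
  swap
  · refine (norm_sum_le _ _).trans ?_
    simp only [norm_unitExp, sum_const, nsmul_eq_mul, mul_one, Nat.card_Ioc]
    have : 1 ≤ √lam := Real.one_le_sqrt.2 hlam1.le
    have h3 : 1 ≤ 4 * A * √lam := by nlinarith
    have : 0 ≤ 9 / √lam := by positivity
    nlinarith [Nat.cast_nonneg (α := ℝ) (b - a)]
  have hneg : ‖∑ m ∈ Ioc a b, unitExp (f m)‖ = ‖∑ m ∈ Ioc a b, unitExp (s * f m)‖ := by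
    rcases hs with rfl | rfl
    · simp
    · simp only [neg_mul, one_mul, norm_sum_unitExp_neg (fun m => f m)]
  rw [hneg]
  obtain ⟨N, rfl⟩ : ∃ N, b = a + 1 + N := ⟨b - (a + 1), by omega⟩
  have hsum : ∑ m ∈ Ioc a (a + 1 + N), unitExp (s * f m) =
      ∑ n ∈ range N, unitExp (s * f ((a : ℝ) + 1 + n)) + unitExp (s * f ((a + 1 + N : ℕ) : ℝ)) := by
    rw [← Ico_add_one_add_one_eq_Ioc, sum_Ico_eq_sum_range,
      show a + 1 + N + 1 - (a + 1) = N + 1 by omega,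
      sum_range_succ]
    simp
  rw [hsum]
  refine (norm_add_le _ _).trans ?_
  rw [norm_unitExp]
  have hmain := norm_sum_unitExp_le_of_second_difference (N := N) (A := A)
    (f := fun n : ℕ => s * f ((a : ℝ) + 1 + n)) hlam hlam1 hA
  have hdiff : ∀ n : ℕ, n + 1 < N → ∃ t ∈ Set.Icc ((a : ℝ) + 1) (a + 1 + N : ℕ),
      (s * f ((a : ℝ) + 1 + (n + 2 : ℕ)) - s * f ((a : ℝ) + 1 + (n + 1 : ℕ))) -
      (s * f ((a : ℝ) + 1 + (n + 1 : ℕ)) - s * f ((a : ℝ) + 1 + n)) = s * f₂ t := by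
    intro n hn
    have hn' : (n : ℝ) + 2 ≤ N := by exact_mod_cast hn
    have hsub : ∀ t ∈ Set.Icc ((a : ℝ) + 1 + n) ((a : ℝ) + 1 + n + 2),
        t ∈ Set.Icc ((a : ℝ) + 1) (a + 1 + N : ℕ) := fun t ht =>
      ⟨by linarith [ht.1, Nat.cast_nonneg (α := ℝ) n], by push_cast; linarith [ht.2]⟩
    obtain ⟨t, ht, hte⟩ := exists_second_difference_eq (x := (a : ℝ) + 1 + n)
      (fun t ht => h1 t (hsub t ht)) (fun t ht => h2 t (hsub t ht))
    refine ⟨t, hsub t ht, ?_⟩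
    rw [← hte]
    push_cast
    simp only [add_assoc]
    ring
  have hm := hmain (fun n hn => by
    obtain ⟨t, ht, hte⟩ := hdiff n hn
    simp only [hte]; exact hl t ht) (fun n hn => by
    obtain ⟨t, ht, hte⟩ := hdiff n hn
    simp only [hte]; exact hu t ht)
  have e3 : 1 ≤ 1 / √lam := by
    rw [le_div_iff₀ hsq, one_mul]; exact Real.sqrt_le_one.2 hlam1
  have h9 : 9 / √lam = 8 / √lam + 1 / √lam := by ring
  have h10 : 4 * A * √lam * N ≤ 4 * A * √lam * ((a + 1 + N - a : ℕ) : ℝ) := by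
    apply mul_le_mul_of_nonneg_left _ (by positivity)
    exact_mod_cast (by omega : N ≤ a + 1 + N - a)
  linarith

/-- Expanding a square: a bound for the second moment of a linear form whose kernel has small
off-diagonal correlations. -/
theorem sum_norm_sq_le_of_correlation {Ms B : Finset ℕ} {E : ℕ → ℕ → ℂ} {b : ℕ → ℂ} {D V : ℝ}
    (hV : 0 ≤ V) (hD : ∀ k ∈ B, ‖∑ m ∈ Ms, E m k * (starRingEnd ℂ) (E m k)‖ ≤ D)
    (hoff : ∀ k₁ ∈ B, ∀ k₂ ∈ B, k₁ ≠ k₂ →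
      ‖∑ m ∈ Ms, E m k₁ * (starRingEnd ℂ) (E m k₂)‖ ≤ V) :
    ∑ m ∈ Ms, ‖∑ k ∈ B, b k * E m k‖ ^ 2 ≤ (D + #B * V) * ∑ k ∈ B, ‖b k‖ ^ 2 := by
  have hexp : ((∑ m ∈ Ms, ‖∑ k ∈ B, b k * E m k‖ ^ 2 : ℝ) : ℂ) =
      ∑ k₁ ∈ B, ∑ k₂ ∈ B, b k₁ * (starRingEnd ℂ) (b k₂) *
        ∑ m ∈ Ms, E m k₁ * (starRingEnd ℂ) (E m k₂) := by
    push_cast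
    have : ∀ m ∈ Ms, ((‖∑ k ∈ B, b k * E m k‖ : ℝ) : ℂ) ^ 2 =
        ∑ k₁ ∈ B, ∑ k₂ ∈ B, b k₁ * (starRingEnd ℂ) (b k₂) *
          (E m k₁ * (starRingEnd ℂ) (E m k₂)) := by
      intro m _
      rw [← Complex.mul_conj', map_sum, sum_mul_sum]
      refine sum_congr rfl fun k₁ _ => sum_congr rfl fun k₂ _ => ?_
      rw [map_mul]; ring
    rw [sum_congr rfl this, sum_comm]
    refine sum_congr rfl fun k₁ _ => ?_
    rw [sum_comm]
    refine sum_congr rfl fun k₂ _ => ?_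
    rw [mul_sum]
  have hnorm : ∑ m ∈ Ms, ‖∑ k ∈ B, b k * E m k‖ ^ 2 =
      ‖((∑ m ∈ Ms, ‖∑ k ∈ B, b k * E m k‖ ^ 2 : ℝ) : ℂ)‖ := by
    rw [Complex.norm_real, Real.norm_of_nonneg (sum_nonneg fun _ _ => by positivity)]
  rw [hnorm, hexp]
  have hbound : ∀ k₁ ∈ B, ∀ k₂ ∈ B, ‖b k₁ * (starRingEnd ℂ) (b k₂) *
      ∑ m ∈ Ms, E m k₁ * (starRingEnd ℂ) (E m k₂)‖ ≤
      (if k₁ = k₂ then D * ‖b k₁‖ ^ 2 else 0) + V * (‖b k₁‖ * ‖b k₂‖) := by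
    intro k₁ h₁ k₂ h₂
    rw [norm_mul, norm_mul, Complex.norm_conj]
    split_ifs with h
    · subst h
      have := mul_le_mul_of_nonneg_left (hD k₁ h₁) (mul_nonneg (norm_nonneg (b k₁))
        (norm_nonneg (b k₁)))
      have h0 : 0 ≤ V * (‖b k₁‖ * ‖b k₁‖) := by positivity
      nlinarith
    · have := mul_le_mul_of_nonneg_left (hoff k₁ h₁ k₂ h₂ h) (mul_nonneg (norm_nonneg (b k₁))
        (norm_nonneg (b k₂)))
      linarith
  refine (norm_sum_le _ _).trans ((sum_le_sum fun k₁ h₁ => (norm_sum_le _ _).trans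
    (sum_le_sum fun k₂ h₂ => hbound k₁ h₁ k₂ h₂)).trans ?_)
  simp only [sum_add_distrib, sum_ite_eq]
  have h1 : ∑ x ∈ B, (if x ∈ B then D * ‖b x‖ ^ 2 else 0) = D * ∑ k ∈ B, ‖b k‖ ^ 2 := by
    rw [mul_sum]; exact sum_congr rfl fun k hk => by rw [if_pos hk]
  have h2 : ∑ x ∈ B, ∑ x_1 ∈ B, V * (‖b x‖ * ‖b x_1‖) = V * (∑ k ∈ B, ‖b k‖) ^ 2 := by
    rw [sq, sum_mul_sum, mul_sum]; exact sum_congr rfl fun k _ => by rw [mul_sum]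
  rw [h1, h2, add_mul]
  have := sq_sum_le_card_mul_sum_sq (s := B) (f := fun k => ‖b k‖)
  nlinarith

/-- The Weyl–van der Corput inequality for bilinear forms, in the form of a decomposition
of one variable into blocks. -/
theorem norm_bilinear_sq_le {Ms Ks R : Finset ℕ} {ρ : ℕ → ℕ} {E : ℕ → ℕ → ℂ} {a b : ℕ → ℂ}
    {D V Q : ℝ} (hV : 0 ≤ V) (hρ : ∀ k ∈ Ks, ρ k ∈ R)
    (hQ : ∀ r ∈ R, (#(Ks.filter fun k => ρ k = r) : ℝ) ≤ Q)
    (hD : ∀ k ∈ Ks, ‖∑ m ∈ Ms, E m k * (starRingEnd ℂ) (E m k)‖ ≤ D)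
    (hoff : ∀ k₁ ∈ Ks, ∀ k₂ ∈ Ks, k₁ ≠ k₂ → ρ k₁ = ρ k₂ →
      ‖∑ m ∈ Ms, E m k₁ * (starRingEnd ℂ) (E m k₂)‖ ≤ V) :
    ‖∑ k ∈ Ks, ∑ m ∈ Ms, a m * b k * E m k‖ ^ 2 ≤
      #R * (∑ m ∈ Ms, ‖a m‖ ^ 2) * ((D + Q * V) * ∑ k ∈ Ks, ‖b k‖ ^ 2) := by
  set Z : ℕ → ℕ → ℂ := fun m r => ∑ k ∈ Ks with ρ k = r, b k * E m k with hZ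
  have hsum : ∑ k ∈ Ks, ∑ m ∈ Ms, a m * b k * E m k = ∑ x ∈ Ms ×ˢ R, a x.1 * Z x.1 x.2 := by
    rw [sum_comm, sum_product]
    refine sum_congr rfl fun m _ => ?_
    show _ = ∑ r ∈ R, a m * ∑ k ∈ Ks with ρ k = r, b k * E m k
    rw [← mul_sum, sum_fiberwise_of_maps_to hρ fun k => b k * E m k, mul_sum]
    exact sum_congr rfl fun k _ => by ring
  have h1 : ‖∑ k ∈ Ks, ∑ m ∈ Ms, a m * b k * E m k‖ ≤
      ∑ x ∈ Ms ×ˢ R, ‖a x.1‖ * ‖Z x.1 x.2‖ := by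
    rw [hsum]
    exact (norm_sum_le _ _).trans (le_of_eq (sum_congr rfl fun x _ => norm_mul _ _))
  have h2 := sum_mul_sq_le_sq_mul_sq (Ms ×ˢ R) (fun x => ‖a x.1‖) (fun x => ‖Z x.1 x.2‖)
  have h3 : ∑ x ∈ Ms ×ˢ R, ‖a x.1‖ ^ 2 = #R * ∑ m ∈ Ms, ‖a m‖ ^ 2 := by
    rw [sum_product, mul_sum]
    refine sum_congr rfl fun m _ => ?_
    show ∑ _r ∈ R, ‖a m‖ ^ 2 = _
    rw [sum_const, nsmul_eq_mul]
  have h4 : ∑ x ∈ Ms ×ˢ R, ‖Z x.1 x.2‖ ^ 2 ≤ (D + Q * V) * ∑ k ∈ Ks, ‖b k‖ ^ 2 := by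
    rw [sum_product_right, ← sum_fiberwise_of_maps_to hρ fun k => ‖b k‖ ^ 2, mul_sum]
    refine sum_le_sum fun r hr => ?_
    show ∑ m ∈ Ms, ‖∑ k ∈ Ks with ρ k = r, b k * E m k‖ ^ 2 ≤ _
    refine (sum_norm_sq_le_of_correlation (E := E) (b := b) hV
      (fun k hk => hD k (mem_filter.1 hk).1) (fun k₁ h₁ k₂ h₂ h => ?_)).trans ?_
    · rw [mem_filter] at h₁ h₂
      exact hoff k₁ h₁.1 k₂ h₂.1 h (h₁.2.trans h₂.2.symm)
    · apply mul_le_mul_of_nonneg_right _ (sum_nonneg fun _ _ => by positivity)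
      have := mul_le_mul_of_nonneg_right (hQ r hr) hV
      linarith
  calc _ ≤ (∑ x ∈ Ms ×ˢ R, ‖a x.1‖ * ‖Z x.1 x.2‖) ^ 2 := by gcongr
    _ ≤ _ := h2
    _ ≤ _ := by
      rw [h3]
      exact mul_le_mul_of_nonneg_left h4 (by positivity)

/-- A phase `φ` on `[P, 4P]` for which the sizes of `χ(t) = t² φ''(t)` and of `t χ'(t)` are known
up to the factor `A`. -/
structure PhaseBounds (P : ℕ) (A F₁ F₂ s₁ s₂ : ℝ) (φ φ₁ φ₂ χ₁ : ℝ → ℝ) : Prop where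
  one_le : 1 ≤ A
  sign₁ : s₁ = 1 ∨ s₁ = -1
  sign₂ : s₂ = 1 ∨ s₂ = -1
  pos₁ : 0 < F₁
  pos₂ : 0 < F₂
  deriv₁ : ∀ t ∈ Set.Icc (P : ℝ) (4 * P), HasDerivAt φ (φ₁ t) t
  deriv₂ : ∀ t ∈ Set.Icc (P : ℝ) (4 * P), HasDerivAt φ₁ (φ₂ t) t
  deriv₃ : ∀ t ∈ Set.Icc (P : ℝ) (4 * P), HasDerivAt (fun t => t ^ 2 * φ₂ t) (χ₁ t) t
  lower₁ : ∀ t ∈ Set.Icc (P : ℝ) (4 * P), F₁ ≤ s₁ * (t ^ 2 * φ₂ t)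
  upper₁ : ∀ t ∈ Set.Icc (P : ℝ) (4 * P), s₁ * (t ^ 2 * φ₂ t) ≤ A * F₁
  lower₂ : ∀ t ∈ Set.Icc (P : ℝ) (4 * P), F₂ ≤ s₂ * (t * χ₁ t)
  upper₂ : ∀ t ∈ Set.Icc (P : ℝ) (4 * P), s₂ * (t * χ₁ t) ≤ A * F₂

theorem norm_sum_differenced_le {P : ℕ} {A F₁ F₂ s₁ s₂ : ℝ} {φ φ₁ φ₂ χ₁ : ℝ → ℝ}
    (hφ : PhaseBounds P A F₁ F₂ s₁ s₂ φ φ₁ φ₂ χ₁) (hP : 0 < P) {K Q k₁ k₂ a b : ℕ} (hK : 0 < K)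
    (hk₁ : K < k₁) (hk₂ : k₁ < k₂) (hk₂' : k₂ ≤ 2 * K) (hQ : k₂ - k₁ ≤ Q)
    (ha : P / k₁ ≤ a) (hb : b ≤ 4 * P / k₂) :
    ‖∑ m ∈ Ioc a b, unitExp (φ (m * k₂) - φ (m * k₁))‖ ≤
      512 * A * √(Q * F₂ / K) + 36 * P / √(F₂ * K) := by
  have hA := hφ.one_le
  have hF := hφ.pos₂
  have hPr : (0 : ℝ) < P := by exact_mod_cast hP
  have hKr : (0 : ℝ) < K := by exact_mod_cast hK
  rcases le_or_gt b a with hab | hab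
  · rw [Ioc_eq_empty (by omega), sum_empty, norm_zero]; positivity
  have hk₁r : (K : ℝ) < k₁ := by exact_mod_cast hk₁
  have hk₂r : (k₁ : ℝ) < k₂ := by exact_mod_cast hk₂
  have hk₂r' : (k₂ : ℝ) ≤ 2 * K := by exact_mod_cast hk₂'
  have ha' : (P : ℝ) ≤ ((a : ℝ) + 1) * k₁ := by
    have : P < (a + 1) * k₁ := by
      rw [← Nat.div_lt_iff_lt_mul (by omega)]; omega
    exact_mod_cast this.le
  have hb' : (b : ℝ) * k₂ ≤ 4 * P := by
    have : b * k₂ ≤ 4 * P := by rwa [← Nat.le_div_iff_mul_le (by omega)]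
    exact_mod_cast this
  have hrange : ∀ x ∈ Set.Icc ((a : ℝ) + 1) b, ∀ k : ℝ, k₁ ≤ k → k ≤ k₂ →
      x * k ∈ Set.Icc (P : ℝ) (4 * P) := by
    intro x hx k h1 h2
    have hx0 : (0 : ℝ) < x := by linarith [hx.1, Nat.cast_nonneg (α := ℝ) a]
    constructor
    · exact ha'.trans (mul_le_mul hx.1 h1 (by positivity) hx0.le)
    · exact (mul_le_mul hx.2 h2 (by linarith) (by positivity)).trans hb'
  set q : ℝ := (k₂ : ℝ) - k₁ with hq
  have hq1 : 1 ≤ q := by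
    have : (k₁ : ℝ) + 1 ≤ k₂ := by exact_mod_cast hk₂
    linarith
  have hqQ : q ≤ Q := by
    have : (k₂ : ℝ) ≤ k₁ + Q := by exact_mod_cast (by omega : k₂ ≤ k₁ + Q)
    linarith
  set f₂ : ℝ → ℝ := fun x => φ₂ (x * k₂) * k₂ * k₂ - φ₂ (x * k₁) * k₁ * k₁ with hf₂
  have hf₂val : ∀ x ∈ Set.Icc ((a : ℝ) + 1) b, ∃ ξ ∈ Set.Icc (P : ℝ) (4 * P),
      f₂ x = q * (ξ * χ₁ ξ) / (x * ξ) := by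
    intro x hx
    have hx0 : (0 : ℝ) < x := by linarith [hx.1, Nat.cast_nonneg (α := ℝ) a]
    have hlt : x * k₁ < x * k₂ := mul_lt_mul_of_pos_left hk₂r hx0
    have hsub : ∀ t ∈ Set.Icc (x * k₁) (x * k₂), t ∈ Set.Icc (P : ℝ) (4 * P) := fun t ht =>
      ⟨(hrange x hx k₁ le_rfl hk₂r.le).1.trans ht.1,
        ht.2.trans (hrange x hx k₂ hk₂r.le le_rfl).2⟩
    obtain ⟨ξ, hξ, hξ'⟩ := exists_hasDerivAt_eq_slope (fun t => t ^ 2 * φ₂ t) χ₁ hlt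
      (fun t ht => (hφ.deriv₃ t (hsub t ht)).continuousAt.continuousWithinAt)
      (fun t ht => hφ.deriv₃ t (hsub t ⟨ht.1.le, ht.2.le⟩))
    have hξmem := hsub ξ ⟨hξ.1.le, hξ.2.le⟩
    have hξ0 : 0 < ξ := hPr.trans_le hξmem.1
    refine ⟨ξ, hξmem, ?_⟩
    have hd : x * k₂ - x * k₁ ≠ 0 := by linarith
    rw [eq_div_iff hd] at hξ'
    rw [eq_div_iff (by positivity), hf₂]
    have : x * q = x * k₂ - x * k₁ := by rw [hq]; ring
    apply mul_left_cancel₀ hx0.ne'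
    simp only
    rw [show x * (q * (ξ * χ₁ ξ)) = (χ₁ ξ * (x * k₂ - x * k₁)) * ξ by rw [← this]; ring, hξ']
    ring
  have hlam : 0 < q * F₂ * K / (16 * P ^ 2) := by positivity
  have hmain := norm_sum_unitExp_le_of_second_deriv (a := a) (b := b)
    (f := fun x => φ (x * k₂) - φ (x * k₁))
    (f₁ := fun x => φ₁ (x * k₂) * k₂ - φ₁ (x * k₁) * k₁) (f₂ := f₂)
    (lam := q * F₂ * K / (16 * P ^ 2)) (A := 32 * A) (s := s₂) hlam (by linarith) hφ.sign₂
    (by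
      intro t ht
      have d2 := (hφ.deriv₁ _ (hrange t ht k₂ hk₂r.le le_rfl)).comp t
        ((hasDerivAt_id t).mul_const (k₂ : ℝ))
      have d1 := (hφ.deriv₁ _ (hrange t ht k₁ le_rfl hk₂r.le)).comp t
        ((hasDerivAt_id t).mul_const (k₁ : ℝ))
      simp only [one_mul] at d1 d2
      exact d2.sub d1)
    (by
      intro t ht
      have d2 := ((hφ.deriv₂ _ (hrange t ht k₂ hk₂r.le le_rfl)).comp t
        ((hasDerivAt_id t).mul_const (k₂ : ℝ))).mul_const (k₂ : ℝ)
      have d1 := ((hφ.deriv₂ _ (hrange t ht k₁ le_rfl hk₂r.le)).comp t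
        ((hasDerivAt_id t).mul_const (k₁ : ℝ))).mul_const (k₁ : ℝ)
      simp only [one_mul] at d1 d2
      exact d2.sub d1)
    (by
      intro x hx
      obtain ⟨ξ, hξ, he⟩ := hf₂val x hx
      have hx0 : (0 : ℝ) < x := by linarith [hx.1, Nat.cast_nonneg (α := ℝ) a]
      have hξ0 : 0 < ξ := hPr.trans_le hξ.1
      have hl := hφ.lower₂ ξ hξ
      have hxK : x * K ≤ 4 * P := (mul_le_mul_of_nonneg_left hk₁r.le hx0.le).trans
        (hrange x hx k₁ le_rfl hk₂r.le).2
      rw [he, show s₂ * (q * (ξ * χ₁ ξ) / (x * ξ)) = q * (s₂ * (ξ * χ₁ ξ)) / (x * ξ) by ring,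
        div_le_div_iff₀ (by positivity) (by positivity)]
      have h1 : (x * K) * ξ ≤ (4 * P) * (4 * P) :=
        mul_le_mul hxK hξ.2 hξ0.le (by positivity)
      calc q * F₂ * K * (x * ξ) = q * F₂ * ((x * K) * ξ) := by ring
        _ ≤ q * F₂ * ((4 * P) * (4 * P)) := by gcongr
        _ = q * F₂ * (16 * P ^ 2) := by ring
        _ ≤ q * (s₂ * (ξ * χ₁ ξ)) * (16 * P ^ 2) := by gcongr)
    (by
      intro x hx
      obtain ⟨ξ, hξ, he⟩ := hf₂val x hx
      have hx0 : (0 : ℝ) < x := by linarith [hx.1, Nat.cast_nonneg (α := ℝ) a]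
      have hξ0 : 0 < ξ := hPr.trans_le hξ.1
      have hu := hφ.upper₂ ξ hξ
      have hxK : (P : ℝ) ≤ x * (2 * K) := (hrange x hx k₂ hk₂r.le le_rfl).1.trans
        (mul_le_mul_of_nonneg_left hk₂r' hx0.le)
      rw [he, show s₂ * (q * (ξ * χ₁ ξ) / (x * ξ)) = q * (s₂ * (ξ * χ₁ ξ)) / (x * ξ) by ring,
        show 32 * A * (q * F₂ * K / (16 * P ^ 2)) = 2 * A * q * F₂ * K / P ^ 2 by
          field_simp; ring,
        div_le_div_iff₀ (by positivity) (by positivity)]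
      have h1 : (P : ℝ) * P ≤ (x * (2 * K)) * ξ := mul_le_mul hxK hξ.1 hPr.le (by positivity)
      calc q * (s₂ * (ξ * χ₁ ξ)) * P ^ 2 ≤ q * (A * F₂) * P ^ 2 := by gcongr
        _ = q * (A * F₂) * (P * P) := by ring
        _ ≤ q * (A * F₂) * ((x * (2 * K)) * ξ) := by gcongr
        _ = 2 * A * q * F₂ * K * (x * ξ) := by ring)
  have hcast : ∀ m : ℕ, unitExp (φ ((m : ℝ) * k₂) - φ ((m : ℝ) * k₁)) =
    unitExp ((fun x : ℝ => φ (x * k₂) - φ (x * k₁)) m) := fun m => rfl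
  refine hmain.trans ?_
  have hsqrt : √(q * F₂ * K / (16 * P ^ 2)) = √(q * F₂ * K) / (4 * P) := by
    rw [Real.sqrt_div (by positivity), show (16 : ℝ) * P ^ 2 = (4 * P) ^ 2 by ring,
      Real.sqrt_sq (by positivity)]
  rw [hsqrt]
  have hlen : ((b - a : ℕ) : ℝ) ≤ 4 * P / K := by
    rw [le_div_iff₀ hKr]
    have : ((b - a : ℕ) : ℝ) ≤ b := by exact_mod_cast (by omega)
    have hb0 : (0 : ℝ) ≤ b := Nat.cast_nonneg b
    nlinarith
  have hs0 : 0 < √(q * F₂ * K) := Real.sqrt_pos.2 (by positivity)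
  apply add_le_add
  · have h1 : √(q * F₂ * K) / K ≤ √(Q * F₂ / K) := by
      rw [show √(q * F₂ * K) / K = √(q * F₂ / K) by
        rw [show q * F₂ / K = (q * F₂ * K) / K ^ 2 by field_simp, Real.sqrt_div (by positivity),
          Real.sqrt_sq hKr.le]]
      apply Real.sqrt_le_sqrt
      gcongr
    calc 4 * (32 * A) * (√(q * F₂ * K) / (4 * P)) * ((b - a : ℕ) : ℝ)
        ≤ 4 * (32 * A) * (√(q * F₂ * K) / (4 * P)) * (4 * P / K) := by gcongr
      _ = 128 * A * (√(q * F₂ * K) / K) := by field_simp; try ring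
      _ ≤ 512 * A * √(Q * F₂ / K) := by gcongr; norm_num
  · have h1 : √(F₂ * K) ≤ √(q * F₂ * K) := by
      apply Real.sqrt_le_sqrt
      nlinarith [mul_pos hF hKr]
    have h2 : 0 < √(F₂ * K) := Real.sqrt_pos.2 (by positivity)
    calc 9 / (√(q * F₂ * K) / (4 * P)) = 36 * P / √(q * F₂ * K) := by field_simp; try ring
      _ ≤ 36 * P / √(F₂ * K) := by gcongr

/-- The kernel `e(φ(mk))` restricted to the range `P < mk ≤ 4P`. -/
noncomputable def phaseKernel (P : ℕ) (φ : ℝ → ℝ) (m k : ℕ) : ℂ :=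
  if P < m * k ∧ m * k ≤ 4 * P then unitExp (φ (m * k)) else 0

theorem phaseKernel_comm (P : ℕ) (φ : ℝ → ℝ) (m k : ℕ) :
    phaseKernel P φ m k = phaseKernel P φ k m := by
  simp only [phaseKernel, mul_comm]

theorem norm_phaseKernel_le (P : ℕ) (φ : ℝ → ℝ) (m k : ℕ) : ‖phaseKernel P φ m k‖ ≤ 1 := by
  unfold phaseKernel
  split_ifs
  · rw [norm_unitExp]
  · simp

theorem norm_sum_phaseKernel_mul_conj_le {P : ℕ} {A F₁ F₂ s₁ s₂ : ℝ} {φ φ₁ φ₂ χ₁ : ℝ → ℝ}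
    (hφ : PhaseBounds P A F₁ F₂ s₁ s₂ φ φ₁ φ₂ χ₁) (hP : 0 < P) {K Q k₁ k₂ : ℕ} (hK : 0 < K)
    (hk₁ : K < k₁) (hk₂ : k₁ < k₂) (hk₂' : k₂ ≤ 2 * K) (hQ : k₂ - k₁ ≤ Q) :
    ‖∑ m ∈ Ioc 0 (4 * P / K), phaseKernel P φ m k₂ * (starRingEnd ℂ) (phaseKernel P φ m k₁)‖ ≤
      512 * A * √(Q * F₂ / K) + 36 * P / √(F₂ * K) := by
  have hsub : Ioc (P / k₁) (4 * P / k₂) ⊆ Ioc 0 (4 * P / K) := by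
    apply Ioc_subset_Ioc (Nat.zero_le _)
    exact Nat.div_le_div_left (by omega) hK
  rw [← sum_subset hsub]
  · refine le_trans (le_of_eq ?_) (norm_sum_differenced_le hφ hP hK hk₁ hk₂ hk₂' hQ le_rfl le_rfl)
    congr 1
    refine sum_congr rfl fun m hm => ?_
    rw [mem_Ioc, Nat.div_lt_iff_lt_mul (by omega), Nat.le_div_iff_mul_le (by omega)] at hm
    have h1 : m * k₁ ≤ m * k₂ := Nat.mul_le_mul_left _ hk₂.le
    rw [phaseKernel, phaseKernel, if_pos ⟨by omega, by omega⟩, if_pos ⟨by omega, by omega⟩,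
      conj_unitExp, ← unitExp_add, sub_eq_add_neg]
  · intro m _ hm
    rw [mem_Ioc, Nat.div_lt_iff_lt_mul (by omega), Nat.le_div_iff_mul_le (by omega)] at hm
    rw [phaseKernel, phaseKernel]
    split_ifs with h1 h2
    · exact absurd ⟨h2.1, h1.2⟩ hm
    all_goals simp

theorem norm_sum_phaseKernel_mul_conj_le_of_ne {P : ℕ} {A F₁ F₂ s₁ s₂ : ℝ}
    {φ φ₁ φ₂ χ₁ : ℝ → ℝ}
    (hφ : PhaseBounds P A F₁ F₂ s₁ s₂ φ φ₁ φ₂ χ₁) (hP : 0 < P) {K Q k₁ k₂ : ℕ} (hK : 0 < K)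
    (hk₁ : k₁ ∈ Ioc K (2 * K)) (hk₂ : k₂ ∈ Ioc K (2 * K)) (hne : k₁ ≠ k₂)
    (hQ0 : 0 < Q) (hQ : k₁ / Q = k₂ / Q) :
    ‖∑ m ∈ Ioc 0 (4 * P / K), phaseKernel P φ m k₁ * (starRingEnd ℂ) (phaseKernel P φ m k₂)‖ ≤
      512 * A * √(Q * F₂ / K) + 36 * P / √(F₂ * K) := by
  rw [mem_Ioc] at hk₁ hk₂
  have e1 := Nat.div_add_mod k₁ Q
  have e2 := Nat.div_add_mod k₂ Q
  have l1 := Nat.mod_lt k₁ hQ0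
  have l2 := Nat.mod_lt k₂ hQ0
  rw [hQ] at e1
  rcases lt_or_gt_of_ne hne with h | h
  · rw [← Complex.norm_conj, map_sum]
    refine le_trans (le_of_eq ?_) (norm_sum_phaseKernel_mul_conj_le hφ hP hK hk₁.1 h hk₂.2
      (Q := Q) (by omega))
    congr 1
    exact sum_congr rfl fun m _ => by rw [map_mul, Complex.conj_conj, mul_comm]
  · exact norm_sum_phaseKernel_mul_conj_le hφ hP hK hk₂.1 h hk₁.2 (by omega)

theorem norm_bilinear_block_sq_le {P : ℕ} {A F₁ F₂ s₁ s₂ : ℝ} {φ φ₁ φ₂ χ₁ : ℝ → ℝ}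
    (hφ : PhaseBounds P A F₁ F₂ s₁ s₂ φ φ₁ φ₂ χ₁) (hP : 0 < P) {K Q : ℕ} (hQ : 0 < Q)
    (hQK : Q ≤ K) (a b : ℕ → ℂ) :
    ‖∑ k ∈ Ioc K (2 * K), ∑ m ∈ Ioc 0 (4 * P), a m * b k * phaseKernel P φ m k‖ ^ 2 ≤
      (3 * K / Q : ℝ) * (∑ m ∈ Ioc 0 (4 * P / K), ‖a m‖ ^ 2) *
        ((4 * P / K + Q * (512 * A * √(Q * F₂ / K) + 36 * P / √(F₂ * K))) *
          ∑ k ∈ Ioc K (2 * K), ‖b k‖ ^ 2) := by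
  have hK : 0 < K := by omega
  have hKr : (0 : ℝ) < K := by exact_mod_cast hK
  have hQr : (0 : ℝ) < Q := by exact_mod_cast hQ
  have hQKr : (Q : ℝ) ≤ K := by exact_mod_cast hQK
  have hA := hφ.one_le
  have hF := hφ.pos₂
  have hrestrict : ∀ k ∈ Ioc K (2 * K),
      ∑ m ∈ Ioc 0 (4 * P), a m * b k * phaseKernel P φ m k =
        ∑ m ∈ Ioc 0 (4 * P / K), a m * b k * phaseKernel P φ m k := by
    intro k hk
    rw [mem_Ioc] at hk
    symm
    apply sum_subset (Ioc_subset_Ioc le_rfl (Nat.div_le_self _ _))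
    intro m hm hm'
    rw [mem_Ioc] at hm hm'
    rw [Nat.le_div_iff_mul_le hK] at hm'
    have : m * K ≤ m * k := Nat.mul_le_mul_left _ hk.1.le
    rw [phaseKernel, if_neg (by omega), mul_zero]
  rw [sum_congr rfl hrestrict]
  have hV : 0 ≤ 512 * A * √(Q * F₂ / K) + 36 * P / √(F₂ * K) := by positivity
  have hfib : ∀ r ∈ Icc (K / Q) (2 * K / Q),
      (#((Ioc K (2 * K)).filter fun k => k / Q = r) : ℝ) ≤ Q := by
    intro r _
    have : ((Ioc K (2 * K)).filter fun k => k / Q = r) ⊆ Ico (r * Q) (r * Q + Q) := by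
      intro k hk
      rw [mem_filter] at hk
      have e1 := Nat.div_add_mod k Q
      have l1 := Nat.mod_lt k hQ
      rw [hk.2, mul_comm] at e1
      rw [mem_Ico]
      omega
    have := card_le_card this
    rw [Nat.card_Ico] at this
    exact_mod_cast (by omega)
  have hcard : (#(Icc (K / Q) (2 * K / Q)) : ℝ) ≤ 3 * K / Q := by
    have h1 : #(Icc (K / Q) (2 * K / Q)) * Q ≤ 3 * K := by
      rw [Nat.card_Icc]
      have e1 := Nat.div_add_mod K Q
      have l1 := Nat.mod_lt K hQ
      have e2 := Nat.div_mul_le_self (2 * K) Q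
      have h3 : K / Q ≤ 2 * K / Q := Nat.div_le_div_right (by omega)
      have h4 : (2 * K / Q + 1 - K / Q) * Q + K / Q * Q = 2 * K / Q * Q + Q := by
        rw [← add_mul, Nat.sub_add_cancel (by omega)]; ring
      rw [mul_comm] at e1
      omega
    rw [le_div_iff₀ hQr]
    exact_mod_cast h1
  refine (norm_bilinear_sq_le (R := Icc (K / Q) (2 * K / Q)) (ρ := fun k => k / Q) hV ?_ hfib
    (D := 4 * P / K) ?_ ?_).trans ?_
  · intro k hk
    rw [mem_Ioc] at hk
    rw [mem_Icc]
    exact ⟨Nat.div_le_div_right hk.1.le, Nat.div_le_div_right hk.2⟩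
  · intro k _
    refine (norm_sum_le _ _).trans ((sum_le_sum (g := fun _ => (1 : ℝ)) fun m _ => ?_).trans ?_)
    · rw [norm_mul, Complex.norm_conj]
      have := norm_phaseKernel_le P φ m k
      nlinarith [norm_nonneg (phaseKernel P φ m k)]
    · simp only [sum_const, Nat.card_Ioc, nsmul_eq_mul, mul_one, Nat.sub_zero]
      exact Nat.cast_div_le.trans (by push_cast; exact le_rfl)
  · intro k₁ h₁ k₂ h₂ hne hρ
    exact norm_sum_phaseKernel_mul_conj_le_of_ne hφ hP hK h₁ h₂ hne hQ hρ
  · apply mul_le_mul_of_nonneg_right _ (by positivity)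
    exact mul_le_mul_of_nonneg_right hcard (by positivity)

/-- The saving obtained for a bilinear sum when the shorter variable has length at most `Z`. -/
noncomputable def bilinearBound (P : ℕ) (A F : ℝ) (Q Z : ℕ) : ℝ :=
  √(96 * P ^ 2 / Q + 24 * P * (512 * A * √(Q * F * Z) + 36 * P * √(Z / F)))

theorem norm_bilinear_block_le {P : ℕ} {A F₁ F₂ s₁ s₂ : ℝ} {φ φ₁ φ₂ χ₁ : ℝ → ℝ}
    (hφ : PhaseBounds P A F₁ F₂ s₁ s₂ φ φ₁ φ₂ χ₁) (hP : 0 < P) {K Q Z : ℕ} (hQ : 0 < Q)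
    (hQK : Q ≤ K) (hKZ : K ≤ Z) {a b : ℕ → ℂ} {S : ℝ} (hS : 0 ≤ S)
    (ha : ∀ x : ℕ, x ≤ 4 * P → ∑ m ∈ Ioc 0 x, ‖a m‖ ^ 2 ≤ x * S)
    (hb : ∀ x : ℕ, x ≤ 4 * P → ∑ m ∈ Ioc 0 x, ‖b m‖ ^ 2 ≤ x * S) (hZP : 2 * Z ≤ 4 * P) :
    ‖∑ k ∈ Ioc K (2 * K), ∑ m ∈ Ioc 0 (4 * P), a m * b k * phaseKernel P φ m k‖ ≤
      S * bilinearBound P A F₂ Q Z := by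
  have hK : 0 < K := by omega
  have hKr : (0 : ℝ) < K := by exact_mod_cast hK
  have hQr : (0 : ℝ) < Q := by exact_mod_cast hQ
  have hKZr : (K : ℝ) ≤ Z := by exact_mod_cast hKZ
  have hPr : (0 : ℝ) < P := by exact_mod_cast hP
  have hA := hφ.one_le
  have hF := hφ.pos₂
  have ha' : ∑ m ∈ Ioc 0 (4 * P / K), ‖a m‖ ^ 2 ≤ 4 * P / K * S := by
    refine (ha _ (Nat.div_le_self _ _)).trans (mul_le_mul_of_nonneg_right ?_ hS)
    exact Nat.cast_div_le.trans (by push_cast; exact le_rfl)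
  have hb' : ∑ m ∈ Ioc K (2 * K), ‖b m‖ ^ 2 ≤ 2 * K * S := by
    refine (sum_le_sum_of_subset_of_nonneg (Ioc_subset_Ioc_left (Nat.zero_le K))
      (fun _ _ _ => by positivity)).trans ((hb _ (by omega)).trans (le_of_eq (by push_cast; rfl)))
  have hkey : ‖∑ k ∈ Ioc K (2 * K), ∑ m ∈ Ioc 0 (4 * P), a m * b k * phaseKernel P φ m k‖ ^ 2 ≤
      S ^ 2 * (96 * P ^ 2 / Q + 24 * P * (512 * A * √(Q * F₂ * Z) + 36 * P * √(Z / F₂))) := by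
    refine (norm_bilinear_block_sq_le hφ hP hQ hQK a b).trans ?_
    calc _ ≤ (3 * K / Q : ℝ) * (4 * P / K * S) *
        ((4 * P / K + Q * (512 * A * √(Q * F₂ / K) + 36 * P / √(F₂ * K))) * (2 * K * S)) := by
          gcongr
      _ = S ^ 2 * (96 * P ^ 2 / Q + 24 * P * (512 * A * (K * √(Q * F₂ / K)) +
            36 * P * (K / √(F₂ * K)))) := by
          have : √(F₂ * K) ≠ 0 := (Real.sqrt_pos.2 (by positivity)).ne'
          field_simp
          ring
      _ ≤ _ := by
          have e1 : K * √(Q * F₂ / K) = √(Q * F₂ * K) := by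
            rw [show Q * F₂ * K = K ^ 2 * (Q * F₂ / K) by field_simp,
              Real.sqrt_mul (by positivity), Real.sqrt_sq hKr.le]
          have e2 : K / √(F₂ * K) = √(K / F₂) := by
            rw [show (K : ℝ) / F₂ = K ^ 2 / (F₂ * K) by field_simp,
              Real.sqrt_div (by positivity), Real.sqrt_sq hKr.le]
          rw [e1, e2]
          gcongr
  rw [bilinearBound, ← Real.sqrt_sq hS, ← Real.sqrt_mul (by positivity)]
  exact Real.le_sqrt_of_sq_le hkey

theorem norm_bilinear_dyadic_le {P : ℕ} {A F₁ F₂ s₁ s₂ : ℝ} {φ φ₁ φ₂ χ₁ : ℝ → ℝ}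
    (hφ : PhaseBounds P A F₁ F₂ s₁ s₂ φ φ₁ φ₂ χ₁) (hP : 0 < P) {U Q Z I : ℕ} (hQ : 0 < Q)
    (hQU : Q ≤ U) (hI : Z ≤ 2 ^ I * U) {a b : ℕ → ℂ} {S : ℝ} (hS : 0 ≤ S)
    (ha : ∀ x : ℕ, x ≤ 4 * P → ∑ m ∈ Ioc 0 x, ‖a m‖ ^ 2 ≤ x * S)
    (hb : ∀ x : ℕ, x ≤ 4 * P → ∑ m ∈ Ioc 0 x, ‖b m‖ ^ 2 ≤ x * S) (hZP : 2 * Z ≤ 4 * P)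
    (hbU : ∀ k ≤ U, b k = 0) (hbZ : ∀ k, Z < k → b k = 0) :
    ‖∑ k ∈ Ioc 0 (4 * P), ∑ m ∈ Ioc 0 (4 * P), a m * b k * phaseKernel P φ m k‖ ≤
      I * (S * bilinearBound P A F₂ Q Z) := by
  set T : ℕ → ℂ := fun k => ∑ m ∈ Ioc 0 (4 * P), a m * b k * phaseKernel P φ m k with hT
  have hT0 : ∀ k, b k = 0 → T k = 0 := fun k hk => by simp [hT, hk]
  have hB : 0 ≤ S * bilinearBound P A F₂ Q Z := mul_nonneg hS (Real.sqrt_nonneg _)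
  have h1 : ∑ k ∈ Ioc 0 (4 * P), T k = ∑ k ∈ Ioc U (2 ^ I * U), T k := by
    have hs1 : ∑ k ∈ Ioc 0 (4 * P) ∩ Ioc U (2 ^ I * U), T k = ∑ k ∈ Ioc 0 (4 * P), T k := by
      apply sum_subset inter_subset_left
      intro k hk hk'
      simp only [mem_inter, mem_Ioc] at hk hk'
      apply hT0
      by_cases h : k ≤ U
      · exact hbU k h
      · exact hbZ k (by omega)
    have hs2 : ∑ k ∈ Ioc 0 (4 * P) ∩ Ioc U (2 ^ I * U), T k = ∑ k ∈ Ioc U (2 ^ I * U), T k := by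
      apply sum_subset inter_subset_right
      intro k hk hk'
      simp only [mem_inter, mem_Ioc] at hk hk'
      exact hT0 _ (hbZ k (by omega))
    rw [← hs1, hs2]
  have h2 : ∀ J : ℕ, ∑ k ∈ Ioc U (2 ^ J * U), T k =
      ∑ i ∈ range J, ∑ k ∈ Ioc (2 ^ i * U) (2 * (2 ^ i * U)), T k := by
    intro J
    induction J with
    | zero => simp
    | succ J ih =>
      rw [sum_range_succ, ← ih, show 2 ^ (J + 1) * U = 2 * (2 ^ J * U) by ring]
      have : U ≤ 2 ^ J * U := Nat.le_mul_of_pos_left _ (by positivity)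
      rw [sum_Ioc_consecutive _ this (by omega)]
  rw [h1, h2]
  refine (norm_sum_le _ _).trans ((sum_le_sum (g := fun _ => S * bilinearBound P A F₂ Q Z)
    fun i _ => ?_).trans (by simp))
  have hU : U ≤ 2 ^ i * U := Nat.le_mul_of_pos_left _ (by positivity)
  by_cases h : 2 ^ i * U ≤ Z
  · exact norm_bilinear_block_le hφ hP hQ (hQU.trans hU) h hS ha hb hZP
  · rw [sum_eq_zero fun k hk => hT0 k (hbZ k (by rw [mem_Ioc] at hk; omega)), norm_zero]
    exact hB

theorem norm_bilinear_le {P : ℕ} {A F₁ F₂ s₁ s₂ : ℝ} {φ φ₁ φ₂ χ₁ : ℝ → ℝ}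
    (hφ : PhaseBounds P A F₁ F₂ s₁ s₂ φ φ₁ φ₂ χ₁) (hP : 0 < P) {U Q Z I : ℕ} (hQ : 0 < Q)
    (hQU : Q ≤ U) (hI : Z ≤ 2 ^ I * U) (hZ : 4 * P ≤ Z * Z) {a b : ℕ → ℂ} {S : ℝ} (hS : 0 ≤ S)
    (ha : ∀ x : ℕ, x ≤ 4 * P → ∑ m ∈ Ioc 0 x, ‖a m‖ ^ 2 ≤ x * S)
    (hb : ∀ x : ℕ, x ≤ 4 * P → ∑ m ∈ Ioc 0 x, ‖b m‖ ^ 2 ≤ x * S) (hZP : 2 * Z ≤ 4 * P)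
    (haU : ∀ k ≤ U, a k = 0) (hbU : ∀ k ≤ U, b k = 0) :
    ‖∑ k ∈ Ioc 0 (4 * P), ∑ m ∈ Ioc 0 (4 * P), a m * b k * phaseKernel P φ m k‖ ≤
      2 * I * (S * bilinearBound P A F₂ Q Z) := by
  have hle : ∀ (f : ℕ → ℂ) (p : ℕ → Prop) [DecidablePred p],
      (∀ x : ℕ, x ≤ 4 * P → ∑ m ∈ Ioc 0 x, ‖f m‖ ^ 2 ≤ x * S) →
      ∀ x : ℕ, x ≤ 4 * P → ∑ m ∈ Ioc 0 x, ‖if p m then f m else 0‖ ^ 2 ≤ x * S := by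
    intro f p _ hf x hx
    refine (sum_le_sum fun m _ => ?_).trans (hf x hx)
    split_ifs
    · exact le_rfl
    · simp
  have hsplit : ∑ k ∈ Ioc 0 (4 * P), ∑ m ∈ Ioc 0 (4 * P), a m * b k * phaseKernel P φ m k =
      (∑ k ∈ Ioc 0 (4 * P), ∑ m ∈ Ioc 0 (4 * P),
        a m * (if k ≤ Z then b k else 0) * phaseKernel P φ m k) +
      ∑ k ∈ Ioc 0 (4 * P), ∑ m ∈ Ioc 0 (4 * P),
        (if Z < m then b m else 0) * (if k ≤ Z then a k else 0) * phaseKernel P φ m k := by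
    rw [sum_comm (s := Ioc 0 (4 * P)) (t := Ioc 0 (4 * P))
      (f := fun k m => (if Z < m then b m else 0) * (if k ≤ Z then a k else 0) *
        phaseKernel P φ m k), ← sum_add_distrib]
    refine sum_congr rfl fun k _ => ?_
    rw [← sum_add_distrib]
    refine sum_congr rfl fun m _ => ?_
    rw [phaseKernel_comm P φ k m]
    by_cases hk : k ≤ Z
    · simp [hk, not_lt.2 hk]
    · by_cases hm : m ≤ Z
      · simp only [hk, hm, not_le.1 hk, if_true, if_false]; ring
      · have : Z * Z < m * k := Nat.mul_lt_mul'' (by omega) (by omega)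
        simp [phaseKernel, show ¬ (m * k ≤ 4 * P) by omega]
  rw [hsplit]
  refine (norm_add_le _ _).trans ?_
  have h1 := norm_bilinear_dyadic_le hφ hP hQ hQU hI hS ha (hle b (fun k => k ≤ Z) hb) hZP
    (fun k hk => by simp [hbU k hk]) (fun k hk => by simp [not_le.2 hk])
  have h2 := norm_bilinear_dyadic_le hφ hP hQ hQU hI hS (hle b (fun k => Z < k) hb)
    (hle a (fun k => k ≤ Z) ha) hZP
    (fun k hk => by simp [haU k hk]) (fun k hk => by simp [not_le.2 hk])
  linarith

/-- Partial summation against a monotone weight. -/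
theorem norm_sum_monotone_mul_le {w : ℕ → ℝ} (hw : Monotone w) {z : ℕ → ℂ} {B : ℝ} {b : ℕ} :
    ∀ a ≤ b, 0 ≤ w a → (∀ x, a ≤ x → x ≤ b → ‖∑ m ∈ Ioc x b, z m‖ ≤ B) →
      ‖∑ m ∈ Ioc a b, (w m : ℂ) * z m‖ ≤ w b * B := by
  have key : ∀ a ≤ b, (∀ x, a ≤ x → x ≤ b → ‖∑ m ∈ Ioc x b, z m‖ ≤ B) →
      ‖∑ m ∈ Ioc a b, ((w m - w a : ℝ) : ℂ) * z m‖ ≤ (w b - w a) * B := by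
    intro a hab
    induction hab using Nat.decreasingInduction with
    | self => simp
    | @of_succ a hab ih =>
      intro hB
      have ih' := ih fun x hx hxb => hB x (by omega) hxb
      have hsplit : ∑ m ∈ Ioc a b, ((w m - w a : ℝ) : ℂ) * z m =
          ((w (a + 1) - w a : ℝ) : ℂ) * ∑ m ∈ Ioc a b, z m +
            ∑ m ∈ Ioc (a + 1) b, ((w m - w (a + 1) : ℝ) : ℂ) * z m := by
        rw [← sum_Ioc_consecutive (fun m => ((w m - w a : ℝ) : ℂ) * z m) (Nat.le_succ a) hab,
          ← sum_Ioc_consecutive z (Nat.le_succ a) hab, Nat.Ioc_succ_singleton, sum_singleton,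
          sum_singleton, mul_add, mul_sum, add_assoc, ← sum_add_distrib]
        congr 1
        refine sum_congr rfl fun m _ => ?_
        push_cast
        ring
      rw [hsplit]
      refine (norm_add_le _ _).trans ?_
      rw [norm_mul, Complex.norm_real, Real.norm_of_nonneg (sub_nonneg.2 (hw (Nat.le_succ a)))]
      have := mul_le_mul_of_nonneg_left (hB a le_rfl (by omega))
        (sub_nonneg.2 (hw (Nat.le_succ a)))
      linarith
  intro a hab ha hB
  have hsplit : ∑ m ∈ Ioc a b, (w m : ℂ) * z m = (w a : ℂ) * ∑ m ∈ Ioc a b, z m +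
      ∑ m ∈ Ioc a b, ((w m - w a : ℝ) : ℂ) * z m := by
    rw [mul_sum, ← sum_add_distrib]
    refine sum_congr rfl fun m _ => ?_
    push_cast
    ring
  rw [hsplit]
  refine (norm_add_le _ _).trans ?_
  rw [norm_mul, Complex.norm_real, Real.norm_of_nonneg ha]
  have h1 := mul_le_mul_of_nonneg_left (hB a le_rfl hab) ha
  have h2 := key a hab hB
  linarith

theorem norm_sum_dilated_le {P : ℕ} {A F₁ F₂ s₁ s₂ : ℝ} {φ φ₁ φ₂ χ₁ : ℝ → ℝ}
    (hφ : PhaseBounds P A F₁ F₂ s₁ s₂ φ φ₁ φ₂ χ₁) (hP : 0 < P) {k a b : ℕ} (hk : 0 < k)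
    (ha : P / k ≤ a) (hb : b ≤ 4 * P / k) :
    ‖∑ m ∈ Ioc a b, unitExp (φ (m * k))‖ ≤ 64 * A * √F₁ + 36 * P / √F₁ := by
  have hA := hφ.one_le
  have hF := hφ.pos₁
  have hPr : (0 : ℝ) < P := by exact_mod_cast hP
  have hkr : (1 : ℝ) ≤ k := by exact_mod_cast hk
  have hk0 : (0 : ℝ) < k := by linarith
  have ha' : (P : ℝ) ≤ ((a : ℝ) + 1) * k := by
    have : P < (a + 1) * k := by
      rw [← Nat.div_lt_iff_lt_mul hk]; omega
    exact_mod_cast this.le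
  have hb' : (b : ℝ) * k ≤ 4 * P := by
    have : b * k ≤ 4 * P := by rwa [← Nat.le_div_iff_mul_le hk]
    exact_mod_cast this
  have hrange : ∀ x ∈ Set.Icc ((a : ℝ) + 1) b, x * k ∈ Set.Icc (P : ℝ) (4 * P) := fun x hx =>
    ⟨ha'.trans (mul_le_mul_of_nonneg_right hx.1 hk0.le),
      (mul_le_mul_of_nonneg_right hx.2 hk0.le).trans hb'⟩
  have hlam : 0 < F₁ * k ^ 2 / (16 * P ^ 2) := by positivity
  have hmain := norm_sum_unitExp_le_of_second_deriv (a := a) (b := b)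
    (f := fun x => φ (x * k)) (f₁ := fun x => φ₁ (x * k) * k)
    (f₂ := fun x => φ₂ (x * k) * k * k)
    (lam := F₁ * k ^ 2 / (16 * P ^ 2)) (A := 16 * A) (s := s₁) hlam (by linarith) hφ.sign₁
    (by
      intro t ht
      have d1 := (hφ.deriv₁ _ (hrange t ht)).comp t ((hasDerivAt_id t).mul_const (k : ℝ))
      simp only [one_mul] at d1
      exact d1)
    (by
      intro t ht
      have d1 := ((hφ.deriv₂ _ (hrange t ht)).comp t
        ((hasDerivAt_id t).mul_const (k : ℝ))).mul_const (k : ℝ)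
      simp only [one_mul] at d1
      exact d1)
    (by
      intro x hx
      have hr := hrange x hx
      have hl := hφ.lower₁ _ hr
      have hx0 : 0 < x * k := hPr.trans_le hr.1
      have hx1 : (x * k) ^ 2 ≤ (4 * P) ^ 2 := pow_le_pow_left₀ hx0.le hr.2 2
      have hx2 : s₁ * (φ₂ (x * k) * k * k) = s₁ * ((x * k) ^ 2 * φ₂ (x * k)) * k ^ 2 /
          (x * k) ^ 2 := by
        rw [eq_div_iff (by positivity)]; ring
      rw [hx2, div_le_div_iff₀ (by positivity) (by positivity)]
      calc F₁ * k ^ 2 * (x * k) ^ 2 ≤ F₁ * k ^ 2 * (4 * P) ^ 2 := by gcongr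
        _ = F₁ * k ^ 2 * (16 * P ^ 2) := by ring
        _ ≤ _ := by gcongr)
    (by
      intro x hx
      have hr := hrange x hx
      have hu := hφ.upper₁ _ hr
      have hx0 : 0 < x * k := hPr.trans_le hr.1
      have hx1 : (P : ℝ) ^ 2 ≤ (x * k) ^ 2 := pow_le_pow_left₀ hPr.le hr.1 2
      have hx2 : s₁ * (φ₂ (x * k) * k * k) = s₁ * ((x * k) ^ 2 * φ₂ (x * k)) * k ^ 2 /
          (x * k) ^ 2 := by
        rw [eq_div_iff (by positivity)]; ring
      rw [hx2, show 16 * A * (F₁ * k ^ 2 / (16 * P ^ 2)) = A * F₁ * k ^ 2 / P ^ 2 by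
        field_simp, div_le_div_iff₀ (by positivity) (by positivity)]
      calc _ ≤ A * F₁ * k ^ 2 * P ^ 2 := by gcongr
        _ ≤ _ := by gcongr)
  refine hmain.trans ?_
  have hsqrt : √(F₁ * k ^ 2 / (16 * P ^ 2)) = √F₁ * k / (4 * P) := by
    rw [Real.sqrt_div (by positivity), show (16 : ℝ) * P ^ 2 = (4 * P) ^ 2 by ring,
      Real.sqrt_sq (by positivity), Real.sqrt_mul hF.le, Real.sqrt_sq hk0.le]
  rw [hsqrt]
  have hs0 : 0 < √F₁ := Real.sqrt_pos.2 hF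
  have hlen : ((b - a : ℕ) : ℝ) * k ≤ 4 * P := by
    have : ((b - a : ℕ) : ℝ) ≤ b := by exact_mod_cast (by omega)
    nlinarith
  apply add_le_add
  · calc 4 * (16 * A) * (√F₁ * k / (4 * P)) * ((b - a : ℕ) : ℝ)
        = 64 * A * √F₁ / (4 * P) * (((b - a : ℕ) : ℝ) * k) := by ring
      _ ≤ 64 * A * √F₁ / (4 * P) * (4 * P) := by gcongr
      _ = 64 * A * √F₁ := by field_simp
  · rw [div_div_eq_mul_div, show 9 * (4 * (P : ℝ)) = 36 * P by ring]
    exact div_le_div_of_nonneg_left (by positivity) hs0 (by nlinarith)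

theorem norm_sum_monotone_mul_phaseKernel_le {P : ℕ} {A F₁ F₂ s₁ s₂ : ℝ}
    {φ φ₁ φ₂ χ₁ : ℝ → ℝ} (hφ : PhaseBounds P A F₁ F₂ s₁ s₂ φ φ₁ φ₂ χ₁) (hP : 0 < P) {k : ℕ}
    (hk : 0 < k) {w : ℕ → ℝ} (hw : Monotone w) (hw0 : 0 ≤ w 0) :
    ‖∑ m ∈ Ioc 0 (4 * P), (w m : ℂ) * phaseKernel P φ m k‖ ≤
      w (4 * P) * (64 * A * √F₁ + 36 * P / √F₁) := by
  have hA := hφ.one_le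
  have hF := hφ.pos₁
  have hsub : Ioc (P / k) (4 * P / k) ⊆ Ioc 0 (4 * P) :=
    Ioc_subset_Ioc (Nat.zero_le _) (Nat.div_le_self _ _)
  have h1 : ∑ m ∈ Ioc 0 (4 * P), (w m : ℂ) * phaseKernel P φ m k =
      ∑ m ∈ Ioc (P / k) (4 * P / k), (w m : ℂ) * unitExp (φ (m * k)) := by
    rw [← sum_subset hsub]
    · refine sum_congr rfl fun m hm => ?_
      rw [mem_Ioc, Nat.div_lt_iff_lt_mul hk, Nat.le_div_iff_mul_le hk] at hm
      rw [phaseKernel, if_pos hm]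
    · intro m _ hm
      rw [mem_Ioc, Nat.div_lt_iff_lt_mul hk, Nat.le_div_iff_mul_le hk] at hm
      rw [phaseKernel, if_neg hm, mul_zero]
  rw [h1]
  have hw1 : ∀ m, 0 ≤ w m := fun m => hw0.trans (hw (Nat.zero_le m))
  refine (norm_sum_monotone_mul_le hw (P / k) (Nat.div_le_div_right (by omega)) (hw1 _)
    fun x hx _ => norm_sum_dilated_le hφ hP hk hx le_rfl).trans ?_
  exact mul_le_mul_of_nonneg_right (hw (Nat.div_le_self _ _)) (by positivity)

/-- Bilinear sums in which one variable carries a monotone weight and the other is short. -/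
theorem norm_bilinear_monotone_le {P : ℕ} {A F₁ F₂ s₁ s₂ : ℝ}
    {φ φ₁ φ₂ χ₁ : ℝ → ℝ} (hφ : PhaseBounds P A F₁ F₂ s₁ s₂ φ φ₁ φ₂ χ₁) (hP : 0 < P)
    {w : ℕ → ℝ} (hw : Monotone w) (hw0 : 0 ≤ w 0) {g : ℕ → ℂ} {D : ℕ} {G : ℝ} (hG0 : 0 ≤ G)
    (hG : ∀ k ∈ Ioc 0 (4 * P), ‖g k‖ ≤ G) (hgD : ∀ k, D < k → g k = 0) :
    ‖∑ k ∈ Ioc 0 (4 * P), ∑ m ∈ Ioc 0 (4 * P), (w m : ℂ) * g k * phaseKernel P φ m k‖ ≤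
      D * (G * (w (4 * P) * (64 * A * √F₁ + 36 * P / √F₁))) := by
  have hA := hφ.one_le
  have hw1 : ∀ m, 0 ≤ w m := fun m => hw0.trans (hw (Nat.zero_le m))
  have hwP := hw1 (4 * P)
  set B := w (4 * P) * (64 * A * √F₁ + 36 * P / √F₁) with hB
  have hB0 : 0 ≤ B := by positivity
  have hterm : ∀ k ∈ Ioc 0 (4 * P),
      ‖∑ m ∈ Ioc 0 (4 * P), (w m : ℂ) * g k * phaseKernel P φ m k‖ ≤
        if k ≤ D then G * B else 0 := by
    intro k hk
    have : ∑ m ∈ Ioc 0 (4 * P), (w m : ℂ) * g k * phaseKernel P φ m k =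
        g k * ∑ m ∈ Ioc 0 (4 * P), (w m : ℂ) * phaseKernel P φ m k := by
      rw [mul_sum]; exact sum_congr rfl fun m _ => by ring
    rw [this, norm_mul]
    split_ifs with h
    · exact mul_le_mul (hG k hk)
        (norm_sum_monotone_mul_phaseKernel_le hφ hP (mem_Ioc.1 hk).1 hw hw0) (norm_nonneg _) hG0
    · rw [hgD k (by omega), norm_zero, zero_mul]
  refine (norm_sum_le _ _).trans ((sum_le_sum hterm).trans ?_)
  rw [← sum_filter, sum_const, nsmul_eq_mul]
  apply mul_le_mul_of_nonneg_right _ (by positivity)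
  have : (Ioc 0 (4 * P)).filter (fun k => k ≤ D) ⊆ Ioc 0 D := fun k hk => by
    simp only [mem_filter, mem_Ioc] at hk ⊢; omega
  have := card_le_card this
  rw [Nat.card_Ioc] at this
  exact_mod_cast this

section Vaughan

open ArithmeticFunction ArithmeticFunction.zeta ArithmeticFunction.Moebius

theorem sum_inv_Ioc_le (x : ℕ) : ∑ n ∈ Ioc 0 x, (1 / n : ℝ) ≤ 1 + Real.log x := by
  have h := harmonic_le_one_add_log x
  rw [harmonic_eq_sum_Icc] at h
  push_cast at h
  refine le_trans (le_of_eq ?_) h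
  have : Ioc 0 x = Icc 1 x := by ext; simp [Nat.succ_le_iff]
  rw [this]
  exact sum_congr rfl fun n _ => by rw [one_div]

theorem zeta_mul_zeta_apply (n : ℕ) :
    ((ζ : ArithmeticFunction ℝ) * ζ) n = #n.divisors := by
  rw [coe_zeta_mul_apply]
  rw [sum_congr rfl fun d hd => by
    rw [natCoe_apply, zeta_apply_ne (Nat.pos_of_mem_divisors hd).ne', Nat.cast_one]]
  simp

theorem card_divisorsAntidiagonal (n : ℕ) : #n.divisorsAntidiagonal = #n.divisors := by
  rw [← Nat.image_fst_divisorsAntidiagonal, card_image_of_injOn]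
  intro x hx y hy h
  rw [mem_coe, Nat.mem_divisorsAntidiagonal] at hx hy
  have hx1 : x.1 ≠ 0 := fun h0 => hx.2 (by rw [← hx.1, h0, zero_mul])
  refine Prod.ext h (mul_left_cancel₀ hx1 ?_)
  rw [hx.1, ← hy.1, h]

theorem card_divisors_mul_le (a b : ℕ) :
    #(a * b).divisors ≤ #a.divisors * #b.divisors := by
  open Pointwise in
  rw [Nat.divisors_mul]
  exact card_mul_le

theorem sum_card_divisors_le (x : ℕ) :
    ∑ n ∈ Ioc 0 x, (#n.divisors : ℝ) ≤ x * (1 + Real.log x) := by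
  have h := sum_Ioc_mul_zeta_eq_sum (ζ : ArithmeticFunction ℝ) x
  simp_rw [zeta_mul_zeta_apply] at h
  rw [h]
  calc _ ≤ ∑ n ∈ Ioc 0 x, (x : ℝ) * (1 / n) := by
        refine sum_le_sum fun n hn => ?_
        rw [natCoe_apply, zeta_apply_ne (mem_Ioc.1 hn).1.ne', Nat.cast_one, one_mul,
          mul_one_div]
        exact Nat.cast_div_le
    _ ≤ _ := by
        rw [← mul_sum]
        exact mul_le_mul_of_nonneg_left (sum_inv_Ioc_le x) (Nat.cast_nonneg x)

theorem log_natCast_mono {x y : ℕ} (h : x ≤ y) : Real.log x ≤ Real.log y := by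
  rcases Nat.eq_zero_or_pos x with rfl | hx
  · simpa using Real.log_natCast_nonneg y
  · exact Real.log_le_log (by exact_mod_cast hx) (by exact_mod_cast h)

theorem sum_card_divisors_div_le (x : ℕ) :
    ∑ n ∈ Ioc 0 x, (#n.divisors : ℝ) / n ≤ (1 + Real.log x) ^ 2 := by
  have h : ∀ n ∈ Ioc 0 x, (#n.divisors : ℝ) / n =
      ∑ y ∈ Ioc 0 x ×ˢ Ioc 0 x, if y.1 * y.2 = n then (1 / y.1 : ℝ) * (1 / y.2) else 0 := by
    intro n hn
    rw [mem_Ioc] at hn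
    rw [← sum_filter, ← Nat.divisorsAntidiagonal_eq_prod_filter_of_le hn.1.ne' hn.2]
    rw [sum_congr rfl (g := fun _ => (1 / n : ℝ)), sum_const, card_divisorsAntidiagonal,
      nsmul_eq_mul, mul_one_div]
    intro y hy
    rw [← (Nat.mem_divisorsAntidiagonal.1 hy).1]
    push_cast
    rw [one_div_mul_one_div]
  rw [sum_congr rfl h, sum_comm]
  have hlog := Real.log_natCast_nonneg x
  calc _ ≤ ∑ y ∈ Ioc 0 x ×ˢ Ioc 0 x, (1 / y.1 : ℝ) * (1 / y.2) := by
        refine sum_le_sum fun y _ => ?_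
        rw [sum_ite_eq]
        split_ifs
        · exact le_rfl
        · positivity
    _ = (∑ n ∈ Ioc 0 x, (1 / n : ℝ)) ^ 2 := by rw [sum_product, sq, sum_mul_sum]
    _ ≤ _ := pow_le_pow_left₀ (sum_nonneg fun _ _ => by positivity) (sum_inv_Ioc_le x) 2

/-- The second moment of the divisor function. -/
theorem sum_card_divisors_sq_le (x : ℕ) :
    ∑ n ∈ Ioc 0 x, (#n.divisors : ℝ) ^ 2 ≤ x * (1 + Real.log x) ^ 3 := by
  have hlog := Real.log_natCast_nonneg x
  have hle : ∀ n ∈ Ioc 0 x, (#n.divisors : ℝ) ^ 2 ≤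
      (((ζ : ArithmeticFunction ℝ) * ζ) * ((ζ : ArithmeticFunction ℝ) * ζ)) n := by
    intro n _
    rw [mul_apply]
    simp_rw [zeta_mul_zeta_apply]
    rw [sq, ← nsmul_eq_mul]
    nth_rw 1 [← card_divisorsAntidiagonal]
    rw [← sum_const]
    refine sum_le_sum fun y hy => ?_
    rw [← (Nat.mem_divisorsAntidiagonal.1 hy).1]
    exact_mod_cast card_divisors_mul_le _ _
  refine (sum_le_sum hle).trans ?_
  rw [sum_Ioc_mul_eq_sum_sum]
  simp_rw [zeta_mul_zeta_apply]
  calc _ ≤ ∑ n ∈ Ioc 0 x, (#n.divisors : ℝ) * ((x / n : ℝ) * (1 + Real.log x)) := by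
        refine sum_le_sum fun n hn => mul_le_mul_of_nonneg_left ?_ (Nat.cast_nonneg _)
        refine (sum_card_divisors_le _).trans ?_
        have := log_natCast_mono (Nat.div_le_self x n)
        have h0 := Real.log_natCast_nonneg (x / n)
        exact mul_le_mul Nat.cast_div_le (by linarith) (by linarith) (by positivity)
    _ = x * (1 + Real.log x) * ∑ n ∈ Ioc 0 x, (#n.divisors : ℝ) / n := by
        rw [mul_sum]
        exact sum_congr rfl fun n _ => by ring
    _ ≤ x * (1 + Real.log x) * (1 + Real.log x) ^ 2 :=
        mul_le_mul_of_nonneg_left (sum_card_divisors_div_le x) (by positivity)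
    _ = _ := by ring

/-- The restriction of an arithmetic function to `n ≤ V`. -/
def lowPart (V : ℕ) (f : ArithmeticFunction ℝ) : ArithmeticFunction ℝ :=
  ⟨fun n => if n ≤ V then f n else 0, by simp⟩

/-- The restriction of an arithmetic function to `n > V`. -/
def highPart (V : ℕ) (f : ArithmeticFunction ℝ) : ArithmeticFunction ℝ :=
  ⟨fun n => if n ≤ V then 0 else f n, by simp⟩

theorem lowPart_apply (V : ℕ) (f : ArithmeticFunction ℝ) (n : ℕ) :
    lowPart V f n = if n ≤ V then f n else 0 := rfl

theorem highPart_apply (V : ℕ) (f : ArithmeticFunction ℝ) (n : ℕ) :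
    highPart V f n = if n ≤ V then 0 else f n := rfl

theorem lowPart_add_highPart (V : ℕ) (f : ArithmeticFunction ℝ) :
    lowPart V f + highPart V f = f := by
  ext n
  rw [ArithmeticFunction.add_apply, lowPart_apply, highPart_apply]
  split_ifs <;> simp

/-- Vaughan's identity. -/
theorem highPart_vonMangoldt (U V : ℕ) :
    highPart V Λ = log * lowPart U μ - ζ * (lowPart V Λ * lowPart U μ) +
      highPart V Λ * (ζ * highPart U μ) := by
  have h1 : highPart V Λ * ζ = log - lowPart V Λ * ζ := by
    rw [← vonMangoldt_mul_zeta]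
    nth_rw 2 [← lowPart_add_highPart V Λ]
    ring
  have h2 : (ζ : ArithmeticFunction ℝ) * (lowPart U μ + highPart U μ) = 1 := by
    rw [lowPart_add_highPart, coe_zeta_mul_coe_moebius]
  calc highPart V Λ = highPart V Λ * (ζ * (lowPart U μ + highPart U μ)) := by rw [h2, mul_one]
    _ = (highPart V Λ * ζ) * lowPart U μ + highPart V Λ * (ζ * highPart U μ) := by ring
    _ = _ := by rw [h1]; ring

/-- A sum of a Dirichlet convolution as a bilinear form. -/
theorem sum_mul_unitExp_eq (P : ℕ) (φ : ℝ → ℝ) (f g : ArithmeticFunction ℝ) :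
    ∑ n ∈ Ioc P (4 * P), ((f * g) n : ℂ) * unitExp (φ n) =
      ∑ k ∈ Ioc 0 (4 * P), ∑ m ∈ Ioc 0 (4 * P), (f m : ℂ) * (g k : ℂ) * phaseKernel P φ m k := by
  have h : ∀ n ∈ Ioc P (4 * P), ((f * g) n : ℂ) * unitExp (φ n) =
      ∑ y ∈ Ioc 0 (4 * P) ×ˢ Ioc 0 (4 * P), if y.2 * y.1 = n then
        (f y.2 : ℂ) * (g y.1 : ℂ) * unitExp (φ (y.2 * y.1)) else 0 := by
    intro n hn
    rw [mem_Ioc] at hn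
    have hn0 : n ≠ 0 := by omega
    rw [mul_comm f g, mul_apply, ← sum_filter,
      Nat.divisorsAntidiagonal_eq_prod_filter_of_le hn0 hn.2]
    push_cast
    rw [sum_mul]
    simp_rw [mul_comm (_ : ℕ) _]
    refine sum_congr rfl fun y hy => ?_
    rw [← (mem_filter.1 hy).2]
    push_cast
    ring_nf
  rw [sum_congr rfl h, sum_comm, sum_product]
  refine sum_congr rfl fun k _ => sum_congr rfl fun m _ => ?_
  rw [sum_ite_eq, phaseKernel]
  simp only [mem_Ioc]
  split_ifs <;> simp

theorem norm_sum_vonMangoldt_le {P : ℕ} {A F₁ F₂ s₁ s₂ : ℝ} {φ φ₁ φ₂ χ₁ : ℝ → ℝ}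
    (hφ : PhaseBounds P A F₁ F₂ s₁ s₂ φ φ₁ φ₂ χ₁) (hP : 0 < P) {U Q Z I : ℕ} (hQ : 0 < Q)
    (hQU : Q ≤ U) (hUP : U ≤ P) (hI : Z ≤ 2 ^ I * U) (hZ : 4 * P ≤ Z * Z) (hZP : Z ≤ 2 * P) :
    ‖∑ n ∈ Ioc P (4 * P), (Λ n : ℂ) * unitExp (φ n)‖ ≤
      2 * U ^ 2 * (1 + Real.log (4 * P : ℕ)) * (64 * A * √F₁ + 36 * P / √F₁) +
      2 * I * ((1 + Real.log (4 * P : ℕ)) ^ 3 * bilinearBound P A F₂ Q Z) := by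
  set L := 1 + Real.log (4 * P : ℕ) with hL
  have hL1 : 1 ≤ L := by have := Real.log_natCast_nonneg (4 * P); linarith
  have hA := hφ.one_le
  set B := 64 * A * √F₁ + 36 * P / √F₁ with hB
  have hB0 : 0 ≤ B := by positivity
  have hU1 : (1 : ℝ) ≤ U := by exact_mod_cast (by omega : 1 ≤ U)
  have hlogle : ∀ k ∈ Ioc 0 (4 * P), Real.log k ≤ L := fun k hk => by
    have := log_natCast_mono (mem_Ioc.1 hk).2
    linarith
  have hμ : ∀ n, |(μ n : ℝ)| ≤ 1 := fun n => by
    rw [← Int.cast_abs]; exact_mod_cast abs_moebius_le_one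
  have hlow : ∀ n, |lowPart U (μ : ArithmeticFunction ℝ) n| ≤ 1 := fun n => by
    rw [lowPart_apply]
    split_ifs
    · exact hμ n
    · simp
  have hhigh : ∀ n, |highPart U (μ : ArithmeticFunction ℝ) n| ≤ 1 := fun n => by
    rw [highPart_apply]
    split_ifs
    · simp
    · exact hμ n
  have hsum : ∑ n ∈ Ioc P (4 * P), (Λ n : ℂ) * unitExp (φ n) =
      (∑ n ∈ Ioc P (4 * P), (((log * lowPart U μ) n : ℝ) : ℂ) * unitExp (φ n)) -
      (∑ n ∈ Ioc P (4 * P), ((((ζ : ArithmeticFunction ℝ) * (lowPart U Λ * lowPart U μ)) n : ℝ) : ℂ)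
        * unitExp (φ n)) +
      ∑ n ∈ Ioc P (4 * P), (((highPart U Λ * (ζ * highPart U μ)) n : ℝ) : ℂ) * unitExp (φ n) := by
    rw [← sum_sub_distrib, ← sum_add_distrib]
    refine sum_congr rfl fun n hn => ?_
    rw [mem_Ioc] at hn
    have h1 : Λ n = highPart U Λ n := by rw [highPart_apply, if_neg (by omega)]
    have h2 := congrArg (fun f : ArithmeticFunction ℝ => f n) (highPart_vonMangoldt U U)
    simp only [ArithmeticFunction.add_apply, sub_eq_add_neg, ArithmeticFunction.neg_apply] at h2
    rw [h1, h2]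
    push_cast
    ring
  have hT1 : ‖∑ n ∈ Ioc P (4 * P), (((log * lowPart U μ) n : ℝ) : ℂ) * unitExp (φ n)‖ ≤
      U * (1 * (L * B)) := by
    rw [sum_mul_unitExp_eq]
    refine (norm_bilinear_monotone_le hφ hP (w := fun m => Real.log m) (g := fun k =>
      ((lowPart U μ k : ℝ) : ℂ)) (D := U) (G := 1) (fun x y h => log_natCast_mono h) (by simp)
      zero_le_one (fun k _ => ?_) (fun k hk => ?_)).trans ?_
    · rw [Complex.norm_real]; exact hlow k
    · rw [lowPart_apply, if_neg (by omega), Complex.ofReal_zero]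
    · have : Real.log (4 * P : ℕ) ≤ L := by linarith
      gcongr
  have hT2 : ‖∑ n ∈ Ioc P (4 * P), ((((ζ : ArithmeticFunction ℝ) *
      (lowPart U Λ * lowPart U μ)) n : ℝ) : ℂ) * unitExp (φ n)‖ ≤
      (U * U : ℕ) * (L * (1 * B)) := by
    rw [sum_mul_unitExp_eq]
    have hζ : ∑ k ∈ Ioc 0 (4 * P), ∑ m ∈ Ioc 0 (4 * P), (((ζ : ArithmeticFunction ℝ) m : ℝ) : ℂ) *
        (((lowPart U Λ * lowPart U μ) k : ℝ) : ℂ) * phaseKernel P φ m k =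
        ∑ k ∈ Ioc 0 (4 * P), ∑ m ∈ Ioc 0 (4 * P), (((1 : ℝ)) : ℂ) *
        (((lowPart U Λ * lowPart U μ) k : ℝ) : ℂ) * phaseKernel P φ m k := by
      refine sum_congr rfl fun k _ => sum_congr rfl fun m hm => ?_
      rw [natCoe_apply, zeta_apply_ne (mem_Ioc.1 hm).1.ne', Nat.cast_one]
    rw [hζ]
    refine norm_bilinear_monotone_le hφ hP (w := fun _ => (1 : ℝ)) (g := fun k =>
      (((lowPart U Λ * lowPart U μ) k : ℝ) : ℂ)) (D := U * U) (G := L) (fun x y h => le_rfl)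
      zero_le_one (by linarith) (fun k hk => ?_) (fun k hk => ?_)
    · rw [Complex.norm_real, mul_apply, Real.norm_eq_abs]
      refine (abs_sum_le_sum_abs _ _).trans ?_
      calc _ ≤ ∑ y ∈ k.divisorsAntidiagonal, Λ y.1 := by
            refine sum_le_sum fun y _ => ?_
            rw [abs_mul]
            have h1 : |lowPart U Λ y.1| ≤ Λ y.1 := by
              rw [lowPart_apply]
              split_ifs
              · rw [abs_of_nonneg vonMangoldt_nonneg]
              · simp
            calc _ ≤ Λ y.1 * 1 := mul_le_mul h1 (hlow _) (abs_nonneg _) vonMangoldt_nonneg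
              _ = _ := mul_one _
        _ = Real.log k := by
            rw [Nat.sum_divisorsAntidiagonal (fun i _ => Λ i), vonMangoldt_sum]
        _ ≤ L := hlogle k hk
    · rw [mul_apply, sum_eq_zero, Complex.ofReal_zero]
      intro y hy
      have hy' := (Nat.mem_divisorsAntidiagonal.1 hy).1
      rw [lowPart_apply, lowPart_apply]
      split_ifs with h1 h2
      · have := Nat.mul_le_mul h1 h2
        omega
      all_goals simp
  have hT3 : ‖∑ n ∈ Ioc P (4 * P), (((highPart U Λ * (ζ * highPart U μ)) n : ℝ) : ℂ) *
      unitExp (φ n)‖ ≤ 2 * I * (L ^ 3 * bilinearBound P A F₂ Q Z) := by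
    rw [sum_mul_unitExp_eq]
    refine norm_bilinear_le hφ hP hQ hQU hI hZ (a := fun m => ((highPart U Λ m : ℝ) : ℂ))
      (b := fun k => (((ζ * highPart U μ : ArithmeticFunction ℝ) k : ℝ) : ℂ)) (S := L ^ 3)
      (by positivity) ?_ ?_ (by omega) ?_ ?_
    · intro x hx
      calc _ ≤ ∑ m ∈ Ioc 0 x, L ^ 3 := by
            refine sum_le_sum fun m hm => ?_
            rw [mem_Ioc] at hm
            have h1 : |highPart U Λ m| ≤ L := by
              rw [highPart_apply]
              split_ifs
              · simp; linarith
              · rw [abs_of_nonneg vonMangoldt_nonneg]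
                exact vonMangoldt_le_log.trans (hlogle m (mem_Ioc.2 (by omega)))
            rw [Complex.norm_real, Real.norm_eq_abs]
            calc _ ≤ L ^ 2 := pow_le_pow_left₀ (abs_nonneg _) h1 2
              _ ≤ L ^ 3 := pow_le_pow_right₀ hL1 (by norm_num)
        _ = _ := by simp
    · intro x hx
      calc _ ≤ ∑ m ∈ Ioc 0 x, (#m.divisors : ℝ) ^ 2 := by
            refine sum_le_sum fun m _ => ?_
            rw [Complex.norm_real, Real.norm_eq_abs]
            apply pow_le_pow_left₀ (abs_nonneg _)
            rw [coe_zeta_mul_apply]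
            refine (abs_sum_le_sum_abs _ _).trans ((sum_le_sum fun i _ => hhigh i).trans ?_)
            simp
        _ ≤ x * (1 + Real.log x) ^ 3 := sum_card_divisors_sq_le x
        _ ≤ x * L ^ 3 := by
            have h1 := Real.log_natCast_nonneg x
            have h2 := log_natCast_mono hx
            gcongr
            linarith
    · intro k hk
      simp only [highPart_apply, if_pos hk, Complex.ofReal_zero]
    · intro k hk
      simp only [coe_zeta_mul_apply]
      rw [sum_eq_zero, Complex.ofReal_zero]
      intro i hi
      rw [highPart_apply, if_pos ((Nat.divisor_le hi).trans hk)]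
  rw [hsum]
  refine (norm_add_le _ _).trans (add_le_add ((norm_sub_le _ _).trans ?_) hT3)
  refine (add_le_add hT1 hT2).trans ?_
  push_cast
  have : (U : ℝ) * (L * B) ≤ U ^ 2 * (L * B) :=
    mul_le_mul_of_nonneg_right (by nlinarith) (by positivity)
  nlinarith

end Vaughan

theorem sqrt_rpow {x : ℝ} (hx : 0 ≤ x) (a : ℝ) : √(x ^ a) = x ^ (a / 2) := by
  rw [Real.sqrt_eq_rpow, ← Real.rpow_mul hx]; congr 1; ring

theorem eventually_one_add_log_le {ε : ℝ} (hε : 0 < ε) :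
    ∀ᶠ P : ℕ in Filter.atTop, 1 + Real.log (4 * P : ℕ) ≤ (P : ℝ) ^ ε := by
  have h := (isLittleO_log_rpow_atTop hε).bound (show (0 : ℝ) < 1 / 2 by norm_num)
  have h2 := (tendsto_rpow_atTop hε).eventually_ge_atTop (2 * (1 + Real.log 4))
  filter_upwards [tendsto_natCast_atTop_atTop.eventually h,
    tendsto_natCast_atTop_atTop.eventually h2, Filter.eventually_ge_atTop 1] with P h1 h2 hP
  have hPr : (0 : ℝ) < P := by exact_mod_cast hP
  rw [Real.norm_of_nonneg (by positivity : (0 : ℝ) ≤ (P : ℝ) ^ ε)] at h1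
  have h3 := (le_abs_self _).trans h1
  push_cast
  rw [Real.log_mul (by norm_num) hPr.ne']
  linarith

theorem bilinearBound_le {P : ℕ} {A F : ℝ} {Q Z : ℕ} (hA : 1 ≤ A) (hP : 1 ≤ P)
    (hF : (P : ℝ) ^ (0.99 : ℝ) ≤ F) (hF' : F ≤ A * (P : ℝ) ^ (16 / 15 : ℝ))
    (hQ : (P : ℝ) ^ (0.144 : ℝ) / 2 ≤ Q) (hQ' : (Q : ℝ) ≤ (P : ℝ) ^ (0.144 : ℝ))
    (hZ : (Z : ℝ) ≤ 3 * (P : ℝ) ^ (0.5 : ℝ)) :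
    bilinearBound P A F Q Z ≤ √(1920 + 12288 * A * √(3 * A)) * (P : ℝ) ^ (0.928 : ℝ) := by
  have hx1 : (1 : ℝ) ≤ P := by exact_mod_cast hP
  set x : ℝ := (P : ℝ) with hx
  have hx0 : 0 < x := by linarith
  have hF0 : 0 < F := lt_of_lt_of_le (by positivity) hF
  have hQ0 : (0 : ℝ) < Q := lt_of_lt_of_le (by positivity) hQ
  have h1 : 96 * x ^ 2 / Q ≤ 192 * x ^ (1.856 : ℝ) := by
    rw [div_le_iff₀ hQ0]
    calc 96 * x ^ 2 = 192 * x ^ (1.856 : ℝ) * (x ^ (0.144 : ℝ) / 2) := by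
          rw [show (192 : ℝ) * x ^ (1.856 : ℝ) * (x ^ (0.144 : ℝ) / 2) =
            96 * (x ^ (1.856 : ℝ) * x ^ (0.144 : ℝ)) by ring, ← Real.rpow_add hx0]
          norm_num
      _ ≤ _ := by gcongr
  have h2 : x * √(Q * F * Z) ≤ √(3 * A) * x ^ (1.856 : ℝ) := by
    calc x * √(Q * F * Z) ≤ x * √((x ^ (0.144 : ℝ)) * (A * x ^ (16 / 15 : ℝ)) *
          (3 * x ^ (0.5 : ℝ))) := by gcongr
      _ = √(3 * A) * (x ^ (1 : ℝ) * x ^ ((0.144 + 16 / 15 + 0.5 : ℝ) / 2)) := by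
          rw [show x ^ (0.144 : ℝ) * (A * x ^ (16 / 15 : ℝ)) * (3 * x ^ (0.5 : ℝ)) =
            3 * A * (x ^ (0.144 : ℝ) * x ^ (16 / 15 : ℝ) * x ^ (0.5 : ℝ)) by ring,
            ← Real.rpow_add hx0, ← Real.rpow_add hx0, Real.sqrt_mul (by positivity),
            sqrt_rpow hx0.le, Real.rpow_one]
          ring
      _ ≤ _ := by
          rw [← Real.rpow_add hx0]
          gcongr
          norm_num
  have h3 : x * (x * √(Z / F)) ≤ 2 * x ^ (1.856 : ℝ) := by
    calc x * (x * √(Z / F)) ≤ x * (x * √(3 * x ^ (0.5 : ℝ) / x ^ (0.99 : ℝ))) := by gcongr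
      _ = √3 * (x ^ (1 : ℝ) * x ^ (1 : ℝ) * x ^ ((0.5 - 0.99 : ℝ) / 2)) := by
          rw [mul_div_assoc, ← Real.rpow_sub hx0, Real.sqrt_mul (by positivity),
            sqrt_rpow hx0.le, Real.rpow_one]
          ring
      _ ≤ _ := by
          rw [← Real.rpow_add hx0, ← Real.rpow_add hx0]
          have : √3 ≤ 2 := by rw [Real.sqrt_le_left (by norm_num)]; norm_num
          gcongr
          norm_num
  rw [bilinearBound]
  calc _ ≤ √((1920 + 12288 * A * √(3 * A)) * x ^ (1.856 : ℝ)) := by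
        apply Real.sqrt_le_sqrt
        have h2' := mul_le_mul_of_nonneg_left h2 (by positivity : 0 ≤ 12288 * A)
        calc 96 * x ^ 2 / Q + 24 * x * (512 * A * √(Q * F * Z) + 36 * x * √(Z / F))
            = 96 * x ^ 2 / Q + 12288 * A * (x * √(Q * F * Z)) + 864 * (x * (x * √(Z / F))) := by
              ring
          _ ≤ _ := by linarith
    _ = _ := by
        rw [Real.sqrt_mul (by positivity), sqrt_rpow hx0.le]
        norm_num

/-- Exponential sums over primes with a smooth phase of size between `P ^ 0.99` and
`P ^ (16 / 15)`. -/
theorem eventually_norm_sum_vonMangoldt_le (A : ℝ) :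
    ∀ᶠ P : ℕ in Filter.atTop, ∀ (F₁ F₂ s₁ s₂ : ℝ) (φ φ₁ φ₂ χ₁ : ℝ → ℝ),
      PhaseBounds P A F₁ F₂ s₁ s₂ φ φ₁ φ₂ χ₁ →
      (P : ℝ) ^ (0.99 : ℝ) ≤ F₁ → F₁ ≤ A * (P : ℝ) ^ (16 / 15 : ℝ) →
      (P : ℝ) ^ (0.99 : ℝ) ≤ F₂ → F₂ ≤ A * (P : ℝ) ^ (16 / 15 : ℝ) →
      ‖∑ n ∈ Ioc P (4 * P), (ArithmeticFunction.vonMangoldt n : ℂ) * unitExp (φ n)‖ ≤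
        (P : ℝ) ^ (0.9285 : ℝ) := by
  set C : ℝ := 2 * (64 * A * √A + 36) + 4 * √(1920 + 12288 * A * √(3 * A)) with hC
  have hbig := (tendsto_rpow_atTop (show (0 : ℝ) < 0.0004 by norm_num)).eventually_ge_atTop C
  have hbig2 := (tendsto_rpow_atTop (show (0 : ℝ) < 0.144 by norm_num)).eventually_ge_atTop 2
  filter_upwards [eventually_one_add_log_le (show (0 : ℝ) < 0.00001 by norm_num),
    tendsto_natCast_atTop_atTop.eventually hbig, tendsto_natCast_atTop_atTop.eventually hbig2,
    Filter.eventually_ge_atTop 4] with P hlog hPC hP2 hP4 F₁ F₂ s₁ s₂ φ φ₁ φ₂ χ₁ hφ h1 h1' h2 h2'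
  have hA := hφ.one_le
  have hx4 : (4 : ℝ) ≤ P := by exact_mod_cast hP4
  have hP0 : 0 < P := by omega
  set x : ℝ := (P : ℝ) with hx
  have hx0 : 0 < x := by linarith
  have hx1 : 1 ≤ x := by linarith
  set L := 1 + Real.log (4 * P : ℕ) with hL
  have hL1 : 1 ≤ L := by have := Real.log_natCast_nonneg (4 * P); linarith
  set Q := ⌊x ^ (0.144 : ℝ)⌋₊ with hQ
  set U := ⌊x ^ (0.16 : ℝ)⌋₊ with hU
  set Z := Nat.sqrt (4 * P) + 1 with hZ
  set I := Nat.log 2 Z + 1 with hI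
  have hQle : (Q : ℝ) ≤ x ^ (0.144 : ℝ) := Nat.floor_le (by positivity)
  have hQge : x ^ (0.144 : ℝ) / 2 ≤ Q := by
    have : x ^ (0.144 : ℝ) < Q + 1 := Nat.lt_floor_add_one _
    linarith
  have hQ0 : 0 < Q := by
    have : (0 : ℝ) < Q := by linarith
    exact_mod_cast this
  have hQU : Q ≤ U := Nat.floor_le_floor (Real.rpow_le_rpow_of_exponent_le hx1 (by norm_num))
  have hUle : (U : ℝ) ≤ x ^ (0.16 : ℝ) := Nat.floor_le (by positivity)
  have hU0 : 0 < U := by omega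
  have hUP : U ≤ P := by
    have : (U : ℝ) ≤ x := hUle.trans (by
      calc x ^ (0.16 : ℝ) ≤ x ^ (1 : ℝ) := Real.rpow_le_rpow_of_exponent_le hx1 (by norm_num)
        _ = x := Real.rpow_one x)
    rw [hx] at this
    exact_mod_cast this
  have hIZ : Z ≤ 2 ^ I * U := (Nat.lt_pow_succ_log_self (by norm_num) Z).le.trans
    (Nat.le_mul_of_pos_right _ hU0)
  have hZZ : 4 * P ≤ Z * Z := (Nat.lt_succ_sqrt (4 * P)).le
  have hsq := Nat.sqrt_le (4 * P)
  have hZP : Z ≤ 2 * P := by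
    by_contra h
    have h3 : 2 * P ≤ Nat.sqrt (4 * P) := by omega
    have h4 : 2 * P * (2 * P) ≤ 4 * P := (Nat.mul_le_mul h3 h3).trans hsq
    nlinarith
  have hZle : (Z : ℝ) ≤ 3 * x ^ (0.5 : ℝ) := by
    have e : x ^ (0.5 : ℝ) = √x := by rw [Real.sqrt_eq_rpow]; norm_num
    have h3 : (Nat.sqrt (4 * P) : ℝ) ≤ 2 * √x := by
      rw [show (2 : ℝ) * √x = √(4 * x) by
        rw [Real.sqrt_mul (by norm_num), show (4 : ℝ) = 2 ^ 2 by norm_num,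
          Real.sqrt_sq (by norm_num)]]
      apply Real.le_sqrt_of_sq_le
      rw [sq, hx]
      exact_mod_cast hsq
    have h4 : 1 ≤ √x := Real.one_le_sqrt.2 hx1
    rw [e, hZ]
    push_cast
    linarith
  have hIle : (I : ℝ) ≤ 2 * L := by
    have h3 : (Nat.log 2 Z : ℝ) ≤ Real.logb 2 Z := Real.natLog_le_logb Z 2
    have h4 : Real.log Z ≤ Real.log (4 * P : ℕ) := log_natCast_mono (by omega)
    have h5 := Real.log_two_gt_d9
    have h6 := Real.log_natCast_nonneg Z
    have h7 : Real.logb 2 Z ≤ 2 * Real.log Z := by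
      rw [Real.logb, div_le_iff₀ (by linarith)]
      nlinarith
    rw [hI, hL]
    push_cast at h4 ⊢
    linarith
  refine (norm_sum_vonMangoldt_le hφ hP0 hQ0 hQU hUP hIZ hZZ hZP).trans ?_
  rw [← hL]
  have hbil := bilinearBound_le hA (by omega) h2 h2' hQge hQle hZle
  have hB0 : 0 ≤ bilinearBound P A F₂ Q Z := Real.sqrt_nonneg _
  have hF0 : 0 < F₁ := hφ.pos₁
  have hB : 64 * A * √F₁ + 36 * x / √F₁ ≤ (64 * A * √A + 36) * x ^ (0.54 : ℝ) := by
    have e1 : √F₁ ≤ √A * x ^ (0.54 : ℝ) := by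
      calc √F₁ ≤ √(A * x ^ (16 / 15 : ℝ)) := Real.sqrt_le_sqrt h1'
        _ = √A * x ^ ((16 / 15 : ℝ) / 2) := by
          rw [Real.sqrt_mul (by linarith), sqrt_rpow hx0.le]
        _ ≤ _ := by
          gcongr
          norm_num
    have e2 : x / √F₁ ≤ x ^ (0.54 : ℝ) := by
      calc x / √F₁ ≤ x / √(x ^ (0.99 : ℝ)) := by gcongr
        _ = x ^ (1 - (0.99 : ℝ) / 2) := by
          rw [sqrt_rpow hx0.le, Real.rpow_sub hx0, Real.rpow_one]
        _ ≤ _ := Real.rpow_le_rpow_of_exponent_le hx1 (by norm_num)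
    have e3 := mul_le_mul_of_nonneg_left e1 (by linarith : 0 ≤ 64 * A)
    rw [mul_div_assoc]
    linarith
  calc 2 * (U : ℝ) ^ 2 * L * (64 * A * √F₁ + 36 * x / √F₁) +
        2 * I * (L ^ 3 * bilinearBound P A F₂ Q Z)
      ≤ 2 * (x ^ (0.16 : ℝ)) ^ 2 * x ^ (0.00001 : ℝ) * ((64 * A * √A + 36) * x ^ (0.54 : ℝ)) +
        2 * (2 * x ^ (0.00001 : ℝ)) * ((x ^ (0.00001 : ℝ)) ^ 3 *
          (√(1920 + 12288 * A * √(3 * A)) * x ^ (0.928 : ℝ))) := by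
        have : (I : ℝ) ≤ 2 * x ^ (0.00001 : ℝ) := by linarith
        gcongr
    _ = 2 * (64 * A * √A + 36) * x ^ (0.16 + 0.16 + 0.00001 + 0.54 : ℝ) +
        4 * √(1920 + 12288 * A * √(3 * A)) *
          x ^ (0.00001 + 0.00001 + 0.00001 + 0.00001 + 0.928 : ℝ) := by
        simp only [Real.rpow_add hx0]
        ring
    _ ≤ 2 * (64 * A * √A + 36) * x ^ (0.9281 : ℝ) +
        4 * √(1920 + 12288 * A * √(3 * A)) * x ^ (0.9281 : ℝ) := by
        gcongr <;> norm_num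
    _ = C * x ^ (0.9281 : ℝ) := by rw [hC]; ring
    _ ≤ x ^ (0.0004 : ℝ) * x ^ (0.9281 : ℝ) := by gcongr
    _ = x ^ (0.9285 : ℝ) := by rw [← Real.rpow_add hx0]; norm_num

theorem eventually_norm_sum_log_prime_le (A : ℝ) :
    ∀ᶠ P : ℕ in Filter.atTop, ∀ (F₁ F₂ s₁ s₂ : ℝ) (φ φ₁ φ₂ χ₁ : ℝ → ℝ),
      PhaseBounds P A F₁ F₂ s₁ s₂ φ φ₁ φ₂ χ₁ →
      (P : ℝ) ^ (0.99 : ℝ) ≤ F₁ → F₁ ≤ A * (P : ℝ) ^ (16 / 15 : ℝ) →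
      (P : ℝ) ^ (0.99 : ℝ) ≤ F₂ → F₂ ≤ A * (P : ℝ) ^ (16 / 15 : ℝ) →
      ‖∑ p ∈ Ioc P (4 * P) with p.Prime, ((Real.log p : ℝ) : ℂ) * unitExp (φ p)‖ ≤
        2 * (P : ℝ) ^ (0.9285 : ℝ) := by
  have hbig := (tendsto_rpow_atTop (show (0 : ℝ) < 0.4 by norm_num)).eventually_ge_atTop 4
  filter_upwards [eventually_norm_sum_vonMangoldt_le A,
    eventually_one_add_log_le (show (0 : ℝ) < 0.0285 by norm_num),
    tendsto_natCast_atTop_atTop.eventually hbig,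
    Filter.eventually_ge_atTop 1] with P hΛ hlog hP4 hP1 F₁ F₂ s₁ s₂ φ φ₁ φ₂ χ₁ hφ h1 h1' h2 h2'
  have hx1 : (1 : ℝ) ≤ P := by exact_mod_cast hP1
  have hx0 : (0 : ℝ) < P := by linarith
  have key := hΛ F₁ F₂ s₁ s₂ φ φ₁ φ₂ χ₁ hφ h1 h1' h2 h2'
  rw [← sum_filter_add_sum_filter_not (Ioc P (4 * P)) Nat.Prime] at key
  have e : ∑ p ∈ Ioc P (4 * P) with p.Prime,
      (ArithmeticFunction.vonMangoldt p : ℂ) * unitExp (φ p) =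
      ∑ p ∈ Ioc P (4 * P) with p.Prime, ((Real.log p : ℝ) : ℂ) * unitExp (φ p) :=
    sum_congr rfl fun p hp => by
      rw [ArithmeticFunction.vonMangoldt_apply_prime (mem_filter.1 hp).2]
  rw [e] at key
  have hrest : ‖∑ p ∈ Ioc P (4 * P) with ¬ p.Prime,
      (ArithmeticFunction.vonMangoldt p : ℂ) * unitExp (φ p)‖ ≤ (P : ℝ) ^ (0.9285 : ℝ) := by
    calc _ ≤ ∑ p ∈ Ioc P (4 * P) with ¬ p.Prime, ArithmeticFunction.vonMangoldt p := by
          refine (norm_sum_le _ _).trans (sum_le_sum fun p _ => ?_)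
          rw [norm_mul, norm_unitExp, mul_one, Complex.norm_real,
            Real.norm_of_nonneg ArithmeticFunction.vonMangoldt_nonneg]
      _ ≤ ∑ p ∈ Ioc 0 ⌊(4 * P : ℝ)⌋₊ with ¬ p.Prime, ArithmeticFunction.vonMangoldt p := by
          refine sum_le_sum_of_subset_of_nonneg ?_
            fun _ _ _ => ArithmeticFunction.vonMangoldt_nonneg
          rw [show (4 * P : ℝ) = ((4 * P : ℕ) : ℝ) by push_cast; ring, Nat.floor_natCast]
          exact filter_subset_filter _ (Ioc_subset_Ioc_left (Nat.zero_le _))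
      _ ≤ 2 * √(4 * P : ℝ) * Real.log (4 * P : ℝ) := by
          rw [← Chebyshev.psi_sub_theta_eq_sum_not_prime]
          exact Chebyshev.psi_sub_theta_le (by linarith)
      _ ≤ 4 * (P : ℝ) ^ (0.5 : ℝ) * (P : ℝ) ^ (0.0285 : ℝ) := by
          have e1 : √(4 * P : ℝ) = 2 * (P : ℝ) ^ (0.5 : ℝ) := by
            rw [Real.sqrt_mul (by norm_num), show (4 : ℝ) = 2 ^ 2 by norm_num,
              Real.sqrt_sq (by norm_num), Real.sqrt_eq_rpow]
            norm_num
          rw [e1, show (2 : ℝ) * (2 * (P : ℝ) ^ (0.5 : ℝ)) = 4 * (P : ℝ) ^ (0.5 : ℝ) by ring]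
          gcongr
          push_cast at hlog
          linarith
      _ ≤ (P : ℝ) ^ (0.4 : ℝ) * (P : ℝ) ^ (0.5 : ℝ) * (P : ℝ) ^ (0.0285 : ℝ) := by gcongr
      _ = _ := by rw [← Real.rpow_add hx0, ← Real.rpow_add hx0]; norm_num
  have := norm_le_norm_add_norm_sub' (∑ p ∈ Ioc P (4 * P) with p.Prime,
    ((Real.log p : ℝ) : ℂ) * unitExp (φ p)) (-∑ p ∈ Ioc P (4 * P) with ¬ p.Prime,
      (ArithmeticFunction.vonMangoldt p : ℂ) * unitExp (φ p))
  rw [norm_neg, sub_neg_eq_add] at this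
  linarith

theorem eventually_le_sum_log_prime :
    ∀ᶠ P : ℕ in Filter.atTop, (P : ℝ) ≤ ∑ p ∈ Ioc P (4 * P) with p.Prime, Real.log p := by
  have hbig := (tendsto_rpow_atTop (show (0 : ℝ) < 0.4 by norm_num)).eventually_ge_atTop 20
  filter_upwards [eventually_one_add_log_le (show (0 : ℝ) < 0.1 by norm_num),
    tendsto_natCast_atTop_atTop.eventually hbig,
    Filter.eventually_ge_atTop 1] with P hlog hP4 hP1
  have hx1 : (1 : ℝ) ≤ P := by exact_mod_cast hP1
  have hx0 : (0 : ℝ) < P := by linarith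
  have h1 := Chebyshev.theta_ge (4 * P)
  have h2 := Chebyshev.theta_le_log4_mul_x hx0.le
  have e : ∑ p ∈ Ioc P (4 * P) with p.Prime, Real.log p =
      Chebyshev.theta (4 * P : ℕ) - Chebyshev.theta P := by
    rw [Chebyshev.theta, Chebyshev.theta, Nat.floor_natCast, Nat.floor_natCast, eq_sub_iff_add_eq',
      ← sum_union]
    · rw [← filter_union, Ioc_union_Ioc_eq_Ioc (by omega) (by omega)]
    · exact disjoint_filter_filter (Ioc_disjoint_Ioc_of_le le_rfl)
  rw [e]
  have e1 : √((4 * P : ℕ) : ℝ) = 2 * (P : ℝ) ^ (0.5 : ℝ) := by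
    push_cast
    rw [Real.sqrt_mul (by norm_num), show (4 : ℝ) = 2 ^ 2 by norm_num,
      Real.sqrt_sq (by norm_num), Real.sqrt_eq_rpow]
    norm_num
  have e2 : Real.log ((4 * P : ℕ) + 1) ≤ 1 + Real.log (4 * P : ℕ) := by
    have h0 : (1 : ℝ) ≤ (4 * P : ℕ) := by push_cast; linarith
    calc _ ≤ Real.log (2 * (4 * P : ℕ)) := Real.log_le_log (by linarith) (by linarith)
      _ ≤ _ := by
        rw [Real.log_mul (by norm_num) (by linarith)]
        linarith [Real.log_two_lt_d9]
  have e3 : 20 * ((P : ℝ) ^ (0.5 : ℝ) * (P : ℝ) ^ (0.1 : ℝ)) ≤ P := by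
    calc 20 * ((P : ℝ) ^ (0.5 : ℝ) * (P : ℝ) ^ (0.1 : ℝ))
        ≤ (P : ℝ) ^ (0.4 : ℝ) * ((P : ℝ) ^ (0.5 : ℝ) * (P : ℝ) ^ (0.1 : ℝ)) := by gcongr
      _ = P := by rw [← Real.rpow_add hx0, ← Real.rpow_add hx0]; norm_num
  have e4 : (P : ℝ) ^ (0.5 : ℝ) * Real.log (4 * P : ℕ) ≤
      (P : ℝ) ^ (0.5 : ℝ) * (P : ℝ) ^ (0.1 : ℝ) := by gcongr; linarith
  have e5 : (P : ℝ) ^ (0.1 : ℝ) ≤ (P : ℝ) ^ (0.5 : ℝ) * (P : ℝ) ^ (0.1 : ℝ) :=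
    le_mul_of_one_le_left (by positivity) (Real.one_le_rpow hx1 (by norm_num))
  have e6 : Real.log 4 = 2 * Real.log 2 := by
    rw [show (4 : ℝ) = 2 ^ 2 by norm_num, Real.log_pow]; norm_num
  have e7 : (0.69 : ℝ) * P ≤ Real.log 2 * P := by
    gcongr; linarith [Real.log_two_gt_d9]
  rw [e1] at h1
  rw [e6] at h2
  push_cast at h1 h2 e2 e4 hlog ⊢
  linarith

/-- Weighted Parseval inequality for almost orthogonal phases. -/
theorem abs_sum_norm_sq_sub_le {ι τ : Type*} [DecidableEq τ] (s : Finset ι) (T : Finset τ)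
    (w : ι → ℝ) (a : τ → ℝ) (f : τ → ι → ℝ) {E : ℝ}
    (hE : ∀ t ∈ T, ∀ t' ∈ T, t ≠ t' →
      ‖∑ i ∈ s, (w i : ℂ) * unitExp (f t i - f t' i)‖ ≤ E) (hE0 : 0 ≤ E) :
    |∑ i ∈ s, w i * ‖∑ t ∈ T, (a t : ℂ) * unitExp (f t i)‖ ^ 2 -
      (∑ t ∈ T, a t ^ 2) * ∑ i ∈ s, w i| ≤ (∑ t ∈ T, |a t|) ^ 2 * E := by
  have key : (((∑ i ∈ s, w i * ‖∑ t ∈ T, (a t : ℂ) * unitExp (f t i)‖ ^ 2 -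
      (∑ t ∈ T, a t ^ 2) * ∑ i ∈ s, w i : ℝ)) : ℂ) =
      ∑ t ∈ T, ∑ t' ∈ T, if t = t' then 0 else
        (a t * a t' : ℂ) * ∑ i ∈ s, (w i : ℂ) * unitExp (f t i - f t' i) := by
    have h1 : ((∑ i ∈ s, w i * ‖∑ t ∈ T, (a t : ℂ) * unitExp (f t i)‖ ^ 2 : ℝ) : ℂ) =
        ∑ t ∈ T, ∑ t' ∈ T,
          (a t * a t' : ℂ) * ∑ i ∈ s, (w i : ℂ) * unitExp (f t i - f t' i) := by
      push_cast
      simp_rw [← Complex.mul_conj', map_sum, map_mul, conj_unitExp, Complex.conj_ofReal,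
        sum_mul_sum, mul_sum]
      rw [sum_comm]
      refine sum_congr rfl fun t _ => ?_
      rw [sum_comm]
      refine sum_congr rfl fun t' _ => sum_congr rfl fun i _ => ?_
      rw [sub_eq_add_neg, unitExp_add]
      ring
    have h2 : (((∑ t ∈ T, a t ^ 2) * ∑ i ∈ s, w i : ℝ) : ℂ) =
        ∑ t ∈ T, ∑ t' ∈ T, if t = t' then
          (a t * a t' : ℂ) * ∑ i ∈ s, (w i : ℂ) * unitExp (f t i - f t' i) else 0 := by
      push_cast
      rw [sum_mul]
      refine sum_congr rfl fun t ht => ?_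
      rw [sum_ite_eq, if_pos ht]
      simp [unitExp_zero, sq]
    rw [Complex.ofReal_sub, h1, h2, ← sum_sub_distrib]
    refine sum_congr rfl fun t _ => ?_
    rw [← sum_sub_distrib]
    refine sum_congr rfl fun t' _ => ?_
    split_ifs <;> simp
  rw [← Real.norm_eq_abs, ← Complex.norm_real, key, sq, sum_mul_sum, sum_mul]
  refine (norm_sum_le _ _).trans (sum_le_sum fun t ht => ?_)
  rw [sum_mul]
  refine (norm_sum_le _ _).trans (sum_le_sum fun t' ht' => ?_)
  split_ifs with h
  · rw [norm_zero]; positivity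
  · rw [norm_mul, norm_mul, Complex.norm_real, Complex.norm_real, Real.norm_eq_abs,
      Real.norm_eq_abs]
    gcongr
    exact hE t ht t' ht' h

/-- The coefficients of the Fejér kernel of degree `4 * h`. -/
noncomputable def triangle (h l : ℕ) : ℝ := min (l : ℝ) (4 * h - l)

theorem triangle_zero (h : ℕ) : triangle h 0 = 0 := by simp [triangle]

theorem triangle_end (h : ℕ) : triangle h (4 * h) = 0 := by simp [triangle]

theorem abs_triangle_succ_sub_le (h l : ℕ) : |triangle h (l + 1) - triangle h l| ≤ 1 := by
  rw [triangle, triangle, abs_le]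
  push_cast
  constructor <;> rcases min_cases ((l : ℝ) + 1) (4 * h - (l + 1)) with ⟨e, _⟩ | ⟨e, _⟩ <;>
    rcases min_cases (l : ℝ) (4 * h - l) with ⟨e', _⟩ | ⟨e', _⟩ <;> rw [e, e'] <;> linarith

theorem abs_triangle_le {h l : ℕ} (hl : l < 4 * h) : |triangle h l| ≤ 2 * h := by
  have hl' : (l : ℝ) < 4 * h := by exact_mod_cast hl
  have h0 : (0 : ℝ) ≤ l := by positivity
  rw [triangle, abs_of_nonneg (le_min h0 (by linarith))]
  rcases min_cases (l : ℝ) (4 * h - l) with ⟨e, _⟩ | ⟨e, _⟩ <;> rw [e] <;> linarith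

theorem le_sum_triangle_sq (h : ℕ) : 2 * (h : ℝ) ^ 3 ≤ ∑ l ∈ range (4 * h), triangle h l ^ 2 := by
  calc 2 * (h : ℝ) ^ 3 = ∑ l ∈ Ico h (3 * h), (h : ℝ) ^ 2 := by
        rw [sum_const, Nat.card_Ico, nsmul_eq_mul, show 3 * h - h = 2 * h by omega]
        push_cast; ring
    _ ≤ ∑ l ∈ Ico h (3 * h), triangle h l ^ 2 := by
        refine sum_le_sum fun l hl => ?_
        have hl := mem_Ico.1 hl
        have h1 : (h : ℝ) ≤ l := by exact_mod_cast hl.1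
        have h2 : (l : ℝ) < 3 * h := by exact_mod_cast hl.2
        gcongr
        exact le_min h1 (by linarith)
    _ ≤ _ := by
        refine sum_le_sum_of_subset_of_nonneg (fun l hl => ?_) fun _ _ _ => sq_nonneg _
        have hl := mem_Ico.1 hl
        exact mem_range.2 (by omega)

theorem norm_one_sub_mul_sum_range {M : ℕ} {b : ℕ → ℝ} (h0 : b 0 = 0) (hM : b M = 0) (y : ℝ) :
    ‖(1 - unitExp y) * ∑ l ∈ range M, (b l : ℂ) * unitExp (l * y)‖ =
      ‖∑ l ∈ range M, ((b (l + 1) - b l : ℝ) : ℂ) * unitExp (l * y)‖ := by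
  have e : (1 - unitExp y) * ∑ l ∈ range M, (b l : ℂ) * unitExp (l * y) =
      unitExp y * ∑ l ∈ range M, ((b (l + 1) - b l : ℝ) : ℂ) * unitExp (l * y) := by
    have h1 := sum_range_succ' (fun l : ℕ => (b l : ℂ) * unitExp (l * y)) M
    rw [sum_range_succ, hM, h0, Complex.ofReal_zero, zero_mul, zero_mul, add_zero, add_zero] at h1
    rw [sub_mul, one_mul]
    nth_rewrite 1 [h1]
    rw [mul_sum, mul_sum, ← sum_sub_distrib]
    refine sum_congr rfl fun l _ => ?_
    push_cast
    rw [add_mul, one_mul, unitExp_add]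
    ring
  rw [e, norm_mul, norm_unitExp, one_mul]

/-- If the exponential sums in `x` and `y` are small, then `x i` and `y i` are simultaneously close
to integers for some `i`. -/
theorem exists_near_integers {ι : Type*} (s : Finset ι) {w : ι → ℝ} (hw : ∀ i ∈ s, 0 ≤ w i)
    (x y : ι → ℝ) {h : ℕ} (hh : 0 < h) {E : ℝ}
    (hE : ∀ j k : ℤ, j ≠ 0 ∨ k ≠ 0 → |j| ≤ 2 → |k| ≤ 4 * h →
      ‖∑ i ∈ s, (w i : ℂ) * unitExp (j * x i + k * y i)‖ ≤ E)
    (hS : 392 * h * E < ∑ i ∈ s, w i) :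
    ∃ i ∈ s, |x i - round (x i)| < 3 / 8 ∧ |y i - round (y i)| < 1 / h := by
  have hE0 : 0 ≤ E := (norm_nonneg _).trans (hE 1 0 (Or.inl one_ne_zero) (by norm_num) (by simp))
  have hhr : (0 : ℝ) < h := by exact_mod_cast hh
  have parseval : ∀ (K : ℕ) (hK : K ≤ 3) (α β : ℕ → ℝ),
      |∑ i ∈ s, w i * (‖∑ k ∈ range K, (α k : ℂ) * unitExp (k * x i)‖ *
        ‖∑ l ∈ range (4 * h), (β l : ℂ) * unitExp (l * y i)‖) ^ 2 -
        ((∑ k ∈ range K, α k ^ 2) * ∑ l ∈ range (4 * h), β l ^ 2) * ∑ i ∈ s, w i| ≤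
      ((∑ k ∈ range K, |α k|) * ∑ l ∈ range (4 * h), |β l|) ^ 2 * E := by
    intro K hK α β
    have := abs_sum_norm_sq_sub_le s (range K ×ˢ range (4 * h)) w (fun t => α t.1 * β t.2)
      (fun t i => t.1 * x i + t.2 * y i) (E := E) ?_ hE0
    · have e1 : ∀ i, ‖∑ t ∈ range K ×ˢ range (4 * h), ((α t.1 * β t.2 : ℝ) : ℂ) *
          unitExp (t.1 * x i + t.2 * y i)‖ =
          ‖∑ k ∈ range K, (α k : ℂ) * unitExp (k * x i)‖ *
            ‖∑ l ∈ range (4 * h), (β l : ℂ) * unitExp (l * y i)‖ := by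
        intro i
        rw [← norm_mul, sum_mul_sum, sum_product]
        congr 1
        refine sum_congr rfl fun k _ => sum_congr rfl fun l _ => ?_
        rw [unitExp_add]
        push_cast
        ring
      have e2 : ∑ t ∈ range K ×ˢ range (4 * h), (α t.1 * β t.2) ^ 2 =
          (∑ k ∈ range K, α k ^ 2) * ∑ l ∈ range (4 * h), β l ^ 2 := by
        simp_rw [sum_mul_sum, sum_product, mul_pow]
      have e3 : ∑ t ∈ range K ×ˢ range (4 * h), |α t.1 * β t.2| =
          (∑ k ∈ range K, |α k|) * ∑ l ∈ range (4 * h), |β l| := by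
        simp_rw [sum_mul_sum, sum_product, abs_mul]
      simpa only [e1, e2, e3] using this
    · rintro ⟨k, l⟩ ht ⟨k', l'⟩ ht' hne
      simp only [mem_product, mem_range] at ht ht'
      convert hE (k - k') (l - l') ?_ ?_ ?_ using 5
      · push_cast; ring
      · by_contra hcon
        push Not at hcon
        exact hne (Prod.ext (by simp only; omega) (by simp only; omega))
      · rw [abs_le]; omega
      · rw [abs_le]; omega
  set S := ∑ i ∈ s, w i with hSdef
  set B := ∑ l ∈ range (4 * h), triangle h l ^ 2 with hB
  have hBge : 2 * (h : ℝ) ^ 3 ≤ B := le_sum_triangle_sq h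
  have hβ : ∑ l ∈ range (4 * h), |triangle h l| ≤ 8 * (h : ℝ) ^ 2 := by
    refine (sum_le_sum fun l hl => abs_triangle_le (mem_range.1 hl)).trans (le_of_eq ?_)
    rw [sum_const, card_range, nsmul_eq_mul]; push_cast; ring
  have hd : ∑ l ∈ range (4 * h), |triangle h (l + 1) - triangle h l| ≤ 4 * (h : ℝ) := by
    refine (sum_le_sum fun l hl => abs_triangle_succ_sub_le h l).trans (le_of_eq ?_)
    rw [sum_const, card_range, nsmul_eq_mul]; push_cast; ring
  have hd2 : ∑ l ∈ range (4 * h), (triangle h (l + 1) - triangle h l) ^ 2 ≤ 4 * (h : ℝ) := by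
    refine (sum_le_sum fun l hl => (sq_le_one_iff_abs_le_one _).2
      (abs_triangle_succ_sub_le h l)).trans (le_of_eq ?_)
    rw [sum_const, card_range, nsmul_eq_mul]; push_cast; ring
  set A₁ : ι → ℝ := fun i => ‖1 + unitExp (x i)‖ with hA₁
  set A₂ : ι → ℝ := fun i => ‖∑ l ∈ range (4 * h), (triangle h l : ℂ) * unitExp (l * y i)‖ with hA₂
  have hβ0 : 0 ≤ ∑ l ∈ range (4 * h), |triangle h l| := sum_nonneg fun _ _ => abs_nonneg _
  have hd0 : 0 ≤ ∑ l ∈ range (4 * h), |triangle h (l + 1) - triangle h l| :=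
    sum_nonneg fun _ _ => abs_nonneg _
  have p1 : 2 * B * S - 256 * h ^ 4 * E ≤ ∑ i ∈ s, w i * (A₁ i * A₂ i) ^ 2 := by
    have p := (abs_le.1 (parseval 2 (by norm_num) (fun _ => 1) (triangle h))).1
    simp only [sum_range_succ, range_zero, sum_empty, Nat.cast_zero, zero_mul, unitExp_zero,
      Nat.cast_one, one_mul, Complex.ofReal_one, zero_add, abs_one, one_pow] at p
    have q : ((1 + 1) * ∑ l ∈ range (4 * h), |triangle h l|) ^ 2 * E ≤
        ((1 + 1) * (8 * (h : ℝ) ^ 2)) ^ 2 * E := by gcongr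
    linarith
  have p2 : ∑ i ∈ s, w i * (‖1 - unitExp (x i)‖ * A₁ i * A₂ i) ^ 2 ≤
      2 * B * S + 256 * h ^ 4 * E := by
    have p := (abs_le.1 (parseval 3 (by norm_num) (fun k => 1 - k) (triangle h))).2
    have e : ∀ i, ‖1 - unitExp (x i)‖ * A₁ i = ‖1 + ((1 - 2 : ℝ) : ℂ) * unitExp (2 * x i)‖ := by
      intro i
      rw [hA₁, ← norm_mul, two_mul, unitExp_add]
      congr 1
      push_cast
      ring
    simp only [sum_range_succ, range_zero, sum_empty, Nat.cast_zero, zero_mul, unitExp_zero,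
      Nat.cast_one, one_mul, Complex.ofReal_one, zero_add, sub_zero, sub_self, Complex.ofReal_zero,
      abs_one, one_pow, add_zero, Nat.cast_ofNat, abs_zero, mul_one] at p
    simp only [e]
    norm_num at p ⊢
    have q : ((1 + 1) * ∑ l ∈ range (4 * h), |triangle h l|) ^ 2 * E ≤
        ((1 + 1) * (8 * (h : ℝ) ^ 2)) ^ 2 * E := by gcongr
    norm_num at q
    linarith
  have p3 : ∑ i ∈ s, w i * (‖1 - unitExp (y i)‖ * A₁ i * A₂ i) ^ 2 ≤
      8 * h * S + 64 * h ^ 2 * E := by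
    have p := (abs_le.1 (parseval 2 (by norm_num) (fun _ => 1)
      (fun l => triangle h (l + 1) - triangle h l))).2
    have e : ∀ i, ‖1 - unitExp (y i)‖ * A₁ i * A₂ i = A₁ i *
        ‖∑ l ∈ range (4 * h), ((triangle h (l + 1) - triangle h l : ℝ) : ℂ) *
          unitExp (l * y i)‖ := by
      intro i
      rw [← norm_one_sub_mul_sum_range (triangle_zero h) (triangle_end h), norm_mul]
      ring
    simp only [sum_range_succ _ 1, range_one, sum_singleton, Nat.cast_zero, zero_mul, unitExp_zero,
      Nat.cast_one, one_mul, Complex.ofReal_one, abs_one, one_pow] at p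
    simp only [e]
    have q : ((1 + 1) * ∑ l ∈ range (4 * h), |triangle h (l + 1) - triangle h l|) ^ 2 * E ≤
        ((1 + 1) * (4 * (h : ℝ))) ^ 2 * E := by gcongr
    have q2 : (1 + 1) * (∑ l ∈ range (4 * h), (triangle h (l + 1) - triangle h l) ^ 2) * S ≤
        (1 + 1) * (4 * (h : ℝ)) * S := by
      have : 0 ≤ S := sum_nonneg hw
      gcongr
    linarith
  have hpos : 0 < ∑ i ∈ s, w i * ((A₁ i * A₂ i) ^ 2 *
      (2 - ‖1 - unitExp (x i)‖ ^ 2 - h ^ 2 / 4 * ‖1 - unitExp (y i)‖ ^ 2)) := by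
    have e : ∑ i ∈ s, w i * ((A₁ i * A₂ i) ^ 2 *
        (2 - ‖1 - unitExp (x i)‖ ^ 2 - h ^ 2 / 4 * ‖1 - unitExp (y i)‖ ^ 2)) =
        2 * ∑ i ∈ s, w i * (A₁ i * A₂ i) ^ 2 -
        ∑ i ∈ s, w i * (‖1 - unitExp (x i)‖ * A₁ i * A₂ i) ^ 2 -
        h ^ 2 / 4 * ∑ i ∈ s, w i * (‖1 - unitExp (y i)‖ * A₁ i * A₂ i) ^ 2 := by
      rw [mul_sum, mul_sum, ← sum_sub_distrib, ← sum_sub_distrib]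
      exact sum_congr rfl fun i _ => by ring
    rw [e]
    have hS0 : 0 ≤ S := sum_nonneg hw
    have q1 : 2 * (h : ℝ) ^ 3 * S ≤ B * S := by gcongr
    have q3 := mul_le_mul_of_nonneg_left p3 (by positivity : 0 ≤ (h : ℝ) ^ 2 / 4)
    have q4 := mul_lt_mul_of_pos_left hS (by positivity : 0 < 2 * (h : ℝ) ^ 3)
    nlinarith
  obtain ⟨i, hi, hWi⟩ := exists_lt_of_sum_lt (s := s) (f := fun _ => (0 : ℝ)) (by simpa using hpos)
  refine ⟨i, hi, ?_⟩
  have hW : 0 < 2 - ‖1 - unitExp (x i)‖ ^ 2 - h ^ 2 / 4 * ‖1 - unitExp (y i)‖ ^ 2 := by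
    by_contra hcon
    have := mul_nonpos_of_nonneg_of_nonpos (hw i hi)
      (mul_nonpos_of_nonneg_of_nonpos (sq_nonneg (A₁ i * A₂ i)) (not_lt.1 hcon))
    linarith
  have hx := pow_le_pow_left₀ (by positivity) (four_mul_abs_sub_round_le (x i)) 2
  have hy := pow_le_pow_left₀ (by positivity) (four_mul_abs_sub_round_le (y i)) 2
  have hy' := mul_le_mul_of_nonneg_left hy (by positivity : 0 ≤ (h : ℝ) ^ 2 / 4)
  have hx0 := abs_nonneg (x i - round (x i))
  have hy0 := abs_nonneg (y i - round (y i))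
  constructor
  · have : 0 ≤ (h : ℝ) ^ 2 / 4 * ‖1 - unitExp (y i)‖ ^ 2 := by positivity
    nlinarith
  · rw [lt_div_iff₀ hhr]
    have : (|y i - round (y i)| * h) ^ 2 < 1 := by
      have : 0 ≤ ‖1 - unitExp (x i)‖ ^ 2 := by positivity
      nlinarith
    nlinarith [mul_nonneg hy0 hhr.le]

theorem abs_rpow_sub_rpow_le {c a b R : ℝ} (hc : 1 ≤ c) (ha : 0 ≤ a) (hb : 0 ≤ b) (haR : a ≤ R)
    (hbR : b ≤ R) : |a ^ c - b ^ c| ≤ c * R ^ (c - 1) * |a - b| := by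
  have := (convex_Icc 0 R).norm_image_sub_le_of_norm_hasDerivWithin_le
    (f := fun x : ℝ => x ^ c) (f' := fun x => c * x ^ (c - 1)) (C := c * R ^ (c - 1))
    (fun x _ => (Real.hasDerivAt_rpow_const (Or.inr hc)).hasDerivWithinAt)
    (fun x hx => by
      have := hx.1
      rw [Real.norm_of_nonneg (by positivity)]
      have := hx.2
      have : 0 ≤ c - 1 := by linarith
      gcongr) (Set.mem_Icc.2 ⟨hb, hbR⟩) (Set.mem_Icc.2 ⟨ha, haR⟩)
  simpa only [Real.norm_eq_abs] using this

theorem exists_floor_add_floor_eq {c : ℝ} (hc1 : 1 < c) (hc2 : c < 16 / 15) {n h p : ℕ}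
    (hn : 1 ≤ n) (hu : (p : ℝ) ^ c ≤ (n + 1) / 2) (hh : 32 * (n + 1 : ℝ) ^ (1 - 1 / c) ≤ h)
    (hx : |(p : ℝ) ^ c - 1 / 2 - round ((p : ℝ) ^ c - 1 / 2)| < 3 / 8)
    (hy : |(n + 1 - (p : ℝ) ^ c) ^ (1 / c) - round ((n + 1 - (p : ℝ) ^ c) ^ (1 / c))| < 1 / h) :
    ∃ m : ℕ, 0 < m ∧ ⌊(m : ℝ) ^ c⌋ + ⌊(p : ℝ) ^ c⌋ = (n : ℤ) := by
  have hn1 : (1 : ℝ) ≤ n := by exact_mod_cast hn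
  set N : ℝ := n + 1 with hN
  set u : ℝ := (p : ℝ) ^ c with hudef
  have hu0 : 0 ≤ u := by positivity
  set y : ℝ := (N - u) ^ (1 / c) with hydef
  have hc0 : 0 < c := by linarith
  have hγ : 0 < 1 / c := by positivity
  have hγ1 : 1 / c ≤ 1 := by rw [div_le_one hc0]; linarith
  set R : ℝ := N ^ (1 - 1 / c) with hR
  have hR1 : 1 ≤ R := Real.one_le_rpow (by linarith) (by linarith)
  have hh0 : (0 : ℝ) < h := by linarith
  have hy1 : 1 ≤ y := Real.one_le_rpow (by linarith) hγ.le
  have hyN : y ≤ N ^ (1 / c) := Real.rpow_le_rpow (by linarith) (by linarith) hγ.le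
  have hyc : y ^ c = N - u := by
    rw [hydef, ← Real.rpow_mul (by linarith), one_div_mul_cancel hc0.ne', Real.rpow_one]
  have hinv : 1 / (h : ℝ) ≤ 1 / (32 * R) := one_div_le_one_div_of_le (by positivity) hh
  have hinv' : 1 / (32 * R) ≤ 1 / 32 := one_div_le_one_div_of_le (by norm_num) (by linarith)
  have hy' := abs_lt.1 hy
  have hround : 0 < round y := by
    have : (0 : ℝ) < round y := by linarith
    exact_mod_cast this
  obtain ⟨m, hm⟩ := Int.eq_ofNat_of_zero_le hround.le
  have hmr : (round y : ℝ) = m := by rw [hm]; simp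
  rw [hmr] at hy hy'
  refine ⟨m, by omega, ?_⟩
  have hN1 : 1 ≤ N ^ (1 / c) := Real.one_le_rpow (by linarith) hγ.le
  have hdiff : |(m : ℝ) ^ c - y ^ c| < 1 / 8 := by
    have h1 := abs_rpow_sub_rpow_le hc1.le (Nat.cast_nonneg m) (by linarith : 0 ≤ y)
      (by linarith : (m : ℝ) ≤ 2 * N ^ (1 / c)) (by linarith)
    have h2 : (2 * N ^ (1 / c)) ^ (c - 1) ≤ 2 * R := by
      rw [Real.mul_rpow (by norm_num) (by positivity), ← Real.rpow_mul (by linarith), hR,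
        show 1 / c * (c - 1) = 1 - 1 / c by field_simp]
      have : (2 : ℝ) ^ (c - 1) ≤ 2 ^ (1 : ℝ) :=
        Real.rpow_le_rpow_of_exponent_le (by norm_num) (by linarith)
      rw [Real.rpow_one] at this
      gcongr
    calc _ ≤ c * (2 * N ^ (1 / c)) ^ (c - 1) * |(m : ℝ) - y| := h1
      _ ≤ 16 / 15 * (2 * R) * (1 / (32 * R)) := by
        have : |(m : ℝ) - y| ≤ 1 / (32 * R) := by rw [abs_sub_comm]; linarith
        gcongr
      _ = 1 / 15 := by field_simp; norm_num
      _ < 1 / 8 := by norm_num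
  rw [hyc] at hdiff
  have hd := abs_lt.1 hdiff
  have hx' := abs_lt.1 hx
  set k := round (u - 1 / 2) with hk
  have hfu : ⌊u⌋ = k := by rw [Int.floor_eq_iff]; constructor <;> linarith
  have hfm : ⌊(m : ℝ) ^ c⌋ = n - k := by
    rw [Int.floor_eq_iff]; push_cast; constructor <;> linarith
  rw [hfu, hfm]
  ring

section Phase

variable {c N j k t : ℝ}

/-- The phase detecting solutions of `m ^ c ≈ N - t ^ c` with `t ^ c` close to a half-integer. -/
noncomputable def powerPhase (c N j k t : ℝ) : ℝ :=
  j * (t ^ c - 1 / 2) + k * (N - t ^ c) ^ (1 / c)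

/-- The derivative of `powerPhase`. -/
noncomputable def powerPhaseDeriv (c N j k t : ℝ) : ℝ :=
  t ^ (c - 1) * (c * j - k * (N - t ^ c) ^ (1 / c - 1))

/-- The second derivative of `powerPhase`. -/
noncomputable def powerPhaseDeriv₂ (c N j k t : ℝ) : ℝ :=
  (c - 1) * t ^ (c - 2) * (c * j - k * (N * (N - t ^ c) ^ (1 / c - 2)))

/-- The derivative of `t ^ 2 * powerPhaseDeriv₂ c N j k t`. -/
noncomputable def powerPhaseDeriv₃ (c N j k t : ℝ) : ℝ :=
  c * (c - 1) * t ^ (c - 1) *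
    (c * j - k * (N * (N - t ^ c) ^ (1 / c - 3) * (N + (1 - 1 / c) * t ^ c)))

theorem hasDerivAt_sub_rpow_rpow (ht : 0 < t) (hN : t ^ c < N) (a : ℝ) :
    HasDerivAt (fun s : ℝ => (N - s ^ c) ^ a)
      (-(c * t ^ (c - 1)) * a * (N - t ^ c) ^ (a - 1)) t :=
  ((Real.hasDerivAt_rpow_const (Or.inl ht.ne')).const_sub N).rpow_const
    (Or.inl (sub_pos.2 hN).ne')

theorem hasDerivAt_powerPhase (hc : 0 < c) (ht : 0 < t) (hN : t ^ c < N) :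
    HasDerivAt (powerPhase c N j k) (powerPhaseDeriv c N j k t) t := by
  have h := (((Real.hasDerivAt_rpow_const (p := c) (Or.inl ht.ne')).sub_const (1 / 2)).const_mul
    j).add ((hasDerivAt_sub_rpow_rpow ht hN (1 / c)).const_mul k)
  refine h.congr_deriv ?_
  rw [powerPhaseDeriv]
  field_simp
  ring

theorem hasDerivAt_powerPhaseDeriv (hc : 0 < c) (ht : 0 < t) (hN : t ^ c < N) :
    HasDerivAt (powerPhaseDeriv c N j k) (powerPhaseDeriv₂ c N j k t) t := by
  have h := (Real.hasDerivAt_rpow_const (p := c - 1) (Or.inl ht.ne')).mul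
    (((hasDerivAt_sub_rpow_rpow ht hN (1 / c - 1)).const_mul k).const_sub (c * j))
  refine h.congr_deriv ?_
  have hV : 0 < N - t ^ c := sub_pos.2 hN
  have e1 : (N - t ^ c) ^ (1 / c - 1) = (N - t ^ c) ^ (1 / c - 2) * (N - t ^ c) := by
    rw [← Real.rpow_add_one hV.ne']; congr 1; ring
  have e2 : t ^ (c - 1) = t ^ (c - 2) * t := by
    rw [← Real.rpow_add_one ht.ne']; congr 1; ring
  have e3 : t ^ c = t ^ (c - 2) * t * t := by
    rw [← Real.rpow_add_one ht.ne', ← Real.rpow_add_one ht.ne']; congr 1; ring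
  have e4 : c - 1 - 1 = c - 2 := by ring
  have e5 : 1 / c - 1 - 1 = 1 / c - 2 := by ring
  rw [powerPhaseDeriv₂, e4, e5, e1, e2]
  generalize (N - t ^ c) ^ (1 / c - 2) = G
  rw [e3]
  generalize t ^ (c - 2) = X
  field_simp
  ring

theorem sq_mul_powerPhaseDeriv₂ (ht : 0 < t) :
    t ^ 2 * powerPhaseDeriv₂ c N j k t =
      (c - 1) * t ^ c * (c * j - k * (N * (N - t ^ c) ^ (1 / c - 2))) := by
  have e3 : t ^ c = t ^ (c - 2) * t * t := by
    rw [← Real.rpow_add_one ht.ne', ← Real.rpow_add_one ht.ne']; congr 1; ring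
  rw [powerPhaseDeriv₂]
  generalize (N - t ^ c) ^ (1 / c - 2) = G
  rw [e3]
  ring

theorem mul_powerPhaseDeriv₃ (ht : 0 < t) :
    t * powerPhaseDeriv₃ c N j k t = c * (c - 1) * t ^ c *
      (c * j - k * (N * (N - t ^ c) ^ (1 / c - 3) * (N + (1 - 1 / c) * t ^ c))) := by
  have e3 : t ^ c = t ^ (c - 1) * t := by
    rw [← Real.rpow_add_one ht.ne']; congr 1; ring
  rw [powerPhaseDeriv₃]
  generalize (N - t ^ c) ^ (1 / c - 3) = G
  rw [e3]
  ring

theorem hasDerivAt_sq_mul_powerPhaseDeriv₂ (hc : 0 < c) (ht : 0 < t) (hN : t ^ c < N) :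
    HasDerivAt (fun t => t ^ 2 * powerPhaseDeriv₂ c N j k t) (powerPhaseDeriv₃ c N j k t) t := by
  have h := ((Real.hasDerivAt_rpow_const (p := c) (Or.inl ht.ne')).const_mul (c - 1)).mul
    ((((hasDerivAt_sub_rpow_rpow ht hN (1 / c - 2)).const_mul N).const_mul k).const_sub (c * j))
  have h' := h.congr_of_eventuallyEq (f₁ := fun t => t ^ 2 * powerPhaseDeriv₂ c N j k t)
    (by
      filter_upwards [lt_mem_nhds ht] with s hs
      exact sq_mul_powerPhaseDeriv₂ hs)
  refine h'.congr_deriv ?_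
  have hV : 0 < N - t ^ c := sub_pos.2 hN
  have e1 : (N - t ^ c) ^ (1 / c - 2) = (N - t ^ c) ^ (1 / c - 3) * (N - t ^ c) := by
    rw [← Real.rpow_add_one hV.ne']; congr 1; ring
  have e5 : 1 / c - 2 - 1 = 1 / c - 3 := by ring
  rw [powerPhaseDeriv₃, e5, e1]
  generalize (N - t ^ c) ^ (1 / c - 3) = G
  field_simp
  ring

theorem one_add_le_one_sub_rpow {v : ℝ} (hv : 0 ≤ v) (hv' : v ≤ 1 / 8) {a : ℝ} (ha : a ≤ -1) :
    1 + v ≤ (1 - v) ^ a := by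
  have h0 : 0 < 1 - v := by linarith
  calc 1 + v ≤ (1 - v) ^ (-1 : ℝ) := by
        rw [Real.rpow_neg_one, ← one_div, le_div_iff₀ h0]; nlinarith
    _ ≤ _ := Real.rpow_le_rpow_of_exponent_ge h0 (by linarith) ha

theorem mul_sub_rpow_mem {v : ℝ} (hc : 1 < c) (hc2 : c < 2) (hN : 0 < N) (hv : 0 ≤ v)
    (hv' : v ≤ 1 / 8) :
    N * (N - N * v) ^ (1 / c - 2) ∈ Set.Icc (N ^ (1 / c - 1) * (1 + v))
      (N ^ (1 / c - 1) * (1 + 8 * v)) := by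
  have hγ1 : 1 / c ≤ 1 := by rw [div_le_one (by linarith)]; linarith
  have hγ0 : 0 < 1 / c := by positivity
  have h0 : 0 < 1 - v := by linarith
  have e : N * (N - N * v) ^ (1 / c - 2) = N ^ (1 / c - 1) * (1 - v) ^ (1 / c - 2) := by
    rw [show N - N * v = N * (1 - v) by ring, Real.mul_rpow hN.le h0.le,
      show 1 / c - 1 = 1 / c - 2 + 1 by ring, Real.rpow_add_one hN.ne']
    ring
  rw [e]
  constructor
  · gcongr
    exact one_add_le_one_sub_rpow hv hv' (by linarith)
  · gcongr
    calc (1 - v) ^ (1 / c - 2) ≤ (1 - v) ^ (-2 : ℝ) :=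
          Real.rpow_le_rpow_of_exponent_ge h0 (by linarith) (by linarith)
      _ ≤ _ := by
          rw [Real.rpow_neg h0.le, Real.rpow_two, ← one_div, div_le_iff₀ (by positivity)]
          nlinarith [mul_nonneg hv (sq_nonneg v), mul_nonneg hv hv]

theorem mul_sub_rpow_mul_mem {v : ℝ} (hc : 1 < c) (hc2 : c < 2) (hN : 0 < N) (hv : 0 ≤ v)
    (hv' : v ≤ 1 / 8) :
    N * (N - N * v) ^ (1 / c - 3) * (N + (1 - 1 / c) * (N * v)) ∈
      Set.Icc (N ^ (1 / c - 1) * (1 + v)) (N ^ (1 / c - 1) * (1 + 8 * v)) := by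
  have hγ1 : 1 / c ≤ 1 := by rw [div_le_one (by linarith)]; linarith
  have hγ0 : 0 < 1 / c := by positivity
  have h0 : 0 < 1 - v := by linarith
  have e : N * (N - N * v) ^ (1 / c - 3) * (N + (1 - 1 / c) * (N * v)) =
      N ^ (1 / c - 1) * ((1 - v) ^ (1 / c - 3) * (1 + (1 - 1 / c) * v)) := by
    rw [show N - N * v = N * (1 - v) by ring, Real.mul_rpow hN.le h0.le,
      show 1 / c - 1 = 1 / c - 3 + 1 + 1 by ring, Real.rpow_add_one hN.ne',
      Real.rpow_add_one hN.ne']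
    ring
  have hv1 : 0 ≤ (1 - 1 / c) * v := mul_nonneg (by linarith) hv
  have hv2 : (1 - 1 / c) * v ≤ v := mul_le_of_le_one_left hv (by linarith)
  rw [e]
  constructor
  · gcongr
    exact (one_add_le_one_sub_rpow hv hv' (by linarith)).trans
      (le_mul_of_one_le_right (by positivity) (by linarith))
  · gcongr
    calc (1 - v) ^ (1 / c - 3) * (1 + (1 - 1 / c) * v) ≤ (1 - v) ^ (-3 : ℝ) * (1 + v) := by
          have := Real.rpow_le_rpow_of_exponent_ge h0 (by linarith) (by linarith :
            (-3 : ℝ) ≤ 1 / c - 3)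
          gcongr
      _ ≤ _ := by
          rw [Real.rpow_neg h0.le, show (3 : ℝ) = (3 : ℕ) by norm_num, Real.rpow_natCast,
            ← div_eq_inv_mul, div_le_iff₀ (by positivity)]
          have h3 : 1 - 3 * v ≤ (1 - v) ^ 3 := by nlinarith [mul_nonneg hv (sq_nonneg v)]
          have h4 : (1 + 8 * v) * (1 - 3 * v) ≤ (1 + 8 * v) * (1 - v) ^ 3 := by gcongr
          nlinarith

/-- The linear form `a - σ * D` has constant sign and size for `D - 1` in a range of values
comparable with `v`. -/
theorem exists_bracket_of_nonneg {a σ v η ℓ : ℝ} (hσ : 0 ≤ σ) (hv : 0 < v) (hv' : v ≤ 1 / 1000)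
    (hη : 0 < η) (hℓη : ℓ ≤ η) (hℓv : ℓ ≤ v / 4) (hσM : σ ≤ 140) (haM : |a| ≤ 3)
    (ha : a = 0 ∧ η ≤ σ ∨ 1 ≤ |a|)
    (hgood : a * σ ≤ σ * σ * (1 + v / 2) ∨ σ * σ * (1 + 80 * v) ≤ a * σ) :
    ∃ s b : ℝ, (s = 1 ∨ s = -1) ∧ ℓ ≤ b ∧ 0 < b ∧ b ≤ 300 ∧
      ∀ D ∈ Set.Icc (1 + v) (1 + 40 * v), b ≤ s * (a - σ * D) ∧ s * (a - σ * D) ≤ 80 * b := by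
  have haM' := abs_le.1 haM
  have hσv : 0 ≤ σ * v := mul_nonneg hσ hv.le
  have hσv' : σ * v ≤ σ * (1 / 1000) := mul_le_mul_of_nonneg_left hv' hσ
  have low : a ≤ σ * (1 + v / 2) → ℓ ≤ σ * (1 + v) - a → 0 < σ * (1 + v) - a →
      ∃ s b : ℝ, (s = 1 ∨ s = -1) ∧ ℓ ≤ b ∧ 0 < b ∧ b ≤ 300 ∧
        ∀ D ∈ Set.Icc (1 + v) (1 + 40 * v),
          b ≤ s * (a - σ * D) ∧ s * (a - σ * D) ≤ 80 * b := by
    intro h1 h2 h3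
    refine ⟨-1, σ * (1 + v) - a, Or.inr rfl, h2, h3, by linarith, fun D hD => ?_⟩
    have d1 := mul_le_mul_of_nonneg_left hD.1 hσ
    have d2 := mul_le_mul_of_nonneg_left hD.2 hσ
    constructor <;> linarith
  have high : σ * (1 + 80 * v) ≤ a → 1 ≤ a →
      ∃ s b : ℝ, (s = 1 ∨ s = -1) ∧ ℓ ≤ b ∧ 0 < b ∧ b ≤ 300 ∧
        ∀ D ∈ Set.Icc (1 + v) (1 + 40 * v),
          b ≤ s * (a - σ * D) ∧ s * (a - σ * D) ≤ 80 * b := by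
    intro h1 h2
    have h3 : v / 4 ≤ a - σ * (1 + 40 * v) := by
      rcases le_total σ (1 / 2) with h | h
      · linarith
      · have := mul_le_mul_of_nonneg_right h hv.le
        linarith
    refine ⟨1, a - σ * (1 + 40 * v), Or.inl rfl, by linarith, by linarith, by linarith,
      fun D hD => ?_⟩
    have d1 := mul_le_mul_of_nonneg_left hD.1 hσ
    have d2 := mul_le_mul_of_nonneg_left hD.2 hσ
    constructor <;> linarith
  rcases ha with ⟨rfl, ha⟩ | ha
  · exact low (by positivity) (by linarith) (by linarith)
  rcases le_abs.1 ha with h | h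
  · rcases hσ.eq_or_lt with rfl | hσ0
    · exact high (by linarith) h
    rcases hgood with hg | hg
    · have hg' : a ≤ σ * (1 + v / 2) := le_of_mul_le_mul_right (by linarith) hσ0
      have h3 : v / 4 ≤ σ * (1 + v) - a := by
        have h4 : 1 / 2 ≤ σ := by linarith
        have := mul_le_mul_of_nonneg_right h4 hv.le
        linarith
      exact low hg' (by linarith) (by linarith)
    · exact high (le_of_mul_le_mul_right (by linarith) hσ0) h
  · exact low (by linarith) (by linarith) (by linarith)

theorem exists_bracket {a σ v η ℓ : ℝ} (hv : 0 < v) (hv' : v ≤ 1 / 1000)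
    (hη : 0 < η) (hℓη : ℓ ≤ η) (hℓv : ℓ ≤ v / 4) (hσM : |σ| ≤ 140) (haM : |a| ≤ 3)
    (ha : a = 0 ∧ η ≤ |σ| ∨ 1 ≤ |a|)
    (hgood : a * σ ≤ σ * σ * (1 + v / 2) ∨ σ * σ * (1 + 80 * v) ≤ a * σ) :
    ∃ s b : ℝ, (s = 1 ∨ s = -1) ∧ ℓ ≤ b ∧ 0 < b ∧ b ≤ 300 ∧
      ∀ D ∈ Set.Icc (1 + v) (1 + 40 * v), b ≤ s * (a - σ * D) ∧ s * (a - σ * D) ≤ 80 * b := by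
  rcases le_total 0 σ with h | h
  · rw [abs_of_nonneg h] at hσM ha
    exact exists_bracket_of_nonneg h hv hv' hη hℓη hℓv hσM haM ha hgood
  · rw [abs_of_nonpos h] at hσM ha
    obtain ⟨s, b, hs, h1, h2, h3, h4⟩ := exists_bracket_of_nonneg (a := -a) (σ := -σ)
      (by linarith) hv hv' hη hℓη hℓv hσM (by rwa [abs_neg]) (by rwa [abs_neg, neg_eq_zero])
      (by rwa [neg_mul_neg, neg_mul_neg])
    refine ⟨-s, b, by rcases hs with rfl | rfl <;> simp, h1, h2, h3, fun D hD => ?_⟩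
    have := h4 D hD
    rwa [show -s * (a - σ * D) = s * (-a - -σ * D) by ring]

/-- Bounds for the phase on `[P, 4 * P]` away from the resonances of `j` and `k`. -/
theorem exists_phaseBounds {P : ℕ} {v η ℓ : ℝ} (hc : 1 < c) (hc2 : c < 16 / 15) (hP : 0 < P)
    (hN : 1 ≤ N) (hηdef : η = N ^ (1 / c - 1)) (hvdef : (P : ℝ) ^ c = N * v)
    (hv' : v ≤ 1 / 1000) (hℓ : 0 < ℓ) (hℓη : ℓ ≤ η) (hℓv : ℓ ≤ v / 4) (hj : |j| ≤ 2)
    (hkη : |k| * η ≤ 140) (hjk : j = 0 ∧ 1 ≤ |k| ∨ 1 ≤ |j|)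
    (hgood : c * j * (k * η) ≤ k * η * (k * η) * (1 + v / 2) ∨
      k * η * (k * η) * (1 + 80 * v) ≤ c * j * (k * η)) :
    ∃ F₁ F₂ s₁ s₂ : ℝ, ∃ φ₁ φ₂ χ₁ : ℝ → ℝ,
      PhaseBounds P 400 F₁ F₂ s₁ s₂ (powerPhase c N j k) φ₁ φ₂ χ₁ ∧
      (c - 1) * (P : ℝ) ^ c * ℓ ≤ F₁ ∧ F₁ ≤ 400 * (P : ℝ) ^ c ∧
      (c - 1) * (P : ℝ) ^ c * ℓ ≤ F₂ ∧ F₂ ≤ 400 * (P : ℝ) ^ c := by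
  have hP0 : (0 : ℝ) < P := by exact_mod_cast hP
  have hN0 : 0 < N := by linarith
  have hη : 0 < η := by rw [hηdef]; positivity
  have hX : 0 < (P : ℝ) ^ c := by positivity
  have hv : 0 < v := by
    rw [hvdef] at hX
    exact (pos_iff_pos_of_mul_pos hX).1 hN0
  obtain ⟨s, b, hs, hb1, hb0, hb2, hb⟩ := exists_bracket (a := c * j) (σ := k * η) hv hv' hη hℓη
    hℓv (by rwa [abs_mul, abs_of_pos hη])
    (by rw [abs_mul, abs_of_pos (by linarith : 0 < c)]; nlinarith [abs_nonneg j])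
    (by
      rw [abs_mul, abs_mul, abs_of_pos hη, abs_of_pos (by linarith : 0 < c)]
      rcases hjk with ⟨rfl, h⟩ | h
      · exact Or.inl ⟨mul_zero _, le_mul_of_one_le_left hη.le h⟩
      · exact Or.inr (one_le_mul_of_one_le_of_one_le hc.le h)) hgood
  have h4c : (4 : ℝ) ^ c ≤ 5 := by
    calc (4 : ℝ) ^ c ≤ 4 ^ (16 / 15 : ℝ) :=
          Real.rpow_le_rpow_of_exponent_le (by norm_num) hc2.le
      _ ≤ 5 := by
          rw [div_eq_mul_inv, Real.rpow_mul (by norm_num),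
            Real.rpow_inv_le_iff_of_pos (by positivity) (by norm_num) (by norm_num)]
          norm_num
  have ht0 : ∀ t ∈ Set.Icc (P : ℝ) (4 * P), 0 < t := fun t ht => hP0.trans_le ht.1
  have htX : ∀ t ∈ Set.Icc (P : ℝ) (4 * P), (P : ℝ) ^ c ≤ t ^ c ∧ t ^ c ≤ 5 * (P : ℝ) ^ c := by
    intro t ht
    have := ht0 t ht
    refine ⟨Real.rpow_le_rpow hP0.le ht.1 (by linarith), ?_⟩
    calc t ^ c ≤ (4 * P) ^ c := Real.rpow_le_rpow this.le ht.2 (by linarith)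
      _ = 4 ^ c * (P : ℝ) ^ c := Real.mul_rpow (by norm_num) hP0.le
      _ ≤ _ := by gcongr
  have htv : ∀ t ∈ Set.Icc (P : ℝ) (4 * P), ∃ w, t ^ c = N * w ∧ v ≤ w ∧ w ≤ 5 * v := by
    intro t ht
    obtain ⟨h1, h2⟩ := htX t ht
    rw [hvdef] at h1 h2
    refine ⟨t ^ c / N, by field_simp, ?_, ?_⟩
    · rw [le_div_iff₀ hN0]; linarith
    · rw [div_le_iff₀ hN0]; linarith
  have htN : ∀ t ∈ Set.Icc (P : ℝ) (4 * P), t ^ c < N := by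
    intro t ht
    obtain ⟨w, hw, h1, h2⟩ := htv t ht
    rw [hw]
    exact mul_lt_of_lt_one_right hN0 (by linarith)
  have bracket : ∀ w G : ℝ, v ≤ w → w ≤ 5 * v →
      G ∈ Set.Icc (N ^ (1 / c - 1) * (1 + w)) (N ^ (1 / c - 1) * (1 + 8 * w)) →
      b ≤ s * (c * j - k * G) ∧ s * (c * j - k * G) ≤ 80 * b := by
    intro w G h1 h2 hG
    rw [← hηdef] at hG
    have := hb (G / η) ⟨by rw [le_div_iff₀ hη]; nlinarith [hG.1], by
      rw [div_le_iff₀ hη]; nlinarith [hG.2]⟩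
    rwa [show k * η * (G / η) = k * G by field_simp] at this
  have hB1 : ∀ t ∈ Set.Icc (P : ℝ) (4 * P),
      b ≤ s * (c * j - k * (N * (N - t ^ c) ^ (1 / c - 2))) ∧
      s * (c * j - k * (N * (N - t ^ c) ^ (1 / c - 2))) ≤ 80 * b := by
    intro t ht
    obtain ⟨w, hw, h1, h2⟩ := htv t ht
    rw [hw]
    exact bracket w _ h1 h2 (mul_sub_rpow_mem hc (by linarith) hN0 (by linarith) (by linarith))
  have hB2 : ∀ t ∈ Set.Icc (P : ℝ) (4 * P),
      b ≤ s * (c * j - k * (N * (N - t ^ c) ^ (1 / c - 3) * (N + (1 - 1 / c) * t ^ c))) ∧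
      s * (c * j - k * (N * (N - t ^ c) ^ (1 / c - 3) * (N + (1 - 1 / c) * t ^ c))) ≤ 80 * b := by
    intro t ht
    obtain ⟨w, hw, h1, h2⟩ := htv t ht
    rw [hw]
    exact bracket w _ h1 h2 (mul_sub_rpow_mul_mem hc (by linarith) hN0 (by linarith) (by linarith))
  have hc0 : 0 < c := by linarith
  have hc10 : 0 < c - 1 := by linarith
  have scale : ∀ {K B T : ℝ}, 0 < K → (P : ℝ) ^ c ≤ T → T ≤ 5 * (P : ℝ) ^ c →
      b ≤ s * B ∧ s * B ≤ 80 * b →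
      K * (P : ℝ) ^ c * b ≤ s * (K * T * B) ∧
      s * (K * T * B) ≤ 400 * (K * (P : ℝ) ^ c * b) := by
    intro K B T hK h1 h2 h3
    rw [show s * (K * T * B) = K * T * (s * B) by ring]
    have hT : 0 < T := hX.trans_le h1
    constructor
    · have := h3.1
      gcongr
    · calc K * T * (s * B) ≤ K * (5 * (P : ℝ) ^ c) * (80 * b) := by
            have := h3.2
            have := hb0.trans_le h3.1
            gcongr
        _ = _ := by ring
  refine ⟨(c - 1) * (P : ℝ) ^ c * b, c * (c - 1) * (P : ℝ) ^ c * b, s, s, powerPhaseDeriv c N j k,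
    powerPhaseDeriv₂ c N j k, powerPhaseDeriv₃ c N j k, ?_, ?_, ?_, ?_, ?_⟩
  · exact
    { one_le := by norm_num
      sign₁ := hs
      sign₂ := hs
      pos₁ := by positivity
      pos₂ := by positivity
      deriv₁ := fun t ht => hasDerivAt_powerPhase hc0 (ht0 t ht) (htN t ht)
      deriv₂ := fun t ht => hasDerivAt_powerPhaseDeriv hc0 (ht0 t ht) (htN t ht)
      deriv₃ := fun t ht => hasDerivAt_sq_mul_powerPhaseDeriv₂ hc0 (ht0 t ht) (htN t ht)
      lower₁ := fun t ht => by
        rw [sq_mul_powerPhaseDeriv₂ (ht0 t ht)]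
        exact (scale hc10 (htX t ht).1 (htX t ht).2 (hB1 t ht)).1
      upper₁ := fun t ht => by
        rw [sq_mul_powerPhaseDeriv₂ (ht0 t ht)]
        exact (scale hc10 (htX t ht).1 (htX t ht).2 (hB1 t ht)).2
      lower₂ := fun t ht => by
        rw [mul_powerPhaseDeriv₃ (ht0 t ht)]
        exact (scale (mul_pos hc0 hc10) (htX t ht).1 (htX t ht).2 (hB2 t ht)).1
      upper₂ := fun t ht => by
        rw [mul_powerPhaseDeriv₃ (ht0 t ht)]
        exact (scale (mul_pos hc0 hc10) (htX t ht).1 (htX t ht).2 (hB2 t ht)).2 }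
  · gcongr
  · calc (c - 1) * (P : ℝ) ^ c * b ≤ 1 * (P : ℝ) ^ c * 300 := by gcongr; linarith
      _ ≤ _ := by linarith
  · calc (c - 1) * (P : ℝ) ^ c * ℓ ≤ (c - 1) * (P : ℝ) ^ c * b := by gcongr
      _ ≤ c * ((c - 1) * (P : ℝ) ^ c * b) := le_mul_of_one_le_left (by positivity) hc.le
      _ = _ := by ring
  · calc c * (c - 1) * (P : ℝ) ^ c * b ≤ 1 * (P : ℝ) ^ c * 300 := by gcongr; nlinarith
      _ ≤ _ := by linarith

end Phase

theorem exists_pos_resonance {c η v : ℝ} (hc : 1 < c) (hη : 0 < η) (hv : 0 < v) {j k : ℤ}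
    (hj : |j| ≤ 2)
    (hbad : ¬ (c * j * (k * η) ≤ k * η * (k * η) * (1 + v / 2) ∨
      k * η * (k * η) * (1 + 80 * v) ≤ c * j * (k * η))) :
    ∃ j' k' : ℤ, (j' = 1 ∨ j' = 2) ∧ 0 < k' ∧ k' * η * (1 + v / 2) < c * j' ∧
      c * j' < k' * η * (1 + 80 * v) := by
  push Not at hbad
  obtain ⟨h1, h2⟩ := hbad
  have hj' := abs_le.1 hj
  have aux : ∀ j k : ℤ, j ≤ 2 → 0 < k → k * η * (k * η) * (1 + v / 2) < c * j * (k * η) →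
      c * j * (k * η) < k * η * (k * η) * (1 + 80 * v) →
      ∃ j' k' : ℤ, (j' = 1 ∨ j' = 2) ∧ 0 < k' ∧ k' * η * (1 + v / 2) < c * j' ∧
        c * j' < k' * η * (1 + 80 * v) := by
    intro j k hj hk h1 h2
    have hkr : (0 : ℝ) < k := by exact_mod_cast hk
    have hkη : 0 < k * η := by positivity
    have h1' : k * η * (1 + v / 2) < c * j := lt_of_mul_lt_mul_right (by linarith) hkη.le
    have h2' : c * j < k * η * (1 + 80 * v) := lt_of_mul_lt_mul_right (by linarith) hkη.le
    have hj0 : 0 < j := by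
      have : 0 < c * (j : ℝ) := lt_trans (by positivity) h1'
      have := (pos_iff_pos_of_mul_pos this).1 (by linarith)
      exact_mod_cast this
    exact ⟨j, k, by omega, hk, h1', h2'⟩
  rcases lt_trichotomy k 0 with hk | rfl | hk
  · refine aux (-j) (-k) (by omega) (by omega) ?_ ?_ <;> push_cast <;> linarith
  · simp at h1
  · exact aux j k hj'.2 hk h1 h2

/-- Among three well separated scales at least one avoids all resonances. -/
theorem exists_nonresonant_scale {c η : ℝ} (hc : 1 < c) (hc2 : c < 16 / 15) (hη : 0 < η)
    {v : ℕ → ℝ} (hv : ∀ i, 0 < v i) (hvs : ∀ i, 160 * v i ≤ v (i + 1)) (hvη : v 2 ≤ η / 1000) :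
    ∃ i ≤ 2, ∀ j k : ℤ, |j| ≤ 2 →
      (c * j * (k * η) ≤ k * η * (k * η) * (1 + v i / 2) ∨
        k * η * (k * η) * (1 + 80 * v i) ≤ c * j * (k * η)) := by
  have hv0 := hv 0
  have hv1 := hv 1
  have hs0 := hvs 0
  have hs1 := hvs 1
  rw [zero_add] at hs0
  norm_num at hs1
  have unique : ∀ {a b : ℝ} {j k k' : ℤ}, 0 < a → a ≤ η / 1000 → 160 * a ≤ b →
      b ≤ η / 1000 → (j = 1 ∨ j = 2) → 0 < k → 0 < k' →
      k * η * (1 + a / 2) < c * j → c * j < k * η * (1 + 80 * a) →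
      k' * η * (1 + b / 2) < c * j → c * j < k' * η * (1 + 80 * b) → False := by
    intro a b j k k' ha haη hab hbη hj hk hk' h1 h2 h3 h4
    have hcj : c * j ≤ 32 / 15 := by rcases hj with rfl | rfl <;> push_cast <;> linarith
    have hkr : (0 : ℝ) < k := by exact_mod_cast hk
    have hkr' : (0 : ℝ) < k' := by exact_mod_cast hk'
    have near : ∀ {l d : ℝ}, 0 < l → 0 < d → d ≤ η / 1000 → l * η * (1 + d / 2) < c * j →
        c * j < l * η * (1 + 80 * d) → l * η < c * j ∧ c * j < (l + 1) * η := by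
      intro l d hl hd hdη e1 e2
      have hld : 0 < l * η * d := by positivity
      have e3 : l * η < c * j := by linarith
      have e4 : l * η * d ≤ (32 / 15) * (η / 1000) :=
        mul_le_mul (by linarith) hdη hd.le (by norm_num)
      exact ⟨e3, by linarith⟩
    obtain ⟨a1, a2⟩ := near hkr ha haη h1 h2
    obtain ⟨b1, b2⟩ := near hkr' (by linarith) hbη h3 h4
    have c1 : (k : ℝ) < k' + 1 := lt_of_mul_lt_mul_right (a1.trans b2) hη.le
    have c2 : (k' : ℝ) < k + 1 := lt_of_mul_lt_mul_right (b1.trans a2) hη.le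
    have c3 : k < k' + 1 := by exact_mod_cast c1
    have c4 : k' < k + 1 := by exact_mod_cast c2
    obtain rfl : k = k' := by omega
    have : k * η * (160 * a) ≤ k * η * b := by gcongr
    linarith
  by_contra hcon
  push Not at hcon
  have get : ∀ i ≤ 2, ∃ j' k' : ℤ, (j' = 1 ∨ j' = 2) ∧ 0 < k' ∧
      k' * η * (1 + v i / 2) < c * j' ∧ c * j' < k' * η * (1 + 80 * v i) := by
    intro i hi
    obtain ⟨j, k, hj, h1, h2⟩ := hcon i hi
    exact exists_pos_resonance hc hη (hv i) hj (by push Not; exact ⟨h1, h2⟩)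
  obtain ⟨j₀, k₀, hj₀, hk₀, p₀, q₀⟩ := get 0 (by norm_num)
  obtain ⟨j₁, k₁, hj₁, hk₁, p₁, q₁⟩ := get 1 (by norm_num)
  obtain ⟨j₂, k₂, hj₂, hk₂, p₂, q₂⟩ := get 2 (by norm_num)
  have : j₀ = j₁ ∨ j₀ = j₂ ∨ j₁ = j₂ := by omega
  rcases this with rfl | rfl | rfl
  · exact unique hv0 (by linarith) hs0 (by linarith) hj₀ hk₀ hk₁ p₀ q₀ p₁ q₁
  · exact unique hv0 (by linarith) (by linarith) hvη hj₀ hk₀ hk₂ p₀ q₀ p₂ q₂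
  · exact unique hv1 (by linarith) hs1 hvη hj₁ hk₁ hk₂ p₁ q₁ p₂ q₂

theorem rpow_le_of_le_mul {c κ η x : ℝ} (hc : 1 < c) (hc2 : c < 16 / 15) (hx1 : 1 ≤ x)
    (hκ : 0 < κ) (hb : 4 / ((c - 1) * κ ^ 3) ≤ x ^ (0.005 : ℝ))
    (hη : κ ≤ η * x ^ (c ^ 2 - c)) :
    x ^ (0.99 : ℝ) ≤ (c - 1) * x ^ c * (κ ^ 2 * η / 4) := by
  have hx0 : 0 < x := by linarith
  have hc10 : 0 < c - 1 := by linarith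
  have hη0 : 0 < η := pos_of_mul_pos_left (hκ.trans_le hη) (by positivity)
  have e2 : x ^ (0.005 : ℝ) * x ^ (0.99 : ℝ) * x ^ (c ^ 2 - c) ≤ x ^ c := by
    rw [← Real.rpow_add hx0, ← Real.rpow_add hx0]
    exact Real.rpow_le_rpow_of_exponent_le hx1 (by norm_num; nlinarith)
  have e3 : 4 ≤ x ^ (0.005 : ℝ) * ((c - 1) * κ ^ 3) := by
    rwa [div_le_iff₀ (by positivity)] at hb
  have e4 : κ * (x ^ (0.005 : ℝ) * x ^ (0.99 : ℝ)) ≤ η * x ^ c := by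
    calc κ * (x ^ (0.005 : ℝ) * x ^ (0.99 : ℝ))
        ≤ η * x ^ (c ^ 2 - c) * (x ^ (0.005 : ℝ) * x ^ (0.99 : ℝ)) :=
          mul_le_mul_of_nonneg_right hη (by positivity)
      _ = η * (x ^ (0.005 : ℝ) * x ^ (0.99 : ℝ) * x ^ (c ^ 2 - c)) := by ring
      _ ≤ _ := mul_le_mul_of_nonneg_left e2 hη0.le
  have e5 := mul_le_mul_of_nonneg_right e3 (by positivity : 0 ≤ x ^ (0.99 : ℝ))
  have e6 := mul_le_mul_of_nonneg_left e4 (by positivity : 0 ≤ (c - 1) * κ ^ 2)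
  linarith

/-- A nonresonant scale `P` of the right order of magnitude yields a representation. -/
theorem eventually_representation_of_scale {c κ : ℝ} (hc : 1 < c) (hc2 : c < 16 / 15) (hκ : 0 < κ)
    (hκ1 : κ ≤ 1) :
    ∀ᶠ P : ℕ in Filter.atTop, ∀ n : ℕ, 1 ≤ n →
      κ * (n + 1 : ℝ) ^ (1 / c ^ 2) ≤ P →
      (P : ℝ) ^ c / (n + 1) ≤ (n + 1 : ℝ) ^ (1 / c - 1) / 1000 →
      (∀ j k : ℤ, |j| ≤ 2 →
        (c * j * (k * (n + 1 : ℝ) ^ (1 / c - 1)) ≤ k * (n + 1 : ℝ) ^ (1 / c - 1) *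
          (k * (n + 1 : ℝ) ^ (1 / c - 1)) * (1 + (P : ℝ) ^ c / (n + 1) / 2) ∨
        k * (n + 1 : ℝ) ^ (1 / c - 1) * (k * (n + 1 : ℝ) ^ (1 / c - 1)) *
          (1 + 80 * ((P : ℝ) ^ c / (n + 1))) ≤ c * j * (k * (n + 1 : ℝ) ^ (1 / c - 1)))) →
      ∃ m p : ℕ, 0 < m ∧ p.Prime ∧ ⌊(m : ℝ) ^ c⌋ + ⌊(p : ℝ) ^ c⌋ = (n : ℤ) := by
  have hc0 : 0 < c := by linarith
  have hc10 : 0 < c - 1 := by linarith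
  have hbig := (tendsto_rpow_atTop (show (0 : ℝ) < 0.005 by norm_num)).eventually_ge_atTop
    (4 / ((c - 1) * κ ^ 3))
  have hbig2 := (tendsto_rpow_atTop (show (0 : ℝ) < 0.0003 by norm_num)).eventually_gt_atTop
    (392 * 66 / κ)
  filter_upwards [eventually_norm_sum_log_prime_le 400, eventually_le_sum_log_prime,
    tendsto_natCast_atTop_atTop.eventually hbig, tendsto_natCast_atTop_atTop.eventually hbig2,
    Filter.eventually_ge_atTop 1] with P hexp hmain hb1 hb2 hP1 n hn hPlow hvη hgood
  have hn1 : (1 : ℝ) ≤ n := by exact_mod_cast hn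
  have hx1 : (1 : ℝ) ≤ P := by exact_mod_cast hP1
  set x : ℝ := (P : ℝ) with hx
  have hx0 : 0 < x := by linarith
  set N : ℝ := n + 1 with hN
  have hN0 : 0 < N := by linarith
  have hN1 : 1 ≤ N := by linarith
  set η := N ^ (1 / c - 1) with hη
  set R := N ^ (1 - 1 / c) with hR
  set v := x ^ c / N with hv
  have hγ1 : 1 / c ≤ 1 := by rw [div_le_one hc0]; linarith
  have hη0 : 0 < η := by positivity
  have hR1 : 1 ≤ R := Real.one_le_rpow hN1 (by linarith)
  have hηR : η * R = 1 := by rw [hη, hR, ← Real.rpow_add hN0]; simp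
  have hη1 : η ≤ 1 := Real.rpow_le_one_of_one_le_of_nonpos hN1 (by linarith)
  have hvdef : x ^ c = N * v := by rw [hv]; field_simp
  have hRle : R ≤ x ^ (c ^ 2 - c) / κ := by
    have h1 : N ^ (1 / c ^ 2) ≤ x / κ := by rw [le_div_iff₀ hκ]; linarith
    have h2 : 0 ≤ c ^ 2 - c := by nlinarith
    calc R = (N ^ (1 / c ^ 2)) ^ (c ^ 2 - c) := by
          rw [← Real.rpow_mul hN0.le, hR]; congr 1; field_simp
      _ ≤ (x / κ) ^ (c ^ 2 - c) := Real.rpow_le_rpow (by positivity) h1 h2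
      _ = x ^ (c ^ 2 - c) / κ ^ (c ^ 2 - c) := Real.div_rpow hx0.le hκ.le _
      _ ≤ x ^ (c ^ 2 - c) / κ ^ (1 : ℝ) := by
          have := Real.rpow_le_rpow_of_exponent_ge hκ hκ1 (by nlinarith : c ^ 2 - c ≤ 1)
          gcongr
      _ = _ := by rw [Real.rpow_one]
  have e1 : κ ≤ η * x ^ (c ^ 2 - c) := by
    have := mul_le_mul_of_nonneg_left hRle hη0.le
    rw [hηR, mul_div_assoc', le_div_iff₀ hκ] at this
    linarith
  have hℓv : κ ^ 2 * η / 4 ≤ v / 4 := by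
    have h1 : κ ^ 2 * N ^ (1 / c) ≤ x ^ c := by
      calc κ ^ 2 * N ^ (1 / c) ≤ κ ^ c * (N ^ (1 / c ^ 2)) ^ c := by
            have := Real.rpow_le_rpow_of_exponent_ge hκ hκ1 (by linarith : c ≤ 2)
            rw [Real.rpow_two] at this
            rw [← Real.rpow_mul hN0.le, show 1 / c ^ 2 * c = 1 / c by field_simp]
            gcongr
        _ = (κ * N ^ (1 / c ^ 2)) ^ c := (Real.mul_rpow hκ.le (by positivity)).symm
        _ ≤ x ^ c := Real.rpow_le_rpow (by positivity) hPlow hc0.le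
    have h2 : N ^ (1 / c) = η * N := by
      rw [hη, ← Real.rpow_add_one hN0.ne']; congr 1; ring
    have h3 : κ ^ 2 * η ≤ v := by
      rw [hv, le_div_iff₀ hN0]; rw [h2] at h1; linarith
    linarith
  set h := ⌈32 * R⌉₊ with hh
  have hhge : 32 * R ≤ h := Nat.le_ceil _
  have hhle : (h : ℝ) ≤ 33 * R := by
    have : (h : ℝ) < 32 * R + 1 := Nat.ceil_lt_add_one (by linarith)
    linarith
  have hh0 : 0 < h := by
    have : (0 : ℝ) < h := by linarith
    exact_mod_cast this
  have hE : ∀ j k : ℤ, j ≠ 0 ∨ k ≠ 0 → |j| ≤ 2 → |k| ≤ 4 * h →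
      ‖∑ p ∈ Ioc P (4 * P) with p.Prime, ((Real.log p : ℝ) : ℂ) *
        unitExp (j * ((p : ℝ) ^ c - 1 / 2) + k * (N - (p : ℝ) ^ c) ^ (1 / c))‖ ≤
        2 * x ^ (0.9285 : ℝ) := by
    intro j k hjk hj hk
    have hjr : |(j : ℝ)| ≤ 2 := by exact_mod_cast hj
    have hkr : |(k : ℝ)| ≤ 4 * h := by exact_mod_cast hk
    have hkη : |(k : ℝ)| * η ≤ 140 := by
      calc |(k : ℝ)| * η ≤ 4 * (33 * R) * η := by gcongr; linarith
        _ = 132 * (η * R) := by ring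
        _ ≤ 140 := by rw [hηR]; norm_num
    have hjk' : (j : ℝ) = 0 ∧ 1 ≤ |(k : ℝ)| ∨ 1 ≤ |(j : ℝ)| := by
      have : j = 0 ∧ 1 ≤ |k| ∨ 1 ≤ |j| := by
        rcases eq_or_ne j 0 with h | h
        · exact Or.inl ⟨h, Int.one_le_abs (by tauto)⟩
        · exact Or.inr (Int.one_le_abs h)
      exact_mod_cast this
    obtain ⟨F₁, F₂, s₁, s₂, φ₁, φ₂, χ₁, hφ, l₁, u₁, l₂, u₂⟩ := exists_phaseBounds
      (ℓ := κ ^ 2 * η / 4) hc hc2 (by omega) hN1 hη hvdef (by linarith) (by positivity)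
      (by nlinarith) hℓv hjr hkη hjk' (hgood j k hj)
    have low := rpow_le_of_le_mul hc hc2 hx1 hκ hb1 e1
    have up : 400 * x ^ c ≤ 400 * x ^ (16 / 15 : ℝ) := by gcongr
    have key := hexp F₁ F₂ s₁ s₂ (powerPhase c N j k) φ₁ φ₂ χ₁ hφ (low.trans l₁) (u₁.trans up)
      (low.trans l₂) (u₂.trans up)
    simp only [powerPhase] at key
    exact key
  have hSum : 392 * h * (2 * x ^ (0.9285 : ℝ)) <
      ∑ p ∈ Ioc P (4 * P) with p.Prime, Real.log p := by
    refine lt_of_lt_of_le ?_ hmain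
    have e1 : x ^ (c ^ 2 - c) ≤ x ^ (0.0712 : ℝ) :=
      Real.rpow_le_rpow_of_exponent_le hx1 (by nlinarith)
    calc 392 * h * (2 * x ^ (0.9285 : ℝ))
        ≤ 392 * (33 * (x ^ (0.0712 : ℝ) / κ)) * (2 * x ^ (0.9285 : ℝ)) := by
          have : (h : ℝ) ≤ 33 * (x ^ (0.0712 : ℝ) / κ) := hhle.trans (by
            gcongr
            exact hRle.trans (by gcongr))
          gcongr
      _ = 392 * 66 / κ * (x ^ (0.0712 : ℝ) * x ^ (0.9285 : ℝ)) := by ring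
      _ < x ^ (0.0003 : ℝ) * (x ^ (0.0712 : ℝ) * x ^ (0.9285 : ℝ)) := by gcongr
      _ = x := by rw [← Real.rpow_add hx0, ← Real.rpow_add hx0]; norm_num
  obtain ⟨p, hp, hpx, hpy⟩ := exists_near_integers _ (fun p _ => Real.log_natCast_nonneg p)
    (fun p : ℕ => (p : ℝ) ^ c - 1 / 2) (fun p : ℕ => (N - (p : ℝ) ^ c) ^ (1 / c)) hh0 hE hSum
  rw [mem_filter, mem_Ioc] at hp
  have hpc : (p : ℝ) ^ c ≤ N / 2 := by
    have h1 : (p : ℝ) ≤ 4 * x := by rw [hx]; exact_mod_cast hp.1.2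
    calc (p : ℝ) ^ c ≤ (4 * x) ^ c := Real.rpow_le_rpow (by positivity) h1 hc0.le
      _ = 4 ^ c * (N * v) := by rw [Real.mul_rpow (by norm_num) hx0.le, hvdef]
      _ ≤ 4 ^ (2 : ℝ) * (N * (1 / 1000)) := by
          have : (4 : ℝ) ^ c ≤ 4 ^ (2 : ℝ) :=
            Real.rpow_le_rpow_of_exponent_le (by norm_num) (by linarith)
          have : v ≤ 1 / 1000 := by linarith
          gcongr
      _ ≤ N / 2 := by norm_num; linarith
  obtain ⟨m, hm, hmp⟩ := exists_floor_add_floor_eq hc hc2 hn hpc hhge hpx hpy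
  exact ⟨m, p, hm, hp.2, hmp⟩

/-- Every sufficiently large positive integer `n` can be written as
`⌊m^c⌋ + ⌊p^c⌋ = n` with `m` a positive integer and `p` a prime, when `1 < c < 16/15`. -/
theorem floor_power_prime_representation (c : ℝ) (hc1 : 1 < c) (hc2 : c < 16 / 15) :
    ∀ᶠ n : ℕ in Filter.atTop, ∃ m p : ℕ, 0 < m ∧ p.Prime ∧
      ⌊(m : ℝ) ^ c⌋ + ⌊(p : ℝ) ^ c⌋ = (n : ℤ) := by
  have hc0 : 0 < c := by linarith
  obtain ⟨P₁, hP₁⟩ := Filter.eventually_atTop.1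
    (eventually_representation_of_scale hc1 hc2 (show (0 : ℝ) < 1 / (2 * 10 ^ 8) by norm_num)
      (by norm_num))
  have hbig := (tendsto_rpow_atTop (show (0 : ℝ) < 1 / c ^ 2 by positivity)).eventually_ge_atTop
    (10 ^ 8 * (P₁ + 1))
  filter_upwards [tendsto_natCast_atTop_atTop.eventually hbig, Filter.eventually_ge_atTop 1]
    with n hnbig hn
  have hn1 : (1 : ℝ) ≤ n := by exact_mod_cast hn
  set N : ℝ := n + 1 with hN
  have hN0 : 0 < N := by linarith
  set Y := N ^ (1 / c ^ 2) with hY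
  have hY0 : 0 < Y := by positivity
  have hYbig : 10 ^ 8 * ((P₁ : ℝ) + 1) ≤ Y :=
    hnbig.trans (Real.rpow_le_rpow (by linarith) (by linarith) (by positivity))
  set P₀ := ⌊Y / 10 ^ 8⌋₊ with hP₀
  have hP₀le : (P₀ : ℝ) ≤ Y / 10 ^ 8 := Nat.floor_le (by positivity)
  have hP₀gt : Y / 10 ^ 8 < P₀ + 1 := Nat.lt_floor_add_one _
  have hP₁P₀ : P₁ + 1 ≤ P₀ := by
    apply Nat.le_floor
    push_cast
    rw [le_div_iff₀ (by norm_num)]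
    linarith
  have hP₀1 : (1 : ℝ) ≤ P₀ := by exact_mod_cast (by omega : 1 ≤ P₀)
  have hη0 : 0 < N ^ (1 / c - 1) := by positivity
  have hYc : Y ^ c / N = N ^ (1 / c - 1) := by
    rw [hY, ← Real.rpow_mul hN0.le, show 1 / c ^ 2 * c = 1 / c by field_simp,
      Real.rpow_sub_one hN0.ne']
  have hvs : ∀ i : ℕ, 160 * (((160 ^ i * P₀ : ℕ) : ℝ) ^ c / N) ≤
      ((160 ^ (i + 1) * P₀ : ℕ) : ℝ) ^ c / N := by
    intro i
    have h160 : (160 : ℝ) ≤ 160 ^ c := by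
      calc (160 : ℝ) = 160 ^ (1 : ℝ) := (Real.rpow_one _).symm
        _ ≤ _ := Real.rpow_le_rpow_of_exponent_le (by norm_num) hc1.le
    have e : ((160 ^ (i + 1) * P₀ : ℕ) : ℝ) ^ c = 160 ^ c * ((160 ^ i * P₀ : ℕ) : ℝ) ^ c := by
      rw [← Real.mul_rpow (by norm_num) (by positivity)]
      congr 1
      push_cast
      ring
    rw [← mul_div_assoc, e]
    gcongr
  have hv2 : ∀ i ≤ 2, ((160 ^ i * P₀ : ℕ) : ℝ) ^ c / N ≤ N ^ (1 / c - 1) / 1000 := by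
    intro i hi
    have h0 : 160 ^ i * P₀ ≤ 160 ^ 2 * P₀ := by gcongr; norm_num
    have h1 : ((160 ^ i * P₀ : ℕ) : ℝ) ≤ 1 / 1000 * Y := by
      calc ((160 ^ i * P₀ : ℕ) : ℝ) ≤ ((160 ^ 2 * P₀ : ℕ) : ℝ) := by exact_mod_cast h0
        _ ≤ _ := by push_cast; linarith
    have h2 : (1 / 1000 : ℝ) ^ c ≤ 1 / 1000 := by
      calc (1 / 1000 : ℝ) ^ c ≤ (1 / 1000) ^ (1 : ℝ) :=
            Real.rpow_le_rpow_of_exponent_ge (by norm_num) (by norm_num) hc1.le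
        _ = _ := Real.rpow_one _
    calc ((160 ^ i * P₀ : ℕ) : ℝ) ^ c / N ≤ (1 / 1000 * Y) ^ c / N := by gcongr
      _ = (1 / 1000) ^ c * (Y ^ c / N) := by
          rw [Real.mul_rpow (by norm_num) hY0.le, mul_div_assoc]
      _ ≤ 1 / 1000 * N ^ (1 / c - 1) := by rw [hYc]; gcongr
      _ = _ := by ring
  obtain ⟨i, hi, hgood⟩ := exists_nonresonant_scale hc1 hc2 hη0
    (v := fun i => ((160 ^ i * P₀ : ℕ) : ℝ) ^ c / N)
    (fun i => by
      have : (0 : ℝ) < (160 ^ i * P₀ : ℕ) := by push_cast; positivity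
      positivity) hvs (hv2 2 le_rfl)
  have hPP : P₀ ≤ 160 ^ i * P₀ := Nat.le_mul_of_pos_left _ (by positivity)
  refine hP₁ (160 ^ i * P₀) (by omega) n hn ?_ (hv2 i hi) hgood
  calc 1 / (2 * 10 ^ 8) * Y ≤ P₀ := by linarith
    _ ≤ _ := by exact_mod_cast hPP
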